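/- arXiv:2308.11286 — 4 statements merged into one kernel-verified Lean document; each statement's English description precedes it below -/
import Mathlib

section
/- Let f : 𝕋 → ℝ be a piecewise smooth function with discontinuity points γ₁,…,γ_ν and jumps H_i = lim_{δ→0}[f(γ_i − δ) − f(γ_i + δ)]. Define h : 𝕋 → ℝ by h(x) = Σ_{i=1}^{ν} H_i·(ι(x) − 1/2) + Σ_{i=1}^{ν} H_i·(𝟙_{[0,γ_i)}(x) − ι(γ_i)). Then for Haar-almost every α ∈ 𝕋 there exists a constant C = C(f) > 0 such that for every N ∈ ℕ and every y ∈ 𝕋, |S_N(f,α,y) − S_N(h,α,y)| ≤ C. -/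
open MeasureTheory Filter Set Topology

noncomputable def toCircle (x : ℝ) : UnitAddCircle := x

/-- The canonical embedding `ι : 𝕋 → [0,1) ⊆ ℝ`. -/
noncomputable def iota (x : UnitAddCircle) : ℝ := (AddCircle.equivIco 1 0 x : ℝ)

/-- The Birkhoff sum `S_N(f, α, x₀) = ∑_{k=0}^{N-1} f(x₀ + kα)`. -/
noncomputable def birkhoff (f : UnitAddCircle → ℝ) (α x₀ : UnitAddCircle) (N : ℕ) : ℝ :=
  ∑ k ∈ Finset.range N, f (x₀ + k • α)

/-- `f : 𝕋 → ℝ` is piecewise smooth with (ordered) discontinuity points `γ i` and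
jumps `H i`: it has zero mean, it is differentiable away from the `γ i` with derivative
extending to a function of bounded variation on `𝕋`, and at least one jump is nonzero. -/
structure IsPiecewiseSmooth {ν : ℕ} (f : UnitAddCircle → ℝ) (γ : Fin ν → UnitAddCircle)
    (H : Fin ν → ℝ) : Prop where
  integral_zero : ∫ x, f x = 0
  nu_pos : 0 < ν
  strictMono : StrictMono fun i => iota (γ i)
  differentiableAt : ∀ x : ℝ, toCircle x ∉ Set.range γ →
    DifferentiableAt ℝ (fun y : ℝ => f (toCircle y)) x
  exists_deriv_bv : ∃ φ : UnitAddCircle → ℝ,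
    BoundedVariationOn (fun y : ℝ => φ (toCircle y)) (Set.Icc 0 1) ∧
    ∀ x : ℝ, toCircle x ∉ Set.range γ →
      HasDerivAt (fun y : ℝ => f (toCircle y)) (φ (toCircle x)) x
  jump : ∀ i, Filter.Tendsto
    (fun δ : ℝ => f (toCircle (iota (γ i) - δ)) - f (toCircle (iota (γ i) + δ)))
    (nhdsWithin 0 (Set.Ioi 0)) (nhds (H i))
  exists_jump_ne : ∃ i, H i ≠ 0

theorem BoundedVariationOn.intervalIntegrable {ψ : ℝ → ℝ} {a b : ℝ} (hab : a ≤ b)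
    (hψ : BoundedVariationOn ψ (Icc a b)) : IntervalIntegrable ψ volume a b := by
  obtain ⟨p, q, hp, hq, rfl⟩ := hψ.locallyBoundedVariationOn.exists_monotoneOn_sub_monotoneOn
  rw [← uIcc_of_le hab] at hp hq
  exact hp.intervalIntegrable.sub hq.intervalIntegrable

theorem integral_fourier_add_inv_natAbs {n : ℤ} (hn : n ≠ 0) (a : ℝ) :
    ∫ x in a..a + (n.natAbs : ℝ)⁻¹, fourier (-n) (x : UnitAddCircle) = 0 := by
  have hm : (n.natAbs : ℝ) ≠ 0 := by simpa using hn
  rw [intervalIntegral.integral_eq_sub_of_hasDerivAt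
    (fun x _ => has_antideriv_at_fourier_neg (T := 1) ⟨one_pos⟩ hn x)
    ((by fun_prop : Continuous fun x : ℝ => fourier (-n) (x : UnitAddCircle)).intervalIntegrable
      _ _), ← mul_sub, QuotientAddGroup.mk_add]
  have h1 : fourier (-n) (((n.natAbs : ℝ)⁻¹ : ℝ) : UnitAddCircle) = (1 : ℂ) := by
    have h2 : (-n) • (((n.natAbs : ℝ)⁻¹ : ℝ) : UnitAddCircle) = 0 := by
      rw [← AddCircle.coe_zsmul, AddCircle.coe_eq_zero_iff]
      refine ⟨-n.sign, ?_⟩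
      have h3 : ((n.sign * n.natAbs : ℤ) : ℝ) = n := by rw [Int.sign_mul_natAbs]
      push_cast at h3
      simp only [Int.cast_neg, zsmul_eq_mul, mul_one]
      field_simp
      rw [← h3]
      simp
    rw [fourier_apply, h2]
    simp
  rw [fourier_apply, smul_add, AddCircle.toCircle_add, Circle.coe_mul, ← fourier_apply,
    ← fourier_apply, h1]
  simp

theorem norm_integral_fourier_mul_le {ψ : ℝ → ℝ} (hψ : BoundedVariationOn ψ (Icc 0 1))
    {n : ℤ} (hn : n ≠ 0) :
    ‖∫ x in (0 : ℝ)..1, fourier (-n) (x : UnitAddCircle) * (ψ x : ℂ)‖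
      ≤ (eVariationOn ψ (Icc 0 1)).toReal / |(n : ℝ)| := by
  set m := n.natAbs with hm
  have hm0 : 0 < m := Int.natAbs_pos.2 hn
  have hmR : (0 : ℝ) < m := by exact_mod_cast hm0
  have hmabs : |(n : ℝ)| = m := by rw [hm, Nat.cast_natAbs]; simp
  set u : ℕ → ℝ := fun j => j * (m : ℝ)⁻¹ with hu
  have humono : Monotone u := fun i j hij => by simp only [hu]; gcongr
  have hu0 : u 0 = 0 := by simp [hu]
  have hum : u m = 1 := by simp [hu, hmR.ne']
  have hsucc : ∀ j, u (j + 1) = u j + (m : ℝ)⁻¹ := fun j => by simp only [hu]; push_cast; ring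
  have hsub : ∀ j < m, Icc (u j) (u (j + 1)) ⊆ Icc 0 1 := fun j hj => by
    rw [← hu0, ← hum]; exact Icc_subset_Icc (humono (Nat.zero_le _)) (humono hj)
  have hbv : ∀ j < m, BoundedVariationOn ψ (Icc (u j) (u (j + 1))) :=
    fun j hj => hψ.mono (hsub j hj)
  have hint0 : ∀ j < m, IntervalIntegrable (fun x => (ψ x : ℂ)) volume (u j) (u (j + 1)) :=
    fun j hj => by
      have h := (hbv j hj).intervalIntegrable (humono j.le_succ)
      exact ⟨h.1.ofReal, h.2.ofReal⟩
  have hc : Continuous fun x : ℝ => fourier (-n) (x : UnitAddCircle) := by fun_prop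
  have hint : ∀ j < m, IntervalIntegrable
      (fun x : ℝ => fourier (-n) (x : UnitAddCircle) * (ψ x : ℂ)) volume (u j) (u (j + 1)) :=
    fun j hj => (hint0 j hj).continuousOn_mul hc.continuousOn
  rw [hmabs]
  calc ‖∫ x in (0 : ℝ)..1, fourier (-n) (x : UnitAddCircle) * (ψ x : ℂ)‖
      = ‖∑ j ∈ Finset.range m,
          ∫ x in u j..u (j + 1), fourier (-n) (x : UnitAddCircle) * (ψ x : ℂ)‖ := by
        rw [intervalIntegral.sum_integral_adjacent_intervals hint, hu0, hum]
    _ ≤ ∑ j ∈ Finset.range m, (eVariationOn ψ (Icc (u j) (u (j + 1)))).toReal * (m : ℝ)⁻¹ := by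
        refine norm_sum_le_of_le _ fun j hj => ?_
        have hj := Finset.mem_range.1 hj
        have h1 : ∫ x in u j..u (j + 1), fourier (-n) (x : UnitAddCircle) * (ψ x : ℂ)
            = ∫ x in u j..u (j + 1),
                fourier (-n) (x : UnitAddCircle) * ((ψ x : ℂ) - (ψ (u j) : ℂ)) := by
          simp_rw [mul_sub]
          rw [intervalIntegral.integral_sub (hint j hj)
            ((hc.intervalIntegrable _ _).mul_const _),
            intervalIntegral.integral_mul_const, hsucc, integral_fourier_add_inv_natAbs hn]
          simp
        rw [h1]
        refine (intervalIntegral.norm_integral_le_of_norm_le_const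
          (C := (eVariationOn ψ (Icc (u j) (u (j + 1)))).toReal) fun x hx => ?_).trans_eq ?_
        · rw [uIoc_of_le (humono j.le_succ)] at hx
          rw [norm_mul, ← Complex.ofReal_sub, Complex.norm_real, fourier_apply, Circle.norm_coe,
            one_mul, ← dist_eq_norm]
          exact (hbv j hj).dist_le (Ioc_subset_Icc_self hx) (left_mem_Icc.2 (humono j.le_succ))
        · rw [hsucc, add_sub_cancel_left, abs_of_pos (inv_pos.2 hmR)]
    _ = (eVariationOn ψ (Icc 0 1)).toReal / m := by
        rw [← Finset.sum_mul, ← ENNReal.toReal_sum fun j hj => hbv j (Finset.mem_range.1 hj),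
          eVariationOn.sum' ψ humono, hu0, hum, div_eq_mul_inv]

theorem four_mul_abs_le_norm_fourier_one_sub_one {x : ℝ} (hx : |x| ≤ 1 / 2) :
    4 * |x| ≤ ‖fourier 1 (x : UnitAddCircle) - 1‖ := by
  have h1 : fourier 1 (x : UnitAddCircle) = Complex.exp (Complex.I * (2 * Real.pi * x : ℝ)) := by
    rw [fourier_coe_apply]
    congr 1
    push_cast
    ring
  rw [h1, Complex.norm_exp_I_mul_ofReal_sub_one, norm_mul, Real.norm_two, Real.norm_eq_abs]
  have hpi := Real.pi_pos
  have h2 : |2 * Real.pi * x / 2| = Real.pi * |x| := by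
    rw [show 2 * Real.pi * x / 2 = Real.pi * x by ring, abs_mul, abs_of_pos hpi]
  have h3 := Real.mul_abs_le_abs_sin (x := 2 * Real.pi * x / 2) (by rw [h2]; nlinarith)
  rw [h2] at h3
  have h4 : 2 / Real.pi * (Real.pi * |x|) = 2 * |x| := by field_simp
  linarith

theorem intervalIntegrable_abs_rpow {r : ℝ} (hr : -1 < r) :
    IntervalIntegrable (fun x : ℝ => |x| ^ r) volume (-(1 / 2)) (1 / 2) := by
  have h1 : IntervalIntegrable (fun x : ℝ => |x| ^ r) volume 0 (1 / 2) := by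
    refine (intervalIntegral.intervalIntegrable_rpow' hr).congr fun x hx => ?_
    rw [uIoc_of_le (by norm_num)] at hx
    simp only [abs_of_pos hx.1]
  have h2 : IntervalIntegrable (fun x : ℝ => |x| ^ r) volume 0 (-(1 / 2)) := by
    simpa using (IntervalIntegrable.iff_comp_neg (f := fun x : ℝ => |x| ^ r)).1 h1
  exact h2.symm.trans h1

theorem lintegral_enorm_fourier_one_sub_one_rpow_lt_top :
    ∫⁻ x : UnitAddCircle, ‖fourier 1 x - 1‖ₑ ^ (-(3 / 4) : ℝ) < ⊤ := by
  rw [← UnitAddCircle.lintegral_preimage (-(1 / 2))]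
  have h1 := (intervalIntegrable_abs_rpow (r := -(3 / 4)) (by norm_num)).1
  have h2 : (-(1 / 2) + 1 : ℝ) = 1 / 2 := by norm_num
  rw [h2]
  refine lt_of_le_of_lt (lintegral_mono_ae ?_) h1.2
  have h0 : ∀ᵐ x ∂(volume.restrict (Ioc (-(1 / 2)) (1 / 2)) : Measure ℝ), x ≠ 0 :=
    ae_restrict_of_ae (by simp [ae_iff])
  filter_upwards [ae_restrict_mem measurableSet_Ioc, h0] with x hx hx0
  have h3 : 0 < |x| := abs_pos.2 hx0
  rw [Real.enorm_eq_ofReal (by positivity), ← ENNReal.ofReal_rpow_of_pos h3, ENNReal.rpow_neg,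
    ENNReal.rpow_neg, ENNReal.inv_le_inv]
  refine ENNReal.rpow_le_rpow ?_ (by norm_num)
  rw [← ofReal_norm]
  refine ENNReal.ofReal_le_ofReal ?_
  have := four_mul_abs_le_norm_fourier_one_sub_one (abs_le.2 ⟨hx.1.le, hx.2⟩)
  linarith

theorem ae_summable_inv_sq_mul_norm_fourier_sub_one :
    ∀ᵐ α : UnitAddCircle, (∀ n : ℤ, n ≠ 0 → fourier n α ≠ 1) ∧
      Summable fun n : ℤ => ((n : ℝ) ^ 2 * ‖fourier n α - 1‖)⁻¹ := by
  set W : UnitAddCircle → ENNReal := fun x => ‖fourier 1 x - 1‖ₑ ^ (-(3 / 4) : ℝ) with hW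
  have hWm : Measurable W := by
    have : Continuous fun x : UnitAddCircle => fourier 1 x - 1 := by fun_prop
    exact (this.measurable.enorm).pow_const _
  have hWn : ∀ (a : ENNReal) (n : ℤ), Measurable fun α => a * W (n • α) :=
    fun a n => (hWm.comp (measurable_const_smul n)).const_mul a
  set c : ℤ → ENNReal := fun n => if n = 0 then 0 else ‖(n : ℝ) ^ 2‖ₑ ^ (-(3 / 4) : ℝ) with hc
  have hc0 : ∀ n : ℤ, n ≠ 0 → c n = ENNReal.ofReal (|(n : ℝ)| ^ (-(3 / 2) : ℝ)) := by
    intro n hn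
    have hn' : (0 : ℝ) < |(n : ℝ)| := by positivity
    simp only [hc, hn, if_false]
    rw [Real.enorm_eq_ofReal (by positivity), ENNReal.ofReal_rpow_of_pos (by positivity),
      ← sq_abs, ← Real.rpow_natCast, ← Real.rpow_mul hn'.le]
    norm_num
  have hcsum : ∑' n, c n ≠ ⊤ := by
    have h1 : Summable fun n : ℤ => |(n : ℝ)| ^ (-(3 / 2) : ℝ) :=
      Real.summable_abs_int_rpow (by norm_num)
    refine ne_top_of_le_ne_top h1.tsum_ofReal_ne_top (ENNReal.tsum_le_tsum fun n => ?_)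
    by_cases hn : n = 0
    · simp [hc, hn]
    · exact (hc0 n hn).le
  have hfin : ∫⁻ α : UnitAddCircle, ∑' n : ℤ, c n * W (n • α) ≠ ⊤ := by
    rw [lintegral_tsum fun n => (hWn _ n).aemeasurable]
    have h1 : ∀ n : ℤ, ∫⁻ α : UnitAddCircle, c n * W (n • α) = c n * ∫⁻ α, W α := by
      intro n
      by_cases hn : n = 0
      · simp [hc, hn]
      · rw [lintegral_const_mul _ (by simpa using hWn 1 n),
          (Measure.measurePreserving_zsmul volume hn).lintegral_comp hWm]
    simp_rw [h1]
    rw [ENNReal.tsum_mul_right]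
    exact ENNReal.mul_ne_top hcsum lintegral_enorm_fourier_one_sub_one_rpow_lt_top.ne
  filter_upwards [ae_lt_top (Measurable.tsum fun n => hWn _ n) hfin] with α hα
  have hterm : ∀ n : ℤ, n ≠ 0 → c n * W (n • α)
      = (‖(n : ℝ) ^ 2‖ₑ * ‖fourier n α - 1‖ₑ) ^ (-(3 / 4) : ℝ) := by
    intro n hn
    have h1 : fourier 1 (n • α) = fourier n α := by simp [fourier_apply]
    simp only [hc, hW, hn, if_false]
    have h2 : ‖(n : ℝ) ^ 2‖ₑ ≠ 0 := by simpa using hn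
    by_cases h3 : ‖fourier n α - 1‖ₑ = 0
    · rw [h1, h3, mul_zero, ENNReal.zero_rpow_of_neg (by norm_num), ENNReal.mul_top]
      rw [ne_eq, ENNReal.rpow_eq_zero_iff]
      simp [hn]
    · rw [h1, ENNReal.mul_rpow_of_ne_zero h2 h3]
  have hne : ∀ n : ℤ, n ≠ 0 → fourier n α ≠ 1 := by
    intro n hn h
    have h1 := ENNReal.ne_top_of_tsum_ne_top hα.ne n
    rw [hterm n hn, h] at h1
    simp at h1
  refine ⟨hne, ?_⟩
  have hs := ENNReal.summable_toReal hα.ne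
  have hs' : Summable fun n : ℤ => ((n : ℝ) ^ 2 * ‖fourier n α - 1‖)⁻¹ ^ (3 / 4 : ℝ) := by
    refine hs.congr fun n => ?_
    by_cases hn : n = 0
    · simp [hc, hn]
    · rw [hterm n hn, ← enorm_norm (fourier n α - 1), ← enorm_mul, ← ENNReal.toReal_rpow,
        toReal_enorm, Real.norm_of_nonneg (by positivity), Real.rpow_neg (by positivity),
        Real.inv_rpow (by positivity)]
  refine .of_norm_bounded_eventually hs' ?_
  filter_upwards [hs'.tendsto_cofinite_zero.eventually_le_const one_pos] with n hn
  have h0 : 0 ≤ ((n : ℝ) ^ 2 * ‖fourier n α - 1‖)⁻¹ := by positivity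
  rw [Real.norm_of_nonneg h0]
  have h1 : ((n : ℝ) ^ 2 * ‖fourier n α - 1‖)⁻¹ ≤ 1 := by
    by_contra! h
    exact absurd hn (not_le.2 (Real.one_lt_rpow h (by norm_num)))
  exact Real.self_le_rpow_of_le_one h0 h1 (by norm_num)

theorem norm_birkhoff_sum_le_of_norm_fourierCoeff_le {g : C(UnitAddCircle, ℂ)} {c : ℝ}
    (hg : ∀ n : ℤ, ‖fourierCoeff g n‖ ≤ c / (n : ℝ) ^ 2) {α : UnitAddCircle}
    (hα : ∀ n : ℤ, n ≠ 0 → fourier n α ≠ 1)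
    (hs : Summable fun n : ℤ => ((n : ℝ) ^ 2 * ‖fourier n α - 1‖)⁻¹) (N : ℕ)
    (y : UnitAddCircle) :
    ‖∑ k ∈ Finset.range N, g (y + k • α)‖
      ≤ ∑' n : ℤ, c * 2 * ((n : ℝ) ^ 2 * ‖fourier n α - 1‖)⁻¹ := by
  have hc : Summable (fourierCoeff g) := by
    refine .of_norm_bounded (g := fun n : ℤ => c * (1 / (n : ℝ) ^ 2))
      ((Real.summable_one_div_int_pow.2 one_lt_two).mul_left c) fun n => ?_
    rw [mul_one_div]
    exact hg n
  have hsum : HasSum (fun n : ℤ => ∑ k ∈ Finset.range N, fourierCoeff g n • fourier n (y + k • α))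
      (∑ k ∈ Finset.range N, g (y + k • α)) :=
    hasSum_sum fun k _ => has_pointwise_sum_fourier_series_of_summable hc _
  rw [← hsum.tsum_eq]
  refine tsum_of_norm_bounded (hs.mul_left (c * 2)).hasSum fun n => ?_
  rcases eq_or_ne n 0 with rfl | hn
  · have : fourierCoeff g 0 = 0 := by simpa using hg 0
    simp [this]
  have hz : fourier n α - 1 ≠ 0 := sub_ne_zero.2 (hα n hn)
  have hgeom : ∑ k ∈ Finset.range N, fourierCoeff g n • fourier n (y + k • α)
      = fourierCoeff g n * (fourier n y * (((fourier n α) ^ N - 1) / (fourier n α - 1))) := by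
    rw [← geom_sum_eq (hα n hn), Finset.mul_sum, Finset.mul_sum]
    refine Finset.sum_congr rfl fun k _ => ?_
    simp only [smul_eq_mul, fourier_apply, smul_add, smul_comm n k, AddCircle.toCircle_add,
      AddCircle.toCircle_nsmul, Circle.coe_mul, Circle.coe_pow]
  have h1 : ∀ x, ‖fourier n (x : UnitAddCircle)‖ = 1 := fun x => by
    rw [fourier_apply, Circle.norm_coe]
  have h2 : ‖(fourier n α) ^ N - 1‖ ≤ 2 := by
    refine (norm_sub_le _ _).trans ?_
    rw [norm_pow, h1, one_pow, norm_one]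
    norm_num
  rw [hgeom, norm_mul, norm_mul, h1, one_mul, norm_div]
  calc ‖fourierCoeff g n‖ * (‖(fourier n α) ^ N - 1‖ / ‖fourier n α - 1‖)
      ≤ c / (n : ℝ) ^ 2 * (2 / ‖fourier n α - 1‖) :=
        mul_le_mul (hg n) (by gcongr) (by positivity) ((norm_nonneg _).trans (hg n))
    _ = c * 2 * ((n : ℝ) ^ 2 * ‖fourier n α - 1‖)⁻¹ := by
        rw [mul_inv]
        ring

theorem exists_forall_notMem_eq_const_add_integral {F ψ : ℝ → ℝ} {P : Set ℝ}
    (hP : ∀ x, ∀ᶠ y in 𝓝[≠] x, y ∉ P) (hψ : ∀ a b, IntervalIntegrable ψ volume a b)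
    (hF : ∀ x ∉ P, HasDerivAt F (ψ x) x)
    (hjump : ∀ p ∈ P, Tendsto (fun δ => F (p - δ) - F (p + δ)) (𝓝[>] 0) (𝓝 0)) :
    ∃ c, ∀ x ∉ P, F x = c + ∫ t in (0 : ℝ)..x, ψ t := by
  set G : ℝ → ℝ := fun x => ∫ t in (0 : ℝ)..x, ψ t with hG
  have hGc : Continuous G := intervalIntegral.continuous_primitive hψ 0
  set D : ℝ → ℝ := fun x => F x - G x with hD
  have hconst : ∀ a b, a ≤ b → (∀ x ∈ Icc a b, x ∉ P) → D b = D a := by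
    intro a b hab hx
    have h1 := intervalIntegral.integral_eq_sub_of_hasDerivAt
      (fun x hx' => hF x (hx x (by rwa [uIcc_of_le hab] at hx'))) (hψ a b)
    have h2 := intervalIntegral.integral_add_adjacent_intervals (hψ 0 a) (hψ a b)
    simp only [hD, hG]
    linarith
  have hloc : ∀ x, ∃ c, ∀ᶠ y in 𝓝[≠] x, D y = c := by
    intro x
    obtain ⟨ε, hε, hball⟩ := Metric.mem_nhdsWithin_iff.1 (hP x)
    have hnot : ∀ y, |y - x| < ε → y ≠ x → y ∉ P := fun y hy hyx => hball ⟨hy, hyx⟩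
    have hleft : ∀ y, x - ε < y → y < x → D y = D (x - ε / 2) := by
      intro y h1 h2
      rcases le_total y (x - ε / 2) with h | h
      · refine (hconst _ _ h fun z hz => hnot z ?_ ?_).symm
        · rw [abs_lt]; constructor <;> linarith [hz.1, hz.2]
        · exact (show z < x by linarith [hz.2]).ne
      · refine hconst _ _ h fun z hz => hnot z ?_ ?_
        · rw [abs_lt]; constructor <;> linarith [hz.1, hz.2]
        · exact (hz.2.trans_lt h2).ne
    have hright : ∀ y, x < y → y < x + ε → D y = D (x + ε / 2) := by
      intro y h1 h2
      rcases le_total y (x + ε / 2) with h | h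
      · refine (hconst _ _ h fun z hz => hnot z ?_ ?_).symm
        · rw [abs_lt]; constructor <;> linarith [hz.1, hz.2]
        · exact (h1.trans_le hz.1).ne'
      · refine hconst _ _ h fun z hz => hnot z ?_ ?_
        · rw [abs_lt]; constructor <;> linarith [hz.1, hz.2]
        · exact (show x < z by linarith [hz.1]).ne'
    have heq : D (x + ε / 2) = D (x - ε / 2) := by
      by_cases hx : x ∈ P
      · have h1 : Tendsto (fun δ => D (x - δ) - D (x + δ)) (𝓝[>] 0) (𝓝 0) := by
          have h2 : Tendsto (fun δ => G (x - δ) - G (x + δ)) (𝓝[>] 0) (𝓝 0) := by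
            have : Continuous fun δ => G (x - δ) - G (x + δ) := by fun_prop
            simpa using (this.tendsto 0).mono_left nhdsWithin_le_nhds
          simpa [hD, sub_sub_sub_comm] using (hjump x hx).sub h2
        have h2 : ∀ᶠ δ in 𝓝[>] (0 : ℝ), D (x - δ) - D (x + δ) = D (x - ε / 2) - D (x + ε / 2) := by
          filter_upwards [Ioo_mem_nhdsGT hε] with δ hδ
          rw [hleft (x - δ) (by linarith [hδ.2]) (by linarith [hδ.1]),
            hright (x + δ) (by linarith [hδ.1]) (by linarith [hδ.2])]
        have h3 := tendsto_nhds_unique (tendsto_const_nhds.congr' (h2.mono fun _ h => h.symm)) h1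
        linarith
      · refine hconst _ _ (by linarith) fun z hz => ?_
        rcases eq_or_ne z x with rfl | hzx
        · exact hx
        · refine hnot z ?_ hzx
          rw [abs_lt]; constructor <;> linarith [hz.1, hz.2]
    refine ⟨D (x - ε / 2), Metric.mem_nhdsWithin_iff.2 ⟨ε, hε, ?_⟩⟩
    rintro y ⟨hy, hyx⟩
    have hy := abs_lt.1 (show |y - x| < ε from hy)
    rcases lt_or_gt_of_ne hyx with h | h
    · exact hleft y (by linarith [hy.1]) h
    · exact (hright y h (by linarith [hy.2])).trans heq
  choose c hc using hloc
  have hcc : IsLocallyConstant c := by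
    rw [IsLocallyConstant.iff_eventually_eq]
    intro x
    have h1 : ∀ᶠ y in 𝓝[≠] x, c y = c x := by
      filter_upwards [eventually_eventually_nhdsWithin.2 (hc x), self_mem_nhdsWithin] with y hy hyx
      rw [IsOpen.nhdsWithin_eq isOpen_compl_singleton hyx] at hy
      obtain ⟨z, hz1, hz2⟩ := ((hc y).and (hy.filter_mono nhdsWithin_le_nhds)).exists
      exact hz1.symm.trans hz2
    rw [eventually_nhdsWithin_iff] at h1
    filter_upwards [h1] with y hy
    rcases eq_or_ne y x with rfl | hyx
    · rfl
    · exact hy hyx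
  refine ⟨c 0, fun x hx => ?_⟩
  have hDx : ContinuousAt D x := (hF x hx).continuousAt.sub hGc.continuousAt
  have h1 := tendsto_nhds_unique (tendsto_const_nhds.congr' ((hc x).mono fun _ h => h.symm))
    (hDx.tendsto.mono_left nhdsWithin_le_nhds)
  rw [hcc.apply_eq_of_preconnectedSpace x 0] at h1
  simp only [hD] at h1
  linarith

theorem hasDerivAt_fract {x : ℝ} (hx : x ∉ range ((↑) : ℤ → ℝ)) :
    HasDerivAt (Int.fract : ℝ → ℝ) 1 x := by
  have hlt : (⌊x⌋ : ℝ) < x := lt_of_le_of_ne (Int.floor_le x) fun h => hx ⟨_, h⟩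
  have h1 : Int.fract =ᶠ[𝓝 x] fun y => y - (⌊x⌋ : ℝ) := by
    filter_upwards [Ioo_mem_nhds hlt (Int.lt_floor_add_one x)] with y hy
    rw [Int.fract, Int.floor_eq_iff.2 ⟨hy.1.le, hy.2⟩]
  exact ((hasDerivAt_id x).sub_const _).congr_of_eventuallyEq h1

theorem tendsto_fract_sub_sub_fract_add (n : ℤ) :
    Tendsto (fun δ : ℝ => Int.fract (n - δ) - Int.fract (n + δ)) (𝓝[>] 0) (𝓝 1) := by
  have h1 : Tendsto (fun δ : ℝ => (n : ℝ) - δ) (𝓝[>] 0) (𝓝[<] n) := by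
    refine tendsto_nhdsWithin_iff.2 ⟨?_, ?_⟩
    · exact ((continuous_const.sub continuous_id).tendsto' (0 : ℝ) _ (by simp)).mono_left
        nhdsWithin_le_nhds
    · filter_upwards [self_mem_nhdsWithin] with δ hδ
      simpa using hδ
  have h2 : Tendsto (fun δ : ℝ => (n : ℝ) + δ) (𝓝[>] 0) (𝓝[≥] n) := by
    refine tendsto_nhdsWithin_iff.2 ⟨?_, ?_⟩
    · exact ((continuous_const.add continuous_id).tendsto' (0 : ℝ) _ (by simp)).mono_left
        nhdsWithin_le_nhds
    · filter_upwards [self_mem_nhdsWithin] with δ hδ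
      simpa using (le_of_lt hδ : (0 : ℝ) ≤ δ)
  simpa using ((tendsto_fract_left' n).comp h1).sub ((tendsto_fract_right' n).comp h2)

theorem iota_toCircle (x : ℝ) : iota (toCircle x) = Int.fract x :=
  (AddCircle.coe_equivIco_mk_apply (1 : ℝ) x).trans (by simp)

theorem toCircle_iota (x : UnitAddCircle) : toCircle (iota x) = x :=
  AddCircle.coe_equivIco

theorem iota_mem_Ico (x : UnitAddCircle) : iota x ∈ Ico (0 : ℝ) 1 := by
  simpa [iota] using (AddCircle.equivIco 1 0 x).2

theorem fract_add_ite_sub_eq_fract_sub (x : ℝ) {c : ℝ} (hc : c ∈ Ico (0 : ℝ) 1) :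
    Int.fract x + ((if Int.fract x < c then (1 : ℝ) else 0) - c) = Int.fract (x - c) := by
  have h0 := Int.fract_nonneg x
  have h1 := Int.fract_lt_one x
  symm
  rw [Int.fract_eq_iff]
  split_ifs with h
  · exact ⟨by linarith [hc.2], by linarith, ⌊x⌋ - 1, by
      push_cast; linarith [Int.floor_add_fract x]⟩
  · exact ⟨by linarith, by linarith [hc.1], ⌊x⌋, by linarith [Int.floor_add_fract x]⟩

theorem integral_fract_sub (c : ℝ) : ∫ x in (0 : ℝ)..1, Int.fract (x - c) = 1 / 2 := by
  have hper : Function.Periodic (fun x : ℝ => Int.fract x) 1 := Int.fract_periodic ℝ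
  rw [intervalIntegral.integral_comp_sub_right (fun x : ℝ => Int.fract x) c]
  have h1 := hper.intervalIntegral_add_eq (0 - c) 0
  rw [show 0 - c + 1 = 1 - c by ring, zero_add] at h1
  rw [h1]
  have h2 : ∫ x in (0 : ℝ)..1, Int.fract x = ∫ x in (0 : ℝ)..1, x := by
    refine intervalIntegral.integral_congr_ae ?_
    have : ∀ᵐ x : ℝ, x ≠ 1 := by simp [ae_iff]
    filter_upwards [this] with x hx hx'
    rw [uIoc_of_le zero_le_one] at hx'
    exact Int.fract_eq_self.2 ⟨hx'.1.le, lt_of_le_of_ne hx'.2 hx⟩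
  rw [h2, integral_id]
  norm_num

theorem fourierCoeff_ofReal_eq {g : C(UnitAddCircle, ℝ)} {ψ : ℝ → ℝ} {P : Set ℝ}
    (hP : P.Countable) (hd : ∀ x ∉ P, HasDerivAt (fun y : ℝ => g y) (ψ x) x)
    (hψ : IntervalIntegrable ψ volume 0 1) {n : ℤ} (hn : n ≠ 0) :
    fourierCoeff (fun x => (g x : ℂ)) n = 1 / (2 * Real.pi * Complex.I * n) *
      ∫ x in (0 : ℝ)..1, fourier (-n) (x : UnitAddCircle) * (ψ x : ℂ) := by
  set A : ℂ := 1 / (-2 * Real.pi * Complex.I * n) with hA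
  have he : Continuous fun x : ℝ => fourier (-n) (x : UnitAddCircle) := by fun_prop
  have hgc : Continuous fun x : ℝ => (g (x : UnitAddCircle) : ℂ) := by fun_prop
  have hi1 : IntervalIntegrable
      (fun x : ℝ => fourier (-n) (x : UnitAddCircle) * (g (x : UnitAddCircle) : ℂ)) volume 0 1 :=
    (he.mul hgc).intervalIntegrable _ _
  have hψ' : IntervalIntegrable (fun x => (ψ x : ℂ)) volume 0 1 := ⟨hψ.1.ofReal, hψ.2.ofReal⟩
  have hi2 : IntervalIntegrable
      (fun x : ℝ => A * fourier (-n) (x : UnitAddCircle) * (ψ x : ℂ)) volume 0 1 :=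
    hψ'.continuousOn_mul (continuous_const.mul he).continuousOn
  have h1 := integral_eq_of_hasDerivAt_off_countable (a := 0) (b := 1)
    (fun x : ℝ => A * fourier (-n) (x : UnitAddCircle) * (g (x : UnitAddCircle) : ℂ))
    (fun x : ℝ => fourier (-n) (x : UnitAddCircle) * (g (x : UnitAddCircle) : ℂ)
      + A * fourier (-n) (x : UnitAddCircle) * (ψ x : ℂ)) hP
    ((continuous_const.mul he).mul hgc).continuousOn
    (fun x hx => by
      have h2 := has_antideriv_at_fourier_neg (T := 1) ⟨one_pos⟩ hn x
      rw [Complex.ofReal_one] at h2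
      exact h2.mul (hd x hx.2).ofReal_comp)
    (hi1.add hi2)
  rw [intervalIntegral.integral_add hi1 hi2] at h1
  have h0 : ((1 : ℝ) : UnitAddCircle) = ((0 : ℝ) : UnitAddCircle) := by simp
  rw [h0, sub_self] at h1
  simp_rw [mul_assoc] at h1
  rw [intervalIntegral.integral_const_mul] at h1
  rw [fourierCoeff_eq_intervalIntegral _ n 0]
  simp only [smul_eq_mul, zero_add, div_one, one_smul]
  rw [eq_neg_of_add_eq_zero_left h1, hA, ← neg_mul]
  congr 1
  rw [neg_mul, neg_mul, neg_mul, one_div, one_div, inv_neg, neg_neg]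

theorem norm_fourierCoeff_ofReal_le {g : C(UnitAddCircle, ℝ)} {ψ : ℝ → ℝ} {P : Set ℝ}
    (hP : P.Countable) (hd : ∀ x ∉ P, HasDerivAt (fun y : ℝ => g y) (ψ x) x)
    (hψ : BoundedVariationOn ψ (Icc 0 1)) {n : ℤ} (hn : n ≠ 0) :
    ‖fourierCoeff (fun x => (g x : ℂ)) n‖
      ≤ (eVariationOn ψ (Icc 0 1)).toReal / (n : ℝ) ^ 2 := by
  have hn' : 0 < |(n : ℝ)| := by positivity
  rw [fourierCoeff_ofReal_eq hP hd (hψ.intervalIntegrable zero_le_one) hn, norm_mul]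
  have h1 : ‖1 / (2 * (Real.pi : ℂ) * Complex.I * n)‖ ≤ 1 / |(n : ℝ)| := by
    simp only [norm_div, norm_mul, norm_one, RCLike.norm_ofNat, Complex.norm_real,
      Complex.norm_I, mul_one, Complex.norm_intCast, Real.norm_eq_abs, abs_of_pos Real.pi_pos]
    gcongr
    nlinarith [Real.pi_gt_three]
  refine (mul_le_mul h1 (norm_integral_fourier_mul_le hψ hn) (norm_nonneg _)
    (by positivity)).trans_eq ?_
  rw [← sq_abs (n : ℝ)]
  field_simp

theorem birkhoff_sub (f h : UnitAddCircle → ℝ) (α y : UnitAddCircle) (N : ℕ) :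
    birkhoff f α y N - birkhoff h α y N = birkhoff (f - h) α y N := by
  simp [birkhoff]

theorem abs_birkhoff_le_of_finite_support {e : UnitAddCircle → ℝ} {S : Finset UnitAddCircle}
    (he : ∀ x ∉ S, e x = 0) {α : UnitAddCircle} (hα : ∀ n : ℤ, n ≠ 0 → fourier n α ≠ 1)
    (N : ℕ) (y : UnitAddCircle) : |birkhoff e α y N| ≤ ∑ x ∈ S, |e x| := by
  classical
  have hinj : Function.Injective fun k : ℕ => y + k • α := by
    intro k l hkl
    by_contra hne
    refine hα (k - l) (sub_ne_zero.2 (by exact_mod_cast hne)) ?_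
    have h1 : (k : ℤ) • α - (l : ℤ) • α = 0 := by
      rw [sub_eq_zero, natCast_zsmul, natCast_zsmul]
      exact add_left_cancel hkl
    rw [fourier_apply, sub_zsmul, ← sub_eq_add_neg, h1]
    simp
  set T := (Finset.range N).image fun k : ℕ => y + k • α with hT
  calc |birkhoff e α y N| ≤ ∑ k ∈ Finset.range N, |e (y + k • α)| :=
        Finset.abs_sum_le_sum_abs _ _
    _ = ∑ x ∈ T, |e x| := (Finset.sum_image (f := fun x => |e x|) hinj.injOn).symm
    _ ≤ ∑ x ∈ T ∪ S, |e x| :=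
        Finset.sum_le_sum_of_subset_of_nonneg Finset.subset_union_left fun _ _ _ => abs_nonneg _
    _ = ∑ x ∈ S, |e x| :=
        (Finset.sum_subset Finset.subset_union_right fun x _ hx => by simp [he x hx]).symm

theorem toCircle_eq_iff {x : ℝ} {γ : UnitAddCircle} :
    toCircle x = γ ↔ x - iota γ ∈ range ((↑) : ℤ → ℝ) := by
  conv_lhs => rw [← toCircle_iota γ]
  rw [toCircle, toCircle, ← sub_eq_zero, ← AddCircle.coe_sub, AddCircle.coe_eq_zero_iff]
  simp

theorem eventually_nhdsNE_sub_notMem_range_intCast (c x : ℝ) :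
    ∀ᶠ y in 𝓝[≠] x, y - c ∉ range ((↑) : ℤ → ℝ) := by
  have h1 : x ∈ Ioo ((⌈x - c⌉ : ℝ) - 1 + c) (⌊x - c⌋ + 1 + c) :=
    ⟨by linarith [Int.ceil_lt_add_one (x - c)], by linarith [Int.lt_floor_add_one (x - c)]⟩
  filter_upwards [mem_nhdsWithin_of_mem_nhds (isOpen_Ioo.mem_nhds h1), self_mem_nhdsWithin]
    with y hy hne
  rintro ⟨n, hn⟩
  have h2 : ⌈x - c⌉ - 1 < n := by
    have := hy.1
    exact_mod_cast (by push_cast; linarith : ((⌈x - c⌉ - 1 : ℤ) : ℝ) < n)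
  have h3 : n < ⌊x - c⌋ + 1 := by
    have := hy.2
    exact_mod_cast (by push_cast; linarith : (n : ℝ) < ((⌊x - c⌋ + 1 : ℤ) : ℝ))
  have h4 : (⌈x - c⌉ : ℝ) ≤ n := by exact_mod_cast (by omega : ⌈x - c⌉ ≤ n)
  have h5 : (n : ℝ) ≤ ⌊x - c⌋ := by exact_mod_cast (by omega : n ≤ ⌊x - c⌋)
  refine hne ?_
  rw [mem_singleton_iff]
  linarith [Int.le_ceil (x - c), Int.floor_le (x - c)]

/-- The real preimage of a finite family of points of the circle is discrete. -/
theorem eventually_nhdsNE_toCircle_notMem_range {ν : ℕ} (γ : Fin ν → UnitAddCircle) (x : ℝ) :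
    ∀ᶠ y in 𝓝[≠] x, y ∉ toCircle ⁻¹' range γ := by
  filter_upwards [eventually_all.2 fun i =>
    eventually_nhdsNE_sub_notMem_range_intCast (iota (γ i)) x] with y hy
  rintro ⟨i, hi⟩
  exact hy i (toCircle_eq_iff.1 hi.symm)

theorem countable_preimage_toCircle_range {ν : ℕ} (γ : Fin ν → UnitAddCircle) :
    (toCircle ⁻¹' range γ).Countable := by
  refine (countable_range fun p : Fin ν × ℤ => iota (γ p.1) + p.2).mono ?_
  rintro x ⟨i, hi⟩
  obtain ⟨n, hn⟩ := toCircle_eq_iff.1 hi.symm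
  exact ⟨(i, n), by simp [hn]⟩

/-- The sum of sawtooth functions with jumps `H i` at the integer translates of `c i`. -/
noncomputable def sawtoothSum {ν : ℕ} (c H : Fin ν → ℝ) (x : ℝ) : ℝ :=
  ∑ i, H i * (Int.fract (x - c i) - 1 / 2)

section sawtoothSum

variable {ν : ℕ} {c H : Fin ν → ℝ}

theorem sawtoothSum_periodic : Function.Periodic (sawtoothSum c H) 1 := by
  intro x
  simp only [sawtoothSum]
  refine Finset.sum_congr rfl fun i _ => ?_
  rw [show x + 1 - c i = x - c i + 1 by ring, Int.fract_add_one]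

theorem hasDerivAt_sawtoothSum {x : ℝ} (hx : ∀ i, x - c i ∉ range ((↑) : ℤ → ℝ)) :
    HasDerivAt (sawtoothSum c H) (∑ i, H i) x := by
  have h1 : ∀ i, HasDerivAt (fun y => H i * (Int.fract (y - c i) - 1 / 2)) (H i) x := fun i => by
    simpa only [mul_one] using ((HasDerivAt.comp_sub_const x (c i)
      (hasDerivAt_fract (hx i))).sub_const (1 / 2)).const_mul (H i)
  exact HasDerivAt.fun_sum fun i _ => h1 i

theorem tendsto_sawtoothSum_sub_sub_add (hc : ∀ i, c i ∈ Ico (0 : ℝ) 1)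
    (hinj : Function.Injective c) (i : Fin ν) (p : ℝ) (hp : p - c i ∈ range ((↑) : ℤ → ℝ)) :
    Tendsto (fun δ => sawtoothSum c H (p - δ) - sawtoothSum c H (p + δ)) (𝓝[>] 0) (𝓝 (H i)) := by
  have h1 : ∀ j, Tendsto (fun δ => H j * (Int.fract (p - δ - c j) - 1 / 2)
      - H j * (Int.fract (p + δ - c j) - 1 / 2)) (𝓝[>] 0) (𝓝 (if j = i then H j else 0)) := by
    intro j
    split_ifs with hji
    · subst hji
      obtain ⟨n, hn⟩ := hp
      refine ((tendsto_fract_sub_sub_fract_add n).const_mul (H j)).congr' ?_ |>.trans_eq (by simp)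
      filter_upwards with δ
      rw [hn, sub_right_comm, sub_add_eq_add_sub]
      ring
    · have hj : p - c j ∉ range ((↑) : ℤ → ℝ) := by
        rintro ⟨m, hm⟩
        obtain ⟨n, hn⟩ := hp
        have h2 : c j - c i = ((n - m : ℤ) : ℝ) := by push_cast; linarith
        have h3 : n - m < 1 := by
          exact_mod_cast (by linarith [(hc i).1, (hc j).2] : ((n - m : ℤ) : ℝ) < (1 : ℝ))
        have h4 : -1 < n - m := by
          exact_mod_cast (by linarith [(hc j).1, (hc i).2] : (-1 : ℝ) < ((n - m : ℤ) : ℝ))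
        refine hji (hinj ?_)
        rw [show n - m = 0 by omega] at h2
        simpa [sub_eq_zero] using h2
      have hcont := (hasDerivAt_fract hj).continuousAt
      have hm : Tendsto (fun δ : ℝ => p - δ - c j) (𝓝[>] 0) (𝓝 (p - c j)) :=
        (Continuous.tendsto' (by fun_prop) 0 _ (by simp)).mono_left nhdsWithin_le_nhds
      have hq : Tendsto (fun δ : ℝ => p + δ - c j) (𝓝[>] 0) (𝓝 (p - c j)) :=
        (Continuous.tendsto' (by fun_prop) 0 _ (by simp)).mono_left nhdsWithin_le_nhds
      simpa using (((hcont.tendsto.comp hm).sub_const (1 / 2)).const_mul (H j)).sub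
        (((hcont.tendsto.comp hq).sub_const (1 / 2)).const_mul (H j))
  have h2 := tendsto_finsetSum Finset.univ fun j _ => h1 j
  simpa [sawtoothSum, Finset.sum_sub_distrib] using h2

theorem intervalIntegrable_fract_sub (c a b : ℝ) :
    IntervalIntegrable (fun x => Int.fract (x - c)) volume a b := by
  refine (intervalIntegrable_const (c := (1 : ℝ))).mono_fun ?_ ?_
  · exact (measurable_fract.comp (measurable_id.sub_const c)).aestronglyMeasurable
  · filter_upwards with x
    rw [Real.norm_of_nonneg (Int.fract_nonneg _), norm_one]
    exact (Int.fract_lt_one _).le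

theorem intervalIntegrable_sawtoothSum (a b : ℝ) :
    IntervalIntegrable (sawtoothSum c H) volume a b := by
  have h1 : IntervalIntegrable (∑ i, fun x => H i * (Int.fract (x - c i) - 1 / 2)) volume a b :=
    IntervalIntegrable.sum _ fun i _ =>
      ((intervalIntegrable_fract_sub _ _ _).sub intervalIntegrable_const).const_mul _
  rwa [show ∑ i, (fun x => H i * (Int.fract (x - c i) - 1 / 2)) = sawtoothSum c H by
    ext x; simp [sawtoothSum]] at h1

theorem integral_sawtoothSum : ∫ x in (0 : ℝ)..1, sawtoothSum c H x = 0 := by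
  simp only [sawtoothSum]
  rw [intervalIntegral.integral_finsetSum fun i _ =>
    ((intervalIntegrable_fract_sub _ _ _).sub intervalIntegrable_const).const_mul _]
  refine Finset.sum_eq_zero fun i _ => ?_
  rw [intervalIntegral.integral_const_mul, intervalIntegral.integral_sub
    (intervalIntegrable_fract_sub _ _ _) intervalIntegrable_const, integral_fract_sub]
  simp

theorem sum_mul_iota_sub_half_eq_sawtoothSum (γ : Fin ν → UnitAddCircle) (x : ℝ) :
    (∑ i, H i) * (iota (toCircle x) - 1 / 2)
      + ∑ i, H i * ((if iota (toCircle x) < iota (γ i) then (1 : ℝ) else 0) - iota (γ i))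
    = sawtoothSum (fun i => iota (γ i)) H x := by
  rw [sawtoothSum, Finset.sum_mul, ← Finset.sum_add_distrib, iota_toCircle]
  refine Finset.sum_congr rfl fun i _ => ?_
  rw [← fract_add_ite_sub_eq_fract_sub x (iota_mem_Ico (γ i))]
  ring

end sawtoothSum

theorem BoundedVariationOn.sub_const {ψ : ℝ → ℝ} {s : Set ℝ} (hψ : BoundedVariationOn ψ s)
    (A : ℝ) : BoundedVariationOn (fun x => ψ x - A) s := by
  rw [BoundedVariationOn] at hψ ⊢
  simpa only [eVariationOn, edist_sub_right] using hψ

/-- A continuous periodic function on the line descends to the circle. -/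
theorem exists_continuousMap_unitAddCircle {G : ℝ → ℝ} (hG : Continuous G)
    (hper : Function.Periodic G 1) : ∃ g : C(UnitAddCircle, ℝ), ∀ x : ℝ, g x = G x :=
  ⟨⟨hper.lift, continuous_coinduced_dom.2 hG⟩, fun x => hper.lift_coe x⟩

theorem toCircle_periodic : Function.Periodic toCircle 1 := fun x => by
  simp [toCircle]

/-- Subtracting the sawtooth sum with the same jumps leaves a continuous function whose
derivative has bounded variation. -/
theorem IsPiecewiseSmooth.exists_eq_sawtoothSum_add {ν : ℕ} {f : UnitAddCircle → ℝ}
    {γ : Fin ν → UnitAddCircle} {H : Fin ν → ℝ} (hf : IsPiecewiseSmooth f γ H) :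
    ∃ (g : C(UnitAddCircle, ℝ)) (ψ : ℝ → ℝ), BoundedVariationOn ψ (Icc 0 1) ∧
      (∀ x ∉ toCircle ⁻¹' range γ,
        f (toCircle x) = sawtoothSum (fun i => iota (γ i)) H x + g x) ∧
      (∀ x ∉ toCircle ⁻¹' range γ, HasDerivAt (fun y : ℝ => g y) (ψ x) x) := by
  obtain ⟨φ, hφ, hd⟩ := hf.exists_deriv_bv
  set P : Set ℝ := toCircle ⁻¹' range γ with hPdef
  set s : ℝ → ℝ := sawtoothSum (fun i => iota (γ i)) H with hs
  set ψ : ℝ → ℝ := fun x => φ (toCircle x) - ∑ i, H i with hψdef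
  set F : ℝ → ℝ := fun x => f (toCircle x) - s x with hFdef
  have hP : ∀ x, ∀ᶠ y in 𝓝[≠] x, y ∉ P := eventually_nhdsNE_toCircle_notMem_range γ
  have hPc : P.Countable := countable_preimage_toCircle_range γ
  have hψ : BoundedVariationOn ψ (Icc 0 1) := hφ.sub_const _
  have hψper : Function.Periodic ψ 1 := fun x => by simp only [hψdef, toCircle_periodic x]
  have hψi : ∀ a b, IntervalIntegrable ψ volume a b := fun a b =>
    hψper.intervalIntegrable₀ one_ne_zero (hψ.intervalIntegrable zero_le_one) a b
  have hFper : Function.Periodic F 1 := fun x => by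
    simp only [hFdef, toCircle_periodic x, hs, sawtoothSum_periodic x]
  have hPper : ∀ x, x + 1 ∈ P ↔ x ∈ P := fun x => by
    simp only [hPdef, mem_preimage, toCircle_periodic x]
  have hF : ∀ x ∉ P, HasDerivAt F (ψ x) x := fun x hx =>
    (hd x hx).sub (hasDerivAt_sawtoothSum fun i hi => hx ⟨i, (toCircle_eq_iff.2 hi).symm⟩)
  have hjump : ∀ p ∈ P, Tendsto (fun δ => F (p - δ) - F (p + δ)) (𝓝[>] 0) (𝓝 0) := by
    rintro p ⟨i, hi⟩
    have h1 := (hf.jump i).sub (tendsto_sawtoothSum_sub_sub_add (H := H)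
      (fun j => iota_mem_Ico (γ j)) hf.strictMono.injective i p (toCircle_eq_iff.1 hi.symm))
    rw [sub_self] at h1
    refine h1.congr fun δ => ?_
    have h2 : toCircle (iota (γ i)) = toCircle p := by rw [toCircle_iota, hi]
    have h3 : toCircle (iota (γ i) - δ) = toCircle (p - δ) := by
      simp only [toCircle, AddCircle.coe_sub] at h2 ⊢
      rw [h2]
    have h4 : toCircle (iota (γ i) + δ) = toCircle (p + δ) := by
      simp only [toCircle, AddCircle.coe_add] at h2 ⊢
      rw [h2]
    simp only [hFdef, h3, h4, hs]
    ring
  obtain ⟨c, hc'⟩ := exists_forall_notMem_eq_const_add_integral hP hψi hF hjump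
  set G : ℝ → ℝ := fun x => c + ∫ t in (0 : ℝ)..x, ψ t
  have hc : ∀ x ∉ P, F x = G x := hc'
  have hGc : Continuous G :=
    continuous_const.add (intervalIntegral.continuous_primitive hψi 0)
  have hGper : Function.Periodic G 1 := by
    intro x
    have h1 : (fun x => G (x + 1)) = G :=
      Continuous.ext_on (hPc.dense_compl ℝ) (by fun_prop) hGc fun x hx => by
        rw [← hc x hx, ← hFper x]
        exact (hc (x + 1) ((hPper x).not.2 hx)).symm
    exact congrFun h1 x
  obtain ⟨g, hg⟩ := exists_continuousMap_unitAddCircle hGc hGper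
  refine ⟨g, ψ, hψ, fun x hx => ?_, fun x hx => ?_⟩
  · rw [hg, ← hc x hx]
    simp only [hFdef]
    ring
  · refine (hF x hx).congr_of_eventuallyEq ?_
    have h1 : ∀ᶠ y in 𝓝 x, y ∉ P := by
      rw [← nhdsNE_sup_pure, eventually_sup]
      exact ⟨hP x, hx⟩
    filter_upwards [h1] with y hy
    rw [hg, hc y hy]

theorem birkhoff_add (f h : UnitAddCircle → ℝ) (α y : UnitAddCircle) (N : ℕ) :
    birkhoff (f + h) α y N = birkhoff f α y N + birkhoff h α y N := by
  simp [birkhoff, Finset.sum_add_distrib]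

theorem integral_eq_intervalIntegral_toCircle (f : UnitAddCircle → ℝ) :
    ∫ x, f x = ∫ x in (0 : ℝ)..1, f (toCircle x) := by
  have h1 := UnitAddCircle.intervalIntegral_preimage 0 f
  rw [zero_add] at h1
  exact h1.symm

theorem fourierCoeff_ofReal_zero (g : UnitAddCircle → ℝ) :
    fourierCoeff (fun x => (g x : ℂ)) 0 = ((∫ x in (0 : ℝ)..1, g x : ℝ) : ℂ) := by
  rw [fourierCoeff_eq_intervalIntegral _ 0 0]
  simp [intervalIntegral.integral_ofReal]

/-- For a piecewise smooth `f` with jumps `H i` at `γ i`, and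
`h(x) = ∑ H_i (ι(x) - 1/2) + ∑ H_i (𝟙_{[0,γ_i)}(x) - ι(γ_i))`, for a.e. `α` the
Birkhoff sums of `f` and `h` stay within a bounded distance, uniformly in `N` and
the starting point. -/
theorem birkhoff_sub_jump_part_bounded {ν : ℕ} (f : UnitAddCircle → ℝ)
    (γ : Fin ν → UnitAddCircle) (H : Fin ν → ℝ) (hf : IsPiecewiseSmooth f γ H)
    (h : UnitAddCircle → ℝ)
    (hh : h = fun x => (∑ i, H i) * (iota x - 1/2)
      + ∑ i, H i * ((if iota x < iota (γ i) then (1 : ℝ) else 0) - iota (γ i))) :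
    ∀ᵐ α ∂(volume : Measure UnitAddCircle), ∃ C : ℝ, 0 < C ∧
      ∀ (N : ℕ) (y : UnitAddCircle), |birkhoff f α y N - birkhoff h α y N| ≤ C := by
  classical
  obtain ⟨g, ψ, hψ, hfg, hg⟩ := hf.exists_eq_sawtoothSum_add
  set s : ℝ → ℝ := sawtoothSum (fun i => iota (γ i)) H
  have hPc := countable_preimage_toCircle_range γ
  have hhs : ∀ x, h (toCircle x) = s x := fun x => by
    rw [hh]
    exact sum_mul_iota_sub_half_eq_sawtoothSum γ x
  have hg0 : ∫ x in (0 : ℝ)..1, g x = 0 := by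
    have hgi : IntervalIntegrable (fun x : ℝ => g x) volume 0 1 :=
      (by fun_prop : Continuous fun x : ℝ => g x).intervalIntegrable _ _
    have h1 : ∫ x in (0 : ℝ)..1, f (toCircle x) = ∫ x in (0 : ℝ)..1, (s x + g x) := by
      refine intervalIntegral.integral_congr_ae ?_
      filter_upwards [hPc.ae_notMem volume] with x hx _
      exact hfg x hx
    rw [intervalIntegral.integral_add (intervalIntegrable_sawtoothSum _ _) hgi,
      integral_sawtoothSum, zero_add, ← integral_eq_intervalIntegral_toCircle,
      hf.integral_zero] at h1
    exact h1.symm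
  set gc : C(UnitAddCircle, ℂ) := ⟨fun x => (g x : ℂ), by fun_prop⟩ with hgc
  set V : ℝ := (eVariationOn ψ (Icc 0 1)).toReal
  have hcoeff : ∀ n : ℤ, ‖fourierCoeff gc n‖ ≤ V / (n : ℝ) ^ 2 := by
    intro n
    rcases eq_or_ne n 0 with rfl | hn
    · have h1 : fourierCoeff gc 0 = 0 := by
        rw [← Complex.ofReal_zero, ← hg0]
        exact fourierCoeff_ofReal_zero g
      simp [h1]
    · exact norm_fourierCoeff_ofReal_le hPc hg hψ hn
  set e : UnitAddCircle → ℝ := f - h - g with he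
  set S : Finset UnitAddCircle := Finset.univ.image γ
  have heS : ∀ x ∉ S, e x = 0 := by
    intro x hx
    have hx' : iota x ∉ toCircle ⁻¹' range γ := by
      rw [mem_preimage, toCircle_iota]
      rintro ⟨i, rfl⟩
      exact hx (Finset.mem_image_of_mem _ (Finset.mem_univ i))
    have h1 := hfg _ hx'
    rw [← hhs] at h1
    have h2 : ((iota x : ℝ) : UnitAddCircle) = x := toCircle_iota x
    rw [toCircle_iota, h2] at h1
    simp [he, h1]
  filter_upwards [ae_summable_inv_sq_mul_norm_fourier_sub_one] with α hα
  set B : ℝ := ∑' n : ℤ, V * 2 * ((n : ℝ) ^ 2 * ‖fourier n α - 1‖)⁻¹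
  have hB : 0 ≤ B := tsum_nonneg fun n => by positivity
  refine ⟨B + ∑ x ∈ S, |e x| + 1, by positivity, fun N y => ?_⟩
  have hbg : |birkhoff g α y N| ≤ B := by
    refine le_trans (le_of_eq ?_) (norm_birkhoff_sum_le_of_norm_fourierCoeff_le hcoeff
      hα.1 hα.2 N y)
    rw [← Real.norm_eq_abs, ← Complex.norm_real]
    simp [birkhoff, hgc]
  have hbe := abs_birkhoff_le_of_finite_support heS hα.1 N y
  rw [birkhoff_sub, show f - h = g + e by rw [he]; abel, birkhoff_add]
  linarith [abs_add_le (birkhoff g α y N) (birkhoff e α y N)]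
end

section
/- Let A ⊆ ℕ be a set of positive lower density and let ψ : ℕ → [0,∞) be a monotone decreasing function with Σ_{q=1}^{∞} ψ(q) = ∞. Then for Lebesgue-almost every α ∈ ℝ there exist infinitely many pairs (p,q) ∈ ℤ × A with gcd(p,q) = 1 satisfying |α − p/q| < ψ(q)/q. -/
open MeasureTheory Filter Set Topology

open scoped Classical in
/-- The lower (asymptotic) density of a set `A ⊆ ℕ`:
`liminf_{N → ∞} #(A ∩ {1,…,N}) / N`. -/
noncomputable def lowerDensity (A : Set ℕ) : ℝ :=
  Filter.liminf (fun N : ℕ => (((Finset.Icc 1 N).filter (· ∈ A)).card : ℝ) / N) Filter.atTop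

theorem one_sub_sum_le_prod_one_sub {ι : Type*} (s : Finset ι) (f : ι → ℝ)
    (h0 : ∀ i ∈ s, 0 ≤ f i) (h1 : ∀ i ∈ s, f i ≤ 1) :
    1 - ∑ i ∈ s, f i ≤ ∏ i ∈ s, (1 - f i) := by
  classical
  induction s using Finset.induction_on with
  | empty => simp
  | insert a s ha ih =>
    rw [Finset.sum_insert ha, Finset.prod_insert ha]
    have hi := ih (fun i hi => h0 i (Finset.mem_insert_of_mem hi))
      (fun i hi => h1 i (Finset.mem_insert_of_mem hi))
    have ha0 := h0 a (Finset.mem_insert_self a s)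
    have ha1 := h1 a (Finset.mem_insert_self a s)
    have hs : 0 ≤ ∑ i ∈ s, f i :=
      Finset.sum_nonneg fun i hi => h0 i (Finset.mem_insert_of_mem hi)
    nlinarith [mul_le_mul_of_nonneg_left hi (sub_nonneg.2 ha1), mul_nonneg ha0 hs]

/-- If the prime factors of `q` above `y` have a small sum of reciprocals, then `φ(q)/q` is bounded
below in terms of `y` alone. -/
theorem half_pow_mul_le_totient (y q : ℕ)
    (hs : ∑ p ∈ q.primeFactors with y < p, (p : ℝ)⁻¹ ≤ 1 / 2) :
    (1 / 2 : ℝ) ^ (y + 1) * q ≤ q.totient := by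
  have htot : (q.totient : ℝ) = q * ∏ p ∈ q.primeFactors, (1 - (p : ℝ)⁻¹) := by
    have h := congrArg (Rat.cast : ℚ → ℝ) (Nat.totient_eq_mul_prod_factors q)
    push_cast at h
    exact h
  have hinv : ∀ p ∈ q.primeFactors, (p : ℝ)⁻¹ ≤ 1 / 2 := fun p hp => by
    rw [one_div]
    exact inv_anti₀ two_pos (by exact_mod_cast (Nat.prime_of_mem_primeFactors hp).two_le)
  have hlarge : 1 / 2 ≤ ∏ p ∈ q.primeFactors with y < p, (1 - (p : ℝ)⁻¹) := by
    refine le_trans (by linarith) (one_sub_sum_le_prod_one_sub _ _ (fun _ _ => by positivity) ?_)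
    intro p hp
    linarith [hinv p (Finset.mem_filter.1 hp).1]
  have hsmall : (1 / 2 : ℝ) ^ y ≤ ∏ p ∈ q.primeFactors with ¬ y < p, (1 - (p : ℝ)⁻¹) := by
    have hcard : (q.primeFactors.filter (fun p => ¬ y < p)).card ≤ y := by
      refine (Finset.card_le_card (t := Finset.Icc 1 y) fun p hp => ?_).trans (by simp)
      rw [Finset.mem_filter] at hp
      exact Finset.mem_Icc.2 ⟨(Nat.prime_of_mem_primeFactors hp.1).one_le, not_lt.1 hp.2⟩
    calc (1 / 2 : ℝ) ^ y ≤ (1 / 2) ^ (q.primeFactors.filter (fun p => ¬ y < p)).card :=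
          pow_le_pow_of_le_one (by norm_num) (by norm_num) hcard
      _ = ∏ p ∈ q.primeFactors with ¬ y < p, (1 / 2 : ℝ) := by rw [Finset.prod_const]
      _ ≤ _ := by
          refine Finset.prod_le_prod (fun _ _ => by norm_num) fun p hp => ?_
          linarith [hinv p (Finset.mem_filter.1 hp).1]
  rw [htot, ← Finset.prod_filter_mul_prod_filter_not q.primeFactors (fun p => y < p), mul_comm,
    pow_succ']
  gcongr

theorem sum_sum_inv_primeFactors_le (y N : ℕ) (hy : y ≠ 0) :
    ∑ q ∈ Finset.Icc 1 N, ∑ p ∈ q.primeFactors with y < p, (p : ℝ)⁻¹ ≤ N / y := by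
  calc ∑ q ∈ Finset.Icc 1 N, ∑ p ∈ q.primeFactors with y < p, (p : ℝ)⁻¹
      ≤ ∑ q ∈ Finset.Icc 1 N, ∑ d ∈ Finset.Ioc y N, if d ∣ q then (d : ℝ)⁻¹ else 0 := by
        refine Finset.sum_le_sum fun q hq => ?_
        rw [← Finset.sum_filter]
        refine Finset.sum_le_sum_of_subset_of_nonneg (fun p hp => ?_) fun _ _ _ => by positivity
        rw [Finset.mem_Icc] at hq
        rw [Finset.mem_filter] at hp
        have hdvd := Nat.dvd_of_mem_primeFactors hp.1
        exact Finset.mem_filter.2 ⟨Finset.mem_Ioc.2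
          ⟨hp.2, (Nat.le_of_dvd hq.1 hdvd).trans hq.2⟩, hdvd⟩
    _ = ∑ d ∈ Finset.Ioc y N, ((N / d : ℕ) : ℝ) * (d : ℝ)⁻¹ := by
        rw [Finset.sum_comm]
        refine Finset.sum_congr rfl fun d _ => ?_
        rw [← Finset.sum_filter, Finset.sum_const, nsmul_eq_mul]
        congr 2
        exact Nat.Ioc_filter_dvd_card_eq_div N d
    _ ≤ ∑ d ∈ Finset.Ioc y N, (N : ℝ) * ((d : ℝ) ^ 2)⁻¹ := by
        refine Finset.sum_le_sum fun d _ => ?_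
        calc ((N / d : ℕ) : ℝ) * (d : ℝ)⁻¹ ≤ (N / d : ℝ) * (d : ℝ)⁻¹ := by
              gcongr; exact Nat.cast_div_le
          _ = _ := by rw [sq, mul_inv, div_eq_mul_inv, mul_assoc]
    _ ≤ N / y := by
        rw [← Finset.mul_sum, div_eq_mul_inv]
        gcongr
        rcases le_total y N with h | h
        · refine (sum_Ioc_inv_sq_le_sub hy h).trans ?_
          simp
        · rw [Finset.Ioc_eq_empty (by omega)]
          simp

/-- The integers `q` with `φ(q)/q` small have small density. -/
theorem card_totient_small_le (y N : ℕ) (hy : y ≠ 0) :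
    (((Finset.Icc 1 N).filter
      (fun q : ℕ => (q.totient : ℝ) < (1 / 2 : ℝ) ^ (y + 1) * q)).card : ℝ) ≤ 2 * N / y := by
  set B := (Finset.Icc 1 N).filter (fun q : ℕ => (q.totient : ℝ) < (1 / 2 : ℝ) ^ (y + 1) * q)
  have h : (B.card : ℝ) * (1 / 2) ≤ N / y := by
    calc (B.card : ℝ) * (1 / 2) = ∑ q ∈ B, (1 / 2 : ℝ) := by rw [Finset.sum_const, nsmul_eq_mul]
      _ ≤ ∑ q ∈ B, ∑ p ∈ q.primeFactors with y < p, (p : ℝ)⁻¹ := by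
          refine Finset.sum_le_sum fun q hq => ?_
          by_contra! hlt
          exact absurd (half_pow_mul_le_totient y q hlt.le) (not_le.2 (Finset.mem_filter.1 hq).2)
      _ ≤ ∑ q ∈ Finset.Icc 1 N, ∑ p ∈ q.primeFactors with y < p, (p : ℝ)⁻¹ :=
          Finset.sum_le_sum_of_subset_of_nonneg (Finset.filter_subset _ _) fun _ _ _ =>
            Finset.sum_nonneg fun _ _ => by positivity
      _ ≤ N / y := sum_sum_inv_primeFactors_le y N hy
  rw [mul_div_assoc]
  linarith

/-- Abel summation: nonnegative partial sums stay nonnegative against antitone weights. -/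
theorem sum_mul_antitone_nonneg (a ψ : ℕ → ℝ) (hψ0 : ∀ q, 0 ≤ ψ q) (hψ : Antitone ψ)
    (ha : ∀ n, 0 ≤ ∑ i ∈ Finset.range (n + 1), a i) (n : ℕ) :
    0 ≤ ∑ i ∈ Finset.range (n + 1), a i * ψ i := by
  suffices h : (∑ i ∈ Finset.range (n + 1), a i) * ψ n ≤
      ∑ i ∈ Finset.range (n + 1), a i * ψ i from (mul_nonneg (ha n) (hψ0 n)).trans h
  induction n with
  | zero => simp
  | succ n ih =>
    rw [Finset.sum_range_succ, Finset.sum_range_succ _ (n + 1), add_mul]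
    gcongr
    exact (mul_le_mul_of_nonneg_left (hψ n.le_succ) (ha n)).trans ih

/-- An antitone divergent series still diverges when restricted to a set whose counting function
grows linearly. -/
theorem not_summable_indicator_of_antitone (B : Set ℕ) (c : ℝ) (hc : 0 < c) (N₀ : ℕ)
    (ψ : ℕ → ℝ) (hψ0 : ∀ q, 0 ≤ ψ q) (hψ : Antitone ψ) (hdiv : ¬ Summable ψ)
    (hB : ∀ N ≥ N₀, c * N ≤ ∑ q ∈ Finset.Icc 1 N, B.indicator (fun _ => (1 : ℝ)) q) :
    ¬ Summable (B.indicator ψ) := by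
  intro hsum
  apply hdiv
  set C : ℝ := c * (N₀ + 1)
  set a : ℕ → ℝ := fun q => B.indicator (fun _ => (1 : ℝ)) q - c + if q = 0 then C else 0
  have hind : ∀ q, 0 ≤ B.indicator (fun _ => (1 : ℝ)) q :=
    fun q => indicator_nonneg (fun _ _ => zero_le_one) q
  have ha : ∀ n, 0 ≤ ∑ i ∈ Finset.range (n + 1), a i := by
    intro n
    simp only [a, Finset.sum_add_distrib, Finset.sum_sub_distrib, Finset.sum_const,
      Finset.card_range, nsmul_eq_mul, Finset.sum_ite_eq', Finset.mem_range, Nat.succ_pos,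
      if_true]
    push_cast
    have hle : ∑ q ∈ Finset.Icc 1 n, B.indicator (fun _ => (1 : ℝ)) q ≤
        ∑ q ∈ Finset.range (n + 1), B.indicator (fun _ => (1 : ℝ)) q :=
      Finset.sum_le_sum_of_subset_of_nonneg
        (fun q hq => by rw [Finset.mem_Icc] at hq; rw [Finset.mem_range]; omega)
        fun _ _ _ => hind _
    have h0 : 0 ≤ ∑ q ∈ Finset.Icc 1 n, B.indicator (fun _ => (1 : ℝ)) q :=
      Finset.sum_nonneg fun _ _ => hind _
    rcases le_total N₀ n with h | h
    · have := hB n h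
      have : 0 ≤ c * N₀ := by positivity
      simp only [C]
      linarith
    · have : c * n ≤ c * N₀ := by gcongr
      simp only [C]
      linarith
  refine summable_of_sum_range_le (c := (∑' q, B.indicator ψ q + C * ψ 0) / c) hψ0 fun n => ?_
  rw [le_div_iff₀ hc]
  have hn := sum_mul_antitone_nonneg a ψ hψ0 hψ ha n
  have hsplit : ∑ i ∈ Finset.range (n + 1), a i * ψ i =
      ∑ i ∈ Finset.range (n + 1), B.indicator ψ i - c * ∑ i ∈ Finset.range (n + 1), ψ i
        + C * ψ 0 := by
    have : ∀ i, a i * ψ i = B.indicator ψ i - c * ψ i + if i = 0 then C * ψ 0 else 0 := by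
      intro i
      by_cases hi : i ∈ B <;> by_cases h0 : i = 0 <;> simp [a, hi, h0] <;> subst_vars <;>
        simp_all <;> ring
    simp only [this, Finset.sum_add_distrib, Finset.sum_sub_distrib, ← Finset.mul_sum,
      Finset.sum_ite_eq', Finset.mem_range, Nat.succ_pos, if_true]
  have hle := hsum.sum_le_tsum (Finset.range (n + 1))
    fun i _ => indicator_nonneg (fun q _ => hψ0 q) i
  rw [Finset.sum_range_succ ψ] at hsplit
  have := mul_nonneg hc.le (hψ0 n)
  linarith

theorem exists_not_summable_indicator (A : Set ℕ) (hA : 0 < lowerDensity A) (ψ : ℕ → ℝ)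
    (hψ0 : ∀ q, 0 ≤ ψ q) (hψ : Antitone ψ) (hdiv : ¬ Summable ψ) :
    ∃ ε : ℝ, 0 < ε ∧
      ¬ Summable ({q : ℕ | q ∈ A ∧ 0 < q ∧ ε * q ≤ q.totient}.indicator ψ) := by
  classical
  obtain ⟨c, hc0, hc⟩ := exists_between hA
  have hev := eventually_lt_of_lt_liminf hc
    (isBoundedUnder_of ⟨0, fun N => div_nonneg (Nat.cast_nonneg _) (Nat.cast_nonneg _)⟩)
  obtain ⟨N₀, hN₀⟩ := eventually_atTop.1 hev
  obtain ⟨y, hy⟩ := exists_nat_gt (4 / c)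
  have hy0 : (0 : ℝ) < y := lt_trans (by positivity) hy
  have hy' : y ≠ 0 := by rintro rfl; simp at hy0
  refine ⟨(1 / 2) ^ (y + 1), by positivity, ?_⟩
  refine not_summable_indicator_of_antitone _ (c / 2) (by positivity) N₀ ψ hψ0 hψ hdiv ?_
  intro N hN
  rcases Nat.eq_zero_or_pos N with rfl | hNpos
  · simp
  have hNR : (0 : ℝ) < N := by exact_mod_cast hNpos
  have h1 : c * N < (((Finset.Icc 1 N).filter (· ∈ A)).card : ℝ) := by
    have := hN₀ N hN
    rw [lt_div_iff₀ hNR] at this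
    convert this
  have h2 := card_totient_small_le y N hy'
  set S := (Finset.Icc 1 N).filter (· ∈ A)
  set B := (Finset.Icc 1 N).filter (fun q : ℕ => (q.totient : ℝ) < (1 / 2 : ℝ) ^ (y + 1) * q)
  set G := (Finset.Icc 1 N).filter
    (· ∈ {q : ℕ | q ∈ A ∧ 0 < q ∧ (1 / 2 : ℝ) ^ (y + 1) * q ≤ q.totient})
  have hsum : ∑ q ∈ Finset.Icc 1 N,
      {q : ℕ | q ∈ A ∧ 0 < q ∧ (1 / 2 : ℝ) ^ (y + 1) * q ≤ q.totient}.indicator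
        (fun _ => (1 : ℝ)) q = G.card := by
    simp only [indicator_apply]
    rw [Finset.sum_boole]
  have hcard : S.card ≤ B.card + G.card := by
    refine (Finset.card_le_card fun q hq => ?_).trans (Finset.card_union_le B G)
    simp only [S, Finset.mem_filter, Finset.mem_Icc] at hq
    simp only [B, G, Finset.mem_union, Finset.mem_filter, Finset.mem_Icc, mem_ofPred_eq]
    rcases lt_or_ge (q.totient : ℝ) ((1 / 2 : ℝ) ^ (y + 1) * q) with h | h
    · exact Or.inl ⟨hq.1, h⟩
    · exact Or.inr ⟨hq.1, hq.2, hq.1.1, h⟩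
  have hcard' : (S.card : ℝ) ≤ B.card + G.card := by exact_mod_cast hcard
  have h3 : 2 * N / y ≤ c / 2 * N := by
    rw [div_lt_iff₀ hc0] at hy
    rw [div_le_iff₀ hy0]
    nlinarith
  rw [hsum]
  linarith

theorem UnitAddCircle.volume_real_ball_le (x : UnitAddCircle) (r : ℝ) (hr : 0 ≤ r) :
    volume.real (Metric.ball x r) ≤ 2 * r := by
  rw [measureReal_def, ← measure_congr AddCircle.closedBall_ae_eq_ball, AddCircle.volume_closedBall,
    ENNReal.toReal_ofReal (by positivity)]
  exact min_le_right _ _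

theorem UnitAddCircle.volume_real_ball (x : UnitAddCircle) (r : ℝ) (hr : 0 ≤ r)
    (hr' : r ≤ 1 / 2) : volume.real (Metric.ball x r) = 2 * r := by
  rw [measureReal_def, ← measure_congr AddCircle.closedBall_ae_eq_ball, AddCircle.volume_closedBall,
    ENNReal.toReal_ofReal (by positivity)]
  exact min_eq_right (by linarith)

/-- A torsion point of the circle is a fraction whose numerator measures its norm. -/
theorem UnitAddCircle.exists_int_of_nsmul_eq_zero {n : ℕ} (hn : 0 < n) {z : UnitAddCircle}
    (hz : n • z = 0) : ∃ k : ℤ, z = ((k / n : ℝ) : UnitAddCircle) ∧ |(k : ℝ)| = n * ‖z‖ := by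
  have hnR : (0 : ℝ) < n := by exact_mod_cast hn
  induction z using QuotientAddGroup.induction_on with
  | H x =>
    obtain ⟨j, hj⟩ := (AddCircle.coe_eq_zero_iff (1 : ℝ)).1
      (show ((n • x : ℝ) : UnitAddCircle) = 0 from hz)
    have hx : (j : ℝ) = n * x := by simpa using hj
    have hk : ((j - n * round x : ℤ) : ℝ) = n * (x - round x) := by
      push_cast
      rw [hx]
      ring
    refine ⟨j - n * round x, ?_, ?_⟩
    · rw [hk, mul_div_cancel_left₀ _ hnR.ne']
      change (x : UnitAddCircle) = _
      rw [AddCircle.coe_sub]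
      have : ((round x : ℝ) : UnitAddCircle) = 0 :=
        (AddCircle.coe_eq_zero_iff (1 : ℝ)).2 ⟨round x, by simp⟩
      rw [this, sub_zero]
    · rw [hk, abs_mul, abs_of_pos hnR]
      congr 1
      exact (UnitAddCircle.norm_eq (x := x)).symm

theorem UnitAddCircle.ncard_torsion_le {n : ℕ} (hn : 0 < n) :
    {z : UnitAddCircle | n • z = 0}.ncard ≤ n := by
  have h := AddCircle.card_torsion_le_of_isSMulRegular (1 : ℝ) n hn.ne'
    (.of_right_eq_zero_of_smul fun _ ↦ by simp [hn.ne'])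
  rw [← (AddCircle.finite_torsion (1 : ℝ) hn).cast_ncard_eq] at h
  exact_mod_cast h

/-- Few nonzero torsion points lie near the origin. -/
theorem UnitAddCircle.ncard_torsion_norm_lt_le {n : ℕ} (hn : 0 < n) {ρ : ℝ} (hρ : 0 ≤ ρ) :
    ({z : UnitAddCircle | n • z = 0 ∧ z ≠ 0 ∧ ‖z‖ < ρ}.ncard : ℝ) ≤ 2 * (ρ * n) := by
  set M := ⌊ρ * n⌋₊
  have hnR : (0 : ℝ) < n := by exact_mod_cast hn
  set F : Finset ℤ := Finset.Icc 1 (M : ℤ) ∪ Finset.Icc (-(M : ℤ)) (-1)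
  have hF : F.card ≤ 2 * M := by
    refine (Finset.card_union_le _ _).trans ?_
    simp only [Int.card_Icc]
    omega
  have hsub : {z : UnitAddCircle | n • z = 0 ∧ z ≠ 0 ∧ ‖z‖ < ρ} ⊆
      (fun k : ℤ => ((k / n : ℝ) : UnitAddCircle)) '' (F : Set ℤ) := by
    rintro z ⟨hz, hz0, hzρ⟩
    obtain ⟨k, hk, hkn⟩ := UnitAddCircle.exists_int_of_nsmul_eq_zero hn hz
    refine ⟨k, ?_, hk.symm⟩
    have hk0 : k ≠ 0 := by
      rintro rfl
      exact hz0 (by simpa using hk)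
    have hkM : k.natAbs ≤ M := by
      refine Nat.le_floor ?_
      rw [Nat.cast_natAbs, Int.cast_abs, hkn, mul_comm]
      gcongr
    simp only [F, Finset.coe_union, Finset.coe_Icc, mem_union, mem_Icc]
    omega
  have h1 := (Set.ncard_le_ncard hsub (F.finite_toSet.image _)).trans
    (Set.ncard_image_le F.finite_toSet)
  rw [Set.ncard_coe_finset] at h1
  have h2 : (M : ℝ) ≤ ρ * n := Nat.floor_le (by positivity)
  calc ({z : UnitAddCircle | n • z = 0 ∧ z ≠ 0 ∧ ‖z‖ < ρ}.ncard : ℝ)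
      ≤ ((2 * M : ℕ) : ℝ) := by exact_mod_cast h1.trans hF
    _ ≤ 2 * (ρ * n) := by push_cast; linarith

/-- Few pairs of points of distinct orders `q` and `r` are close. -/
theorem UnitAddCircle.ncard_close_pairs_le {q r : ℕ} (hq : 0 < q) (hr : 0 < r) (hqr : q ≠ r)
    {ρ : ℝ} (hρ : 0 ≤ ρ) :
    ({xy : UnitAddCircle × UnitAddCircle | addOrderOf xy.1 = q ∧ addOrderOf xy.2 = r ∧
      ‖xy.1 - xy.2‖ < ρ}.ncard : ℝ) ≤ 2 * (ρ * q * r) := by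
  classical
  have hL : 0 < q.lcm r := Nat.lcm_pos hq hr
  have hd : 0 < q.gcd r := Nat.gcd_pos_of_pos_left _ hq
  set P := {xy : UnitAddCircle × UnitAddCircle | addOrderOf xy.1 = q ∧ addOrderOf xy.2 = r ∧
      ‖xy.1 - xy.2‖ < ρ}
  set Z := {z : UnitAddCircle | q.lcm r • z = 0 ∧ z ≠ 0 ∧ ‖z‖ < ρ}
  have hP : P.Finite :=
    ((AddCircle.finite_setOfPred_addOrderOf_eq (1 : ℝ) hq).prod
      (AddCircle.finite_setOfPred_addOrderOf_eq (1 : ℝ) hr)).subset fun xy h => ⟨h.1, h.2.1⟩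
  have hZ : Z.Finite := (AddCircle.finite_torsion (1 : ℝ) hL).subset fun z h => h.1
  have hmaps : ∀ xy ∈ hP.toFinset, xy.1 - xy.2 ∈ hZ.toFinset := by
    rintro ⟨x, y⟩ hxy
    obtain ⟨hx, hy, hn⟩ := hP.mem_toFinset.1 hxy
    refine hZ.mem_toFinset.2 ⟨?_, ?_, hn⟩
    · have hx' : q.lcm r • x = 0 :=
        addOrderOf_dvd_iff_nsmul_eq_zero.1 (hx ▸ Nat.dvd_lcm_left _ _)
      have hy' : q.lcm r • y = 0 :=
        addOrderOf_dvd_iff_nsmul_eq_zero.1 (hy ▸ Nat.dvd_lcm_right _ _)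
      rw [nsmul_sub, hx', hy', sub_zero]
    · intro h
      exact hqr (by rw [← hx, ← hy, sub_eq_zero.1 h])
  have hfib : ∀ z ∈ hZ.toFinset,
      (hP.toFinset.filter fun xy => xy.1 - xy.2 = z).card ≤ q.gcd r := by
    intro z _
    rcases (hP.toFinset.filter fun xy => xy.1 - xy.2 = z).eq_empty_or_nonempty with h | ⟨w, hw⟩
    · simp [h]
    · have hmem : ∀ v ∈ hP.toFinset.filter (fun xy => xy.1 - xy.2 = z),
          q • v.1 = 0 ∧ r • v.2 = 0 ∧ v.1 - v.2 = z := by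
        intro v hv
        rw [Finset.mem_filter, hP.mem_toFinset] at hv
        exact ⟨hv.1.1 ▸ addOrderOf_nsmul_eq_zero _, hv.1.2.1 ▸ addOrderOf_nsmul_eq_zero _, hv.2⟩
      obtain ⟨hw1, hw2, hwz⟩ := hmem w hw
      refine le_trans ?_ (UnitAddCircle.ncard_torsion_le hd)
      rw [← Set.ncard_coe_finset]
      refine Set.ncard_le_ncard_of_injOn (fun v => v.1 - w.1) ?_ ?_
        (AddCircle.finite_torsion (1 : ℝ) hd)
      · intro v hv
        obtain ⟨h1, h2, h3⟩ := hmem v hv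
        refine addOrderOf_dvd_iff_nsmul_eq_zero.1 (Nat.dvd_gcd ?_ ?_)
        · rw [addOrderOf_dvd_iff_nsmul_eq_zero, nsmul_sub, h1, hw1, sub_zero]
        · have : v.1 - w.1 = v.2 - w.2 := by
            rw [sub_eq_sub_iff_sub_eq_sub, h3, hwz]
          rw [addOrderOf_dvd_iff_nsmul_eq_zero, this, nsmul_sub, h2, hw2, sub_zero]
      · intro u hu v hv huv
        have h1 : u.1 = v.1 := sub_left_injective huv
        have h2 := (hmem u hu).2.2.trans (hmem v hv).2.2.symm
        rw [h1] at h2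
        exact Prod.ext h1 (sub_right_injective h2)
  have hcard := Finset.card_le_mul_card_image_of_maps_to hmaps (q.gcd r) hfib
  rw [← Set.ncard_eq_toFinset_card P hP, ← Set.ncard_eq_toFinset_card Z hZ] at hcard
  have hZcard : (Z.ncard : ℝ) ≤ 2 * (ρ * (q.lcm r : ℕ)) :=
    UnitAddCircle.ncard_torsion_norm_lt_le hL hρ
  have hmul : ((q.gcd r : ℕ) : ℝ) * (q.lcm r : ℕ) = q * r := by
    exact_mod_cast Nat.gcd_mul_lcm q r
  calc (P.ncard : ℝ) ≤ (q.gcd r : ℕ) * Z.ncard := by exact_mod_cast hcard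
    _ ≤ (q.gcd r : ℕ) * (2 * (ρ * (q.lcm r : ℕ))) := by gcongr
    _ = 2 * (ρ * ((q.gcd r : ℕ) * (q.lcm r : ℕ))) := by ring
    _ = 2 * (ρ * q * r) := by rw [hmul]; ring

theorem UnitAddCircle.approxAddOrderOf_eq_biUnion (q : ℕ) (δ : ℝ) :
    approxAddOrderOf UnitAddCircle q δ =
      ⋃ x ∈ {x : UnitAddCircle | addOrderOf x = q}, Metric.ball x δ :=
  Metric.thickening_eq_biUnion_ball

theorem UnitAddCircle.volume_real_approxAddOrderOf {q : ℕ} (hq : 0 < q) {δ : ℝ} (hδ : 0 ≤ δ)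
    (hδ' : q * δ ≤ 1 / 2) :
    volume.real (approxAddOrderOf UnitAddCircle q δ) = q.totient * (2 * δ) := by
  have hfin := AddCircle.finite_setOfPred_addOrderOf_eq (1 : ℝ) hq
  have hqR : (1 : ℝ) ≤ q := by exact_mod_cast hq
  have hδhalf : δ ≤ 1 / 2 := by nlinarith
  have hU : approxAddOrderOf UnitAddCircle q δ = ⋃ x ∈ hfin.toFinset, Metric.ball x δ := by
    simp only [UnitAddCircle.approxAddOrderOf_eq_biUnion, hfin.mem_toFinset]
  rw [hU, measureReal_biUnion_finset]
  · rw [Finset.sum_congr rfl fun x _ => UnitAddCircle.volume_real_ball x δ hδ hδhalf,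
      Finset.sum_const, nsmul_eq_mul, ← Set.ncard_eq_toFinset_card _ hfin,
      ← _root_.Nat.card_coe_set_eq]
    congr 2
    exact AddCircle.card_addOrderOf_eq_totient (p := (1 : ℝ))
  · intro x hx y hy hxy
    rw [Finset.mem_coe, hfin.mem_toFinset] at hx hy
    refine Metric.ball_disjoint_ball ?_
    have hz : q • (x - y) = 0 := by
      rw [nsmul_sub, ← hx, addOrderOf_nsmul_eq_zero, hx, ← hy, addOrderOf_nsmul_eq_zero, sub_zero]
    obtain ⟨k, hk, hkn⟩ := UnitAddCircle.exists_int_of_nsmul_eq_zero hq hz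
    have hk0 : k ≠ 0 := by
      rintro rfl
      exact hxy (sub_eq_zero.1 (by simpa using hk))
    have hk1 : (1 : ℝ) ≤ |(k : ℝ)| := by exact_mod_cast Int.one_le_abs hk0
    rw [dist_eq_norm]
    nlinarith
  · exact fun _ _ => Metric.isOpen_ball.measurableSet

/-- The sets of points close to points of distinct orders are quasi-independent. -/
theorem UnitAddCircle.volume_real_approxAddOrderOf_inter_le {q r : ℕ} (hq : 0 < q) (hr : 0 < r)
    (hqr : q ≠ r) {δ η : ℝ} (hδ : 0 ≤ δ) (hη : 0 ≤ η) :
    volume.real (approxAddOrderOf UnitAddCircle q δ ∩ approxAddOrderOf UnitAddCircle r η) ≤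
      8 * (q * δ) * (r * η) := by
  set P := {xy : UnitAddCircle × UnitAddCircle | addOrderOf xy.1 = q ∧ addOrderOf xy.2 = r ∧
      ‖xy.1 - xy.2‖ < δ + η}
  have hP : P.Finite :=
    ((AddCircle.finite_setOfPred_addOrderOf_eq (1 : ℝ) hq).prod
      (AddCircle.finite_setOfPred_addOrderOf_eq (1 : ℝ) hr)).subset fun xy h => ⟨h.1, h.2.1⟩
  have hsub : approxAddOrderOf UnitAddCircle q δ ∩ approxAddOrderOf UnitAddCircle r η ⊆
      ⋃ xy ∈ hP.toFinset, Metric.ball xy.1 δ ∩ Metric.ball xy.2 η := by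
    rintro z ⟨hz1, hz2⟩
    rw [UnitAddCircle.approxAddOrderOf_eq_biUnion, mem_iUnion₂] at hz1 hz2
    obtain ⟨x, hx, hzx⟩ := hz1
    obtain ⟨y, hy, hzy⟩ := hz2
    refine mem_iUnion₂.2 ⟨(x, y), hP.mem_toFinset.2 ⟨hx, hy, ?_⟩, hzx, hzy⟩
    rw [← dist_eq_norm]
    exact (dist_triangle_left x y z).trans_lt (add_lt_add hzx hzy)
  have hmin : 0 ≤ min δ η := le_min hδ hη
  have hball : ∀ xy ∈ hP.toFinset,
      volume.real (Metric.ball xy.1 δ ∩ Metric.ball xy.2 η) ≤ 2 * min δ η := by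
    intro xy _
    rcases le_total δ η with h | h
    · rw [min_eq_left h]
      exact (measureReal_mono inter_subset_left).trans (UnitAddCircle.volume_real_ball_le _ _ hδ)
    · rw [min_eq_right h]
      exact (measureReal_mono inter_subset_right).trans (UnitAddCircle.volume_real_ball_le _ _ hη)
  have hcard : (P.ncard : ℝ) ≤ 2 * ((δ + η) * q * r) :=
    UnitAddCircle.ncard_close_pairs_le hq hr hqr (add_nonneg hδ hη)
  have hmm : (δ + η) * min δ η ≤ 2 * (δ * η) := by
    rcases le_total δ η with h | h
    · rw [min_eq_left h]; nlinarith
    · rw [min_eq_right h]; nlinarith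
  calc volume.real (approxAddOrderOf UnitAddCircle q δ ∩ approxAddOrderOf UnitAddCircle r η)
      ≤ ∑ xy ∈ hP.toFinset, volume.real (Metric.ball xy.1 δ ∩ Metric.ball xy.2 η) :=
        (measureReal_mono hsub (measure_ne_top _ _)).trans (measureReal_biUnion_finset_le _ _)
    _ ≤ P.ncard * (2 * min δ η) := by
        refine (Finset.sum_le_sum hball).trans (le_of_eq ?_)
        rw [Finset.sum_const, nsmul_eq_mul, ← Set.ncard_eq_toFinset_card P hP]
    _ ≤ 2 * ((δ + η) * q * r) * (2 * min δ η) := by gcongr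
    _ = 4 * (q * r) * ((δ + η) * min δ η) := by ring
    _ ≤ 4 * (q * r) * (2 * (δ * η)) := by gcongr
    _ = 8 * (q * δ) * (r * η) := by ring

/-- A second moment lower bound for the measure of a finite union. -/
theorem second_moment_le_measureReal_biUnion {Ω ι : Type*} [MeasurableSpace Ω] (μ : Measure Ω)
    [IsFiniteMeasure μ] (S : Finset ι) (E : ι → Set Ω) (hE : ∀ i, MeasurableSet (E i)) (t : ℝ) :
    2 * t * ∑ i ∈ S, μ.real (E i) - t ^ 2 * ∑ i ∈ S, ∑ j ∈ S, μ.real (E i ∩ E j) ≤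
      μ.real (⋃ i ∈ S, E i) := by
  have hU : MeasurableSet (⋃ i ∈ S, E i) := S.measurableSet_biUnion fun i _ => hE i
  have hint : ∀ s : Set Ω, MeasurableSet s → Integrable (s.indicator (1 : Ω → ℝ)) μ :=
    fun s hs => (integrable_const (1 : ℝ)).indicator hs
  have hl : Integrable (fun ω => ∑ i ∈ S, (E i).indicator (1 : Ω → ℝ) ω) μ :=
    integrable_finsetSum _ fun i _ => hint _ (hE i)
  have hq : Integrable (fun ω => ∑ i ∈ S, ∑ j ∈ S, (E i ∩ E j).indicator (1 : Ω → ℝ) ω) μ :=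
    integrable_finsetSum _ fun i _ => integrable_finsetSum _ fun j _ =>
      hint _ ((hE i).inter (hE j))
  have hpoint : ∀ ω, 2 * t * ∑ i ∈ S, (E i).indicator (1 : Ω → ℝ) ω -
      t ^ 2 * ∑ i ∈ S, ∑ j ∈ S, (E i ∩ E j).indicator (1 : Ω → ℝ) ω ≤
      (⋃ i ∈ S, E i).indicator (1 : Ω → ℝ) ω := by
    intro ω
    simp only [inter_indicator_one, Pi.mul_apply, ← Finset.sum_mul_sum]
    by_cases hω : ω ∈ ⋃ i ∈ S, E i
    · rw [indicator_of_mem hω, Pi.one_apply]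
      nlinarith [sq_nonneg (1 - t * ∑ i ∈ S, (E i).indicator (1 : Ω → ℝ) ω)]
    · have h0 : ∑ i ∈ S, (E i).indicator (1 : Ω → ℝ) ω = 0 :=
        Finset.sum_eq_zero fun i hi =>
          indicator_of_notMem (fun h => hω (mem_iUnion₂.2 ⟨i, hi, h⟩)) _
      rw [indicator_of_notMem hω, h0]
      simp
  have h := integral_mono ((hl.const_mul (2 * t)).sub (hq.const_mul (t ^ 2))) (hint _ hU) hpoint
  have e1 : ∫ ω, ∑ i ∈ S, (E i).indicator (1 : Ω → ℝ) ω ∂μ = ∑ i ∈ S, μ.real (E i) := by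
    rw [integral_finsetSum _ fun i _ => hint _ (hE i)]
    exact Finset.sum_congr rfl fun i _ => integral_indicator_one (hE i)
  have e2 : ∫ ω, ∑ i ∈ S, ∑ j ∈ S, (E i ∩ E j).indicator (1 : Ω → ℝ) ω ∂μ =
      ∑ i ∈ S, ∑ j ∈ S, μ.real (E i ∩ E j) := by
    rw [integral_finsetSum _ fun i _ => integrable_finsetSum _ fun j _ =>
      hint _ ((hE i).inter (hE j))]
    refine Finset.sum_congr rfl fun i _ => ?_
    rw [integral_finsetSum _ fun j _ => hint _ ((hE i).inter (hE j))]
    exact Finset.sum_congr rfl fun j _ => integral_indicator_one ((hE i).inter (hE j))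
  rw [integral_indicator_one hU] at h
  simp only [Pi.sub_apply] at h
  rwa [integral_sub (hl.const_mul _) (hq.const_mul _), integral_const_mul, integral_const_mul,
    e1, e2] at h

/-- Quasi-independent events with large total weight have a union of measure bounded below. -/
theorem sq_div_ten_le_measureReal_biUnion {Ω ι : Type*} [MeasurableSpace Ω] (μ : Measure Ω)
    [IsFiniteMeasure μ] (S : Finset ι) (E : ι → Set Ω) (hE : ∀ i, MeasurableSet (E i))
    (w : ι → ℝ) (hw : 1 ≤ ∑ i ∈ S, w i) (ε : ℝ) (hε : 0 ≤ ε)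
    (hlow : ∀ i ∈ S, ε * w i ≤ μ.real (E i)) (hup : ∀ i ∈ S, μ.real (E i) ≤ 2 * w i)
    (hpair : ∀ i ∈ S, ∀ j ∈ S, i ≠ j → μ.real (E i ∩ E j) ≤ 8 * w i * w j) :
    ε ^ 2 / 10 ≤ μ.real (⋃ i ∈ S, E i) := by
  classical
  set P := ∑ i ∈ S, w i
  have hP : 0 < P := by linarith
  have h1 : ε * P ≤ ∑ i ∈ S, μ.real (E i) := by
    rw [Finset.mul_sum]
    exact Finset.sum_le_sum hlow
  have h2 : ∑ i ∈ S, ∑ j ∈ S, μ.real (E i ∩ E j) ≤ 10 * P ^ 2 := by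
    calc ∑ i ∈ S, ∑ j ∈ S, μ.real (E i ∩ E j)
        ≤ ∑ i ∈ S, ∑ j ∈ S, (8 * w i * w j + if i = j then 2 * w i else 0) := by
          refine Finset.sum_le_sum fun i hi => Finset.sum_le_sum fun j hj => ?_
          split_ifs with hij
          · subst hij
            rw [inter_self]
            nlinarith [hup i hi, mul_self_nonneg (w i)]
          · rw [add_zero]
            exact hpair i hi j hj hij
      _ = 8 * P ^ 2 + 2 * P := by
          simp only [Finset.sum_add_distrib, Finset.sum_ite_eq, ← Finset.mul_sum, P]
          rw [Finset.sum_congr rfl fun i (hi : i ∈ S) => if_pos hi, ← Finset.sum_mul,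
            ← Finset.mul_sum, ← Finset.mul_sum]
          ring
      _ ≤ 10 * P ^ 2 := by nlinarith
  have h := second_moment_le_measureReal_biUnion μ S E hE (ε / (10 * P))
  have h3 : 2 * (ε / (10 * P)) * (ε * P) ≤ 2 * (ε / (10 * P)) * ∑ i ∈ S, μ.real (E i) := by
    gcongr
  have h4 : (ε / (10 * P)) ^ 2 * ∑ i ∈ S, ∑ j ∈ S, μ.real (E i ∩ E j) ≤
      (ε / (10 * P)) ^ 2 * (10 * P ^ 2) := by gcongr
  have h5 : 2 * (ε / (10 * P)) * (ε * P) - (ε / (10 * P)) ^ 2 * (10 * P ^ 2) = ε ^ 2 / 10 := by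
    field_simp
    ring
  linarith

theorem not_summable_min_half {ψ : ℕ → ℝ} (hdiv : ¬ Summable ψ) :
    ¬ Summable fun q => min (ψ q) (1 / 2) := by
  intro hs
  refine hdiv ((summable_congr_atTop ?_).1 hs)
  filter_upwards [hs.tendsto_atTop_zero.eventually (gt_mem_nhds (by norm_num : (0 : ℝ) < 1 / 2))]
    with q hq
  rcases min_lt_iff.1 hq with h | h
  · exact min_eq_left h.le
  · exact absurd h (lt_irrefl _)

theorem exists_finset_one_le_sum {f : ℕ → ℝ} (hf0 : ∀ q, 0 ≤ f q) (hf : ¬ Summable f) (n : ℕ) :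
    ∃ S : Finset ℕ, (∀ q ∈ S, n ≤ q) ∧ 1 ≤ ∑ q ∈ S, f q := by
  have htend := (not_summable_iff_tendsto_nat_atTop_of_nonneg hf0).1 hf
  obtain ⟨N, hN, hnN⟩ := ((htend.eventually_ge_atTop (∑ q ∈ Finset.range n, f q + 1)).and
    (eventually_ge_atTop n)).exists
  refine ⟨Finset.Ico n N, fun q hq => (Finset.mem_Ico.1 hq).1, ?_⟩
  rw [Finset.sum_Ico_eq_sub _ hnN]
  linarith

theorem volume_iInter_ne_zero {Ω : Type*} [MeasurableSpace Ω] (μ : Measure Ω) [IsFiniteMeasure μ]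
    (U : ℕ → Set Ω) (hU : ∀ n, MeasurableSet (U n)) (hanti : Antitone U) (c : ℝ) (hc : 0 < c)
    (hlow : ∀ n, c ≤ μ.real (U n)) : μ (⋂ n, U n) ≠ 0 := by
  have ht := tendsto_measure_iInter_atTop (fun n => (hU n).nullMeasurableSet) hanti
    ⟨0, measure_ne_top μ _⟩
  have hle : ENNReal.ofReal c ≤ μ (⋂ n, U n) :=
    ge_of_tendsto' ht fun n => ENNReal.ofReal_le_of_le_toReal (hlow n)
  exact ((ENNReal.ofReal_pos.2 hc).trans_le hle).ne'

/-- The Duffin–Schaeffer theorem on the circle, for approximations supported on denominators `q`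
with `φ(q)/q` bounded below. -/
theorem UnitAddCircle.ae_mem_addWellApproximable (B : Set ℕ) (ε : ℝ) (hε : 0 < ε)
    (hB : ∀ q ∈ B, 0 < q ∧ ε * q ≤ q.totient) (ψ : ℕ → ℝ) (hψ0 : ∀ q, 0 ≤ ψ q)
    (hψ1 : ∀ q, ψ q ≤ 1 / 2) (hdiv : ¬ Summable (B.indicator ψ)) :
    ∀ᵐ x : UnitAddCircle,
      x ∈ addWellApproximable UnitAddCircle (B.indicator fun q => ψ q / q) := by
  set δ : ℕ → ℝ := B.indicator fun q => ψ q / q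
  set E : ℕ → Set UnitAddCircle := fun q => approxAddOrderOf UnitAddCircle q (δ q)
  have hδ0 : ∀ q, 0 ≤ δ q :=
    fun q => indicator_nonneg (fun q _ => div_nonneg (hψ0 q) q.cast_nonneg) q
  have hqδ : ∀ q ∈ B, q * δ q = ψ q := by
    intro q hq
    have : (q : ℝ) ≠ 0 := by exact_mod_cast (hB q hq).1.ne'
    simp only [δ, indicator_of_mem hq]
    field_simp
  have hδ : Tendsto δ atTop (𝓝 0) := by
    refine squeeze_zero hδ0 (fun q => ?_) (tendsto_const_div_atTop_nhds_zero_nat (1 / 2 : ℝ))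
    refine indicator_le_self' (fun q _ => div_nonneg (hψ0 q) q.cast_nonneg) q |>.trans ?_
    exact div_le_div_of_nonneg_right (hψ1 q) q.cast_nonneg
  have hE : ∀ q, MeasurableSet (E q) := fun q => Metric.isOpen_thickening.measurableSet
  set U : ℕ → Set UnitAddCircle := fun n => ⋃ q ≥ n, ⋃ _ : q ∈ B, E q
  have hU : ∀ n, MeasurableSet (U n) := fun n =>
    MeasurableSet.iUnion fun q => MeasurableSet.iUnion fun _ => MeasurableSet.iUnion fun _ => hE q
  have hanti : Antitone U := fun m n hmn =>
    biUnion_subset_biUnion_left fun q (hq : n ≤ q) => hmn.trans hq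
  have hlow : ∀ n, ε ^ 2 / 10 ≤ volume.real (U n) := by
    intro n
    obtain ⟨S, hSn, hS⟩ :=
      exists_finset_one_le_sum (fun q => indicator_nonneg (fun q _ => hψ0 q) q) hdiv n
    classical
    set T := S.filter (· ∈ B)
    have hTB : ∀ q ∈ T, q ∈ B := fun q hq => (Finset.mem_filter.1 hq).2
    have hT : 1 ≤ ∑ q ∈ T, ψ q := by
      rw [Finset.sum_filter]
      simpa only [indicator_apply] using hS
    have hvol : ∀ q ∈ T, volume.real (E q) = q.totient * (2 * δ q) := fun q hq =>
      UnitAddCircle.volume_real_approxAddOrderOf (hB q (hTB q hq)).1 (hδ0 q)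
        ((hqδ q (hTB q hq)).trans_le (hψ1 q))
    have hmain := sq_div_ten_le_measureReal_biUnion volume T E hE ψ hT ε hε.le
      (fun q hq => by
        have h1 := mul_le_mul_of_nonneg_right (hB q (hTB q hq)).2 (hδ0 q)
        rw [mul_assoc, hqδ q (hTB q hq)] at h1
        rw [hvol q hq]
        nlinarith [mul_nonneg (Nat.cast_nonneg (α := ℝ) q.totient) (hδ0 q)])
      (fun q hq => by
        have h1 : (q.totient : ℝ) ≤ q := by exact_mod_cast Nat.totient_le q
        have h2 := mul_le_mul_of_nonneg_right h1 (hδ0 q)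
        rw [hqδ q (hTB q hq)] at h2
        rw [hvol q hq]
        linarith)
      (fun q hq r hr hqr => by
        rw [← hqδ q (hTB q hq), ← hqδ r (hTB r hr)]
        exact UnitAddCircle.volume_real_approxAddOrderOf_inter_le (hB q (hTB q hq)).1
          (hB r (hTB r hr)).1 hqr (hδ0 q) (hδ0 r))
    refine hmain.trans (measureReal_mono (iUnion₂_subset fun q hq x hx => ?_) (measure_ne_top _ _))
    simp only [U, mem_iUnion]
    exact ⟨q, hSn q (Finset.mem_filter.1 hq).1, hTB q hq, hx⟩
  have hsub : ⋂ n, U n ⊆ addWellApproximable UnitAddCircle δ := by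
    intro x hx
    rw [UnitAddCircle.mem_addWellApproximable_iff]
    refine Set.infinite_of_forall_exists_gt fun n => ?_
    have hxn := mem_iInter.1 hx (n + 1)
    simp only [U, mem_iUnion] at hxn
    obtain ⟨q, hqn, hqB, hxq⟩ := hxn
    exact ⟨q, (UnitAddCircle.mem_approxAddOrderOf_iff (hB q hqB).1).1 hxq, hqn⟩
  refine (AddCircle.addWellApproximable_ae_empty_or_univ δ hδ).resolve_left fun hnull => ?_
  refine volume_iInter_ne_zero volume U hU hanti (ε ^ 2 / 10) (by positivity) hlow ?_
  refine measure_mono_null hsub ?_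
  exact measure_eq_zero_iff_ae_notMem.2 hnull

theorem UnitAddCircle.ae_coe_of_ae {p : UnitAddCircle → Prop} (h : ∀ᵐ x, p x) :
    ∀ᵐ α : ℝ, p (α : UnitAddCircle) := by
  rw [← Measure.restrict_univ (μ := (volume : Measure ℝ)), ← iUnion_Ioc_intCast ℝ,
    ae_restrict_iUnion_iff]
  exact fun n => (UnitAddCircle.measurePreserving_mk n).quasiMeasurePreserving.ae h

/-- Closeness on the circle to `m / q` lifts to closeness on the line to an equivalent reduced
fraction. -/
theorem UnitAddCircle.exists_int_abs_sub_div_lt {α δ : ℝ} {m q : ℕ} (hq : 0 < q)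
    (hmq : m.gcd q = 1) (h : ‖(α : UnitAddCircle) - ((m / q : ℝ) : UnitAddCircle)‖ < δ) :
    ∃ p : ℤ, Int.gcd p q = 1 ∧ |α - p / q| < δ := by
  have hqR : (q : ℝ) ≠ 0 := by exact_mod_cast hq.ne'
  rw [← AddCircle.coe_sub, UnitAddCircle.norm_eq] at h
  refine ⟨m + round (α - m / q) * q, ?_, ?_⟩
  · rw [Int.gcd_add_mul_right_left]
    exact_mod_cast hmq
  · convert h using 2
    push_cast
    field_simp
    ring

/-- Duffin–Schaeffer-type theorem: if `A ⊆ ℕ` has positive lower density and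
`ψ : ℕ → [0,∞)` is monotone decreasing with divergent series, then for a.e. `α ∈ ℝ`
there are infinitely many coprime pairs `(p, q) ∈ ℤ × A` with `|α - p/q| < ψ(q)/q`. -/
theorem duffin_schaeffer_positive_lower_density (A : Set ℕ) (hA : 0 < lowerDensity A)
    (ψ : ℕ → ℝ) (hψ0 : ∀ q, 0 ≤ ψ q) (hψmono : Antitone ψ)
    (hψdiv : Filter.Tendsto (fun N : ℕ => ∑ q ∈ Finset.range N, ψ q)
      Filter.atTop Filter.atTop) :
    ∀ᵐ α ∂(volume : Measure ℝ),
      {pq : ℤ × ℕ | pq.2 ∈ A ∧ Int.gcd pq.1 (pq.2 : ℤ) = 1 ∧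
        |α - (pq.1 : ℝ) / (pq.2 : ℝ)| < ψ pq.2 / pq.2}.Infinite := by
  have hdiv : ¬ Summable ψ := (not_summable_iff_tendsto_nat_atTop_of_nonneg hψ0).2 hψdiv
  set ψ' : ℕ → ℝ := fun q => min (ψ q) (1 / 2)
  have hψ'0 : ∀ q, 0 ≤ ψ' q := fun q => le_min (hψ0 q) (by norm_num)
  have hψ' : Antitone ψ' := fun q r hqr => min_le_min_right _ (hψmono hqr)
  obtain ⟨ε, hε, hns⟩ :=
    exists_not_summable_indicator A hA ψ' hψ'0 hψ' (not_summable_min_half hdiv)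
  set B := {q : ℕ | q ∈ A ∧ 0 < q ∧ ε * q ≤ q.totient}
  filter_upwards [UnitAddCircle.ae_coe_of_ae (UnitAddCircle.ae_mem_addWellApproximable B ε hε
    (fun q hq => hq.2) ψ' hψ'0 (fun q => min_le_right _ _) hns)] with α hα
  rw [UnitAddCircle.mem_addWellApproximable_iff] at hα
  refine Set.Infinite.of_image Prod.snd (hα.mono ?_)
  rintro q ⟨m, hmq, hgcd, hlt⟩
  have hqB : q ∈ B := by
    by_contra hq
    rw [indicator_of_notMem hq] at hlt
    exact (norm_nonneg _).not_gt hlt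
  rw [indicator_of_mem hqB] at hlt
  obtain ⟨p, hp, hpq⟩ := UnitAddCircle.exists_int_abs_sub_div_lt (Nat.zero_lt_of_lt hmq) hgcd hlt
  refine ⟨(p, q), ⟨hqB.1, hp, hpq.trans_le ?_⟩, rfl⟩
  exact div_le_div_of_nonneg_right (min_le_left _ _) q.cast_nonneg
end

section
/- Let (I_k)_{k∈ℕ} be a sequence of intervals in 𝕋 with μ(I_k) → 0, let c > 0, and let (U_k)_{k∈ℕ} be measurable subsets of 𝕋 with U_k ⊆ I_k and μ(U_k) ≥ c·μ(I_k) for all k. Then μ(limsup_{k→∞} U_k) = μ(limsup_{k→∞} I_k). -/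
open MeasureTheory Filter Set Topology

open Metric in
/-- In a space with a uniformly locally doubling measure, if the sets `U k` fill a fixed proportion
of balls `ball (w k) (r k)` with radii tending to zero, then almost every point of the limsup of
the balls is in the limsup of the `U k`. -/
theorem limsup_ball_ae_le_limsup {α : Type*} [PseudoMetricSpace α] [SecondCountableTopology α]
    [MeasurableSpace α] [BorelSpace α] (μ : Measure α) [IsLocallyFiniteMeasure μ]
    [IsUnifLocDoublingMeasure μ] {w : ℕ → α} {r : ℕ → ℝ} {U : ℕ → Set α} {c : ENNReal}
    (hc : c ≠ 0) (hr : Tendsto r atTop (𝓝 0)) (hU : ∀ k, MeasurableSet (U k))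
    (hUw : ∀ k, U k ⊆ closedBall (w k) (r k))
    (hUc : ∀ k, c * μ (closedBall (w k) (r k)) ≤ μ (U k)) :
    (limsup (fun k => ball (w k) (r k)) atTop : Set α) ≤ᵐ[μ] (limsup U atTop : Set α) := by
  rw [ae_le_set, limsup_eq_iInf_iSup_of_nat (u := U)]
  simp only [iInf_eq_iInter, iSup_eq_iUnion, sdiff_iInter]
  rw [measure_iUnion_null_iff]
  intro i
  set W : Set α := limsup (fun k => ball (w k) (r k)) atTop \ ⋃ j, ⋃ (_ : j ≥ i), U j
  by_contra contra
  obtain ⟨d, hd, hd'⟩ := Measure.exists_mem_of_measure_ne_zero_of_ae contra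
      (IsUnifLocDoublingMeasure.ae_tendsto_measure_inter_div.{_, 0} μ W 1)
  have hfreq : ∃ᶠ k in atTop, d ∈ ball (w k) (r k) := mem_limsup_iff_frequently_mem.1 hd.1
  obtain ⟨f, hf, hdf⟩ := extraction_of_frequently_atTop hfreq
  have hpos : ∀ j, 0 < r (f j) := fun j => pos_of_mem_ball (hdf j)
  have hrf : Tendsto (fun j => r (f j)) atTop (𝓝[>] 0) :=
    tendsto_nhdsWithin_iff.2 ⟨hr.comp hf.tendsto_atTop, .of_forall hpos⟩
  have hlim := hd' (fun j => w (f j)) (fun j => r (f j)) hrf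
    (.of_forall fun j => by simpa using (mem_ball.1 (hdf j)).le)
  have hbound : ∀ᶠ j in atTop, μ (W ∩ closedBall (w (f j)) (r (f j))) /
      μ (closedBall (w (f j)) (r (f j))) + c ≤ 1 := by
    filter_upwards [hlim.eventually_ne one_ne_zero, hf.tendsto_atTop.eventually_ge_atTop i]
      with j hj hij
    set B := closedBall (w (f j)) (r (f j))
    obtain ⟨hWB, hB⟩ := ENNReal.div_ne_zero.1 hj
    have hB0 : μ B ≠ 0 := fun h => hWB (measure_mono_null inter_subset_right h)
    have hdisj : Disjoint (W ∩ B) (U (f j)) := by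
      refine Disjoint.mono_left inter_subset_left (disjoint_left.2 fun x hx hxU => hx.2 ?_)
      exact mem_iUnion₂.2 ⟨f j, hij, hxU⟩
    have hadd : μ (W ∩ B) + c * μ B ≤ μ B := by
      grw [hUc (f j), ← measure_union hdisj (hU _)]
      exact measure_mono (union_subset inter_subset_right (hUw _))
    calc μ (W ∩ B) / μ B + c = (μ (W ∩ B) + c * μ B) / μ B := by
          rw [ENNReal.add_div, ENNReal.mul_div_cancel_right hB0 hB]
      _ ≤ 1 := ENNReal.div_le_of_le_mul (by rwa [one_mul])
  have h := le_of_tendsto (hlim.add_const c) hbound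
  exact hc (nonpos_iff_eq_zero.1
    ((ENNReal.add_le_add_iff_left ENNReal.one_ne_top).1 (by rwa [add_zero])))

theorem toCircle_image_Ioo (a b : ℝ) :
    toCircle '' Ioo a b = Metric.ball (toCircle ((a + b) / 2)) (max ((b - a) / 2) 0) := by
  ext x
  constructor
  · rintro ⟨y, ⟨hay, hyb⟩, rfl⟩
    rw [mem_ball_iff_norm, toCircle, toCircle, ← AddCircle.coe_sub, UnitAddCircle.norm_eq]
    refine lt_max_of_lt_left ((round_le _ 0).trans_lt ?_)
    rw [Int.cast_zero, sub_zero, abs_lt]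
    constructor <;> linarith
  · induction x using QuotientAddGroup.induction_on with | H y => ?_
    intro h
    rw [mem_ball_iff_norm, toCircle, ← AddCircle.coe_sub, UnitAddCircle.norm_eq] at h
    set n := round (y - (a + b) / 2)
    have h' := (lt_max_iff.1 h).resolve_right (abs_nonneg _).not_gt
    rw [abs_lt] at h'
    refine ⟨y - n, ⟨by linarith, by linarith⟩, ?_⟩
    rw [toCircle, AddCircle.coe_sub, sub_eq_self]
    exact AddCircle.coe_eq_zero_iff 1 |>.2 ⟨n, by simp⟩

/-- Gallagher's lemma on `𝕋`: if `I_k` are intervals with `μ(I_k) → 0` and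
`U_k ⊆ I_k` are measurable with `μ(U_k) ≥ c μ(I_k)` for a fixed `c > 0`, then
`μ(limsup U_k) = μ(limsup I_k)`. -/
theorem gallagher_lemma (I U : ℕ → Set UnitAddCircle)
    (hI : ∀ k, ∃ a b : ℝ, I k = toCircle '' Set.Ioo a b)
    (hI0 : Filter.Tendsto (fun k => (volume : Measure UnitAddCircle) (I k))
      Filter.atTop (nhds 0))
    (c : ℝ) (hc : 0 < c)
    (hUmeas : ∀ k, MeasurableSet (U k))
    (hUI : ∀ k, U k ⊆ I k)
    (hUc : ∀ k, ENNReal.ofReal c * (volume : Measure UnitAddCircle) (I k)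
      ≤ (volume : Measure UnitAddCircle) (U k)) :
    (volume : Measure UnitAddCircle) (Filter.limsup U Filter.atTop)
      = (volume : Measure UnitAddCircle) (Filter.limsup I Filter.atTop) := by
  choose a b hab using hI
  simp only [toCircle_image_Ioo] at hab
  set w : ℕ → UnitAddCircle := fun k => toCircle ((a k + b k) / 2)
  set r : ℕ → ℝ := fun k => max ((b k - a k) / 2) 0
  obtain rfl : I = fun k => Metric.ball (w k) (r k) := funext hab
  have hvol : ∀ k, volume (Metric.ball (w k) (r k)) = volume (Metric.closedBall (w k) (r k)) :=
    fun k => (measure_congr AddCircle.closedBall_ae_eq_ball).symm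
  simp only [hvol] at hI0 hUc
  have hr : Tendsto r atTop (𝓝 0) := by
    simp only [AddCircle.volume_closedBall] at hI0
    refine squeeze_zero' (.of_forall fun k => le_max_right _ _) ?_
      ((ENNReal.tendsto_toReal ENNReal.zero_ne_top).comp hI0)
    filter_upwards [hI0.eventually_lt_const zero_lt_one] with k hk
    have h0 : 0 ≤ r k := le_max_right _ _
    have h1 : 2 * r k < 1 := by
      rw [ENNReal.ofReal_lt_one, min_lt_iff] at hk
      exact hk.resolve_left (lt_irrefl _)
    rw [Function.comp_apply, min_eq_right h1.le, ENNReal.toReal_ofReal (by positivity)]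
    linarith
  refine le_antisymm (measure_mono (limsup_le_limsup (.of_forall hUI))) (measure_mono_ae ?_)
  exact limsup_ball_ae_le_limsup volume (ENNReal.ofReal_pos.2 hc).ne' hr hUmeas
    (fun k => (hUI k).trans Metric.ball_subset_closedBall) hUc
end

section
/- Let A ⊆ ℕ be a set of positive lower density. Then for Haar-almost every α ∈ 𝕋 (with continued fraction expansion [0; a₁, a₂, …] and convergent denominators q_k) there exists a strictly increasing sequence (k_j)_{j∈ℕ} of even positive integers such that q_{k_j} ∈ A for all j and (Σ_{i=1}^{k_j} a_i)/a_{k_j + 1} → 0 as j → ∞. -/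
open MeasureTheory Filter Set Topology

/-- Iterates of the Gauss map, starting from the fractional part of `α`. -/
noncomputable def gaussIter (α : ℝ) : ℕ → ℝ
  | 0 => Int.fract α
  | n + 1 => Int.fract (1 / gaussIter α n)

/-- The `k`-th partial quotient `a_k(α)` (for `k ≥ 1`) of the continued fraction
expansion of `α`. -/
noncomputable def cfA (α : ℝ) (k : ℕ) : ℕ := ⌊1 / gaussIter α (k - 1)⌋₊

/-- The denominators `q_k(α)` of the convergents of `α`:
`q₀ = 1`, `q₁ = a₁`, `q_{k+1} = a_{k+1} q_k + q_{k-1}`. -/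
noncomputable def cfQ (α : ℝ) : ℕ → ℕ
  | 0 => 1
  | 1 => cfA α 1
  | (k + 2) => cfA α (k + 2) * cfQ α (k + 1) + cfQ α k

section ContinuedFraction

/-- The denominators of the convergents shifted by one: `cfQPrev α k = q_{k-1}`, with `q_{-1} = 0`. -/
noncomputable def cfQPrev (α : ℝ) : ℕ → ℕ
  | 0 => 0
  | k + 1 => cfQ α k

/-- The numerators `p_k(α)` of the convergents of `α` (without integer part). -/
noncomputable def cfP (α : ℝ) : ℕ → ℕ
  | 0 => 0
  | 1 => 1
  | (k + 2) => cfA α (k + 2) * cfP α (k + 1) + cfP α k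

/-- The numerators of the convergents shifted by one, with `p_{-1} = 1`. -/
noncomputable def cfPPrev (α : ℝ) : ℕ → ℕ
  | 0 => 1
  | k + 1 => cfP α k

/-- The sum `a₁ + ⋯ + a_k` of the first partial quotients. -/
noncomputable def cfS (α : ℝ) (k : ℕ) : ℕ := ∑ i ∈ Finset.Icc 1 k, cfA α i

lemma cfQPrev_succ (α : ℝ) (k : ℕ) : cfQPrev α (k + 1) = cfQ α k := rfl

lemma cfPPrev_succ (α : ℝ) (k : ℕ) : cfPPrev α (k + 1) = cfP α k := rfl

lemma cfQ_succ (α : ℝ) (k : ℕ) : cfQ α (k + 1) = cfA α (k + 1) * cfQ α k + cfQPrev α k := by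
  cases k <;> simp [cfQ, cfQPrev]

lemma cfP_succ (α : ℝ) (k : ℕ) : cfP α (k + 1) = cfA α (k + 1) * cfP α k + cfPPrev α k := by
  cases k <;> simp [cfP, cfPPrev]

lemma cfA_succ (α : ℝ) (k : ℕ) : cfA α (k + 1) = ⌊1 / gaussIter α k⌋₊ := rfl

lemma cfP_det (α : ℝ) (k : ℕ) :
    (cfPPrev α k : ℤ) * cfQ α k - cfP α k * cfQPrev α k = (-1) ^ k := by
  induction k with
  | zero => simp [cfPPrev, cfQ, cfP, cfQPrev]
  | succ k ih =>
    rw [cfQ_succ, cfP_succ, pow_succ, ← ih]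
    simp only [cfPPrev_succ, cfQPrev_succ]
    push_cast
    ring

lemma irrational_gaussIter {α : ℝ} (h : Irrational α) (n : ℕ) : Irrational (gaussIter α n) := by
  induction n with
  | zero => rw [gaussIter, ← Int.self_sub_floor]; exact h.sub_intCast _
  | succ n ih => rw [gaussIter, ← Int.self_sub_floor, one_div]; exact ih.inv.sub_intCast _

lemma gaussIter_pos {α : ℝ} (h : Irrational α) (n : ℕ) : 0 < gaussIter α n := by
  have h0 : 0 ≤ gaussIter α n := by cases n <;> exact Int.fract_nonneg _
  exact lt_of_le_of_ne h0 (irrational_gaussIter h n).ne_zero.symm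

lemma gaussIter_lt_one (α : ℝ) (n : ℕ) : gaussIter α n < 1 := by
  cases n <;> exact Int.fract_lt_one _

lemma one_div_gaussIter {α : ℝ} (h : Irrational α) (n : ℕ) :
    1 / gaussIter α n = cfA α (n + 1) + gaussIter α (n + 1) := by
  have h0 : 0 ≤ 1 / gaussIter α n := by have := gaussIter_pos h n; positivity
  rw [cfA_succ, gaussIter, ← Int.self_sub_floor, natCast_floor_eq_intCast_floor h0]
  ring

lemma cfA_succ_pos {α : ℝ} (h : Irrational α) (n : ℕ) : 0 < cfA α (n + 1) := by
  rw [cfA_succ, Nat.floor_pos, le_div_iff₀ (gaussIter_pos h n), one_mul]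
  exact (gaussIter_lt_one α n).le

lemma cfQ_pos {α : ℝ} (h : Irrational α) (n : ℕ) : 0 < cfQ α n := by
  induction n with
  | zero => simp [cfQ]
  | succ n ih =>
    rw [cfQ_succ]
    have := cfA_succ_pos h n
    positivity

lemma cfQPrev_le {α : ℝ} (h : Irrational α) (n : ℕ) : cfQPrev α n ≤ cfQ α n := by
  cases n with
  | zero => simp [cfQPrev]
  | succ n =>
    rw [cfQ_succ]
    have := cfA_succ_pos h n
    simp only [cfQPrev_succ]
    nlinarith

lemma cfQ_le_succ {α : ℝ} (h : Irrational α) (n : ℕ) : cfQ α n ≤ cfQ α (n + 1) :=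
  cfQPrev_le h (n + 1)

lemma two_pow_le_cfQ {α : ℝ} (h : Irrational α) (n : ℕ) : 2 ^ n ≤ cfQ α (2 * n) := by
  induction n with
  | zero => simp [cfQ]
  | succ n ih =>
    rw [show 2 * (n + 1) = 2 * n + 1 + 1 by ring, cfQ_succ, pow_succ]
    have h1 := cfA_succ_pos h (2 * n + 1)
    have h2 := cfQ_le_succ h (2 * n)
    simp only [cfQPrev_succ]
    nlinarith

/-- `α = (p_n + x_n p_{n-1}) / (q_n + x_n q_{n-1})`, where `x_n` is the `n`-th Gauss iterate. -/
lemma mul_cfQ_add_eq {α : ℝ} (h : Irrational α) (h0 : 0 < α) (h1 : α < 1) (n : ℕ) :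
    α * (cfQ α n + gaussIter α n * cfQPrev α n) = cfP α n + gaussIter α n * cfPPrev α n := by
  induction n with
  | zero =>
    simp [cfQ, cfQPrev, cfP, cfPPrev, gaussIter, Int.fract_eq_self.2 ⟨h0.le, h1⟩]
  | succ n ih =>
    have hx := gaussIter_pos h n
    have e := one_div_gaussIter h n
    have e' : 1 = gaussIter α n * (cfA α (n + 1) + gaussIter α (n + 1)) := by
      rw [← e]; field_simp
    rw [cfQ_succ, cfP_succ]
    simp only [cfPPrev_succ, cfQPrev_succ]
    push_cast
    generalize (cfA α (n + 1) : ℝ) = a at *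
    generalize gaussIter α (n + 1) = y at *
    generalize gaussIter α n = x at *
    apply mul_left_cancel₀ hx.ne'
    linear_combination ih + (cfP α n - α * cfQ α n) * e'

lemma mobius_inverse_branch {α : ℝ} (h : Irrational α) (n : ℕ) :
    ∀ x : ℝ, 0 < x → x < 1 → ∀ β : ℝ,
      β = (cfP α n + x * cfPPrev α n) / (cfQ α n + x * cfQPrev α n) →
      (∀ i < n, cfA β (i + 1) = cfA α (i + 1)) ∧ gaussIter β n = x ∧ β ∈ Ioo 0 1 := by
  induction n with
  | zero =>
    rintro x h0 h1 β rfl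
    simp [h0, h1, cfQ, cfQPrev, cfP, cfPPrev, gaussIter, Int.fract_eq_self.2 ⟨h0.le, h1⟩]
  | succ n ih =>
    intro x h0 h1 β hβ
    have ha : (1 : ℝ) ≤ cfA α (n + 1) := by exact_mod_cast cfA_succ_pos h n
    have hq : (0 : ℝ) < cfQ α n := by exact_mod_cast cfQ_pos h n
    obtain ⟨ih1, ih2, ih3⟩ := ih (1 / (cfA α (n + 1) + x)) (by positivity)
      (by rw [div_lt_one (by positivity)]; linarith) β (by
        rw [hβ, cfQ_succ, cfP_succ]
        simp only [cfPPrev_succ, cfQPrev_succ]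
        push_cast
        rw [div_eq_div_iff (by positivity) (by positivity)]
        field_simp
        ring)
    have e : 1 / gaussIter β n = cfA α (n + 1) + x := by rw [ih2]; simp
    have hf : ⌊(cfA α (n + 1) : ℝ) + x⌋₊ = cfA α (n + 1) := by
      rw [add_comm, Nat.floor_add_natCast h0.le, Nat.floor_eq_zero.2 h1, zero_add]
    refine ⟨fun i hi ↦ ?_, ?_, ih3⟩
    · rcases Nat.lt_succ_iff_lt_or_eq.1 hi with hi | rfl
      · exact ih1 i hi
      · rw [cfA_succ, e, hf]
    · rw [gaussIter, e, Int.fract_natCast_add, Int.fract_eq_self.2 ⟨h0.le, h1⟩]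

lemma cfQ_congr {α β : ℝ} {n : ℕ} (h : ∀ i < n, cfA α (i + 1) = cfA β (i + 1)) :
    cfQ α n = cfQ β n := by
  suffices ∀ m ≤ n, cfQ α m = cfQ β m ∧ cfQPrev α m = cfQPrev β m from (this n le_rfl).1
  intro m
  induction m with
  | zero => simp [cfQ, cfQPrev]
  | succ m ih =>
    intro hm
    obtain ⟨h1, h2⟩ := ih (by omega)
    rw [cfQ_succ, cfQ_succ, h m hm, h1, h2]
    exact ⟨rfl, h1⟩

lemma cfP_congr {α β : ℝ} {n : ℕ} (h : ∀ i < n, cfA α (i + 1) = cfA β (i + 1)) :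
    cfP α n = cfP β n := by
  suffices ∀ m ≤ n, cfP α m = cfP β m ∧ cfPPrev α m = cfPPrev β m from (this n le_rfl).1
  intro m
  induction m with
  | zero => simp [cfP, cfPPrev]
  | succ m ih =>
    intro hm
    obtain ⟨h1, h2⟩ := ih (by omega)
    rw [cfP_succ, cfP_succ, h m hm, h1, h2]
    exact ⟨rfl, h1⟩

lemma cfS_succ (α : ℝ) (n : ℕ) : cfS α (n + 1) = cfS α n + cfA α (n + 1) := by
  rw [cfS, Finset.sum_Icc_succ_top (by omega), cfS]

lemma cfS_eq_sum_range (α : ℝ) (n : ℕ) : cfS α n = ∑ i ∈ Finset.range n, cfA α (i + 1) := by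
  induction n with
  | zero => simp [cfS]
  | succ n ih => rw [cfS_succ, ih, Finset.sum_range_succ]

lemma cfS_congr {α β : ℝ} {n : ℕ} (h : ∀ i < n, cfA α (i + 1) = cfA β (i + 1)) :
    cfS α n = cfS β n := by
  rw [cfS_eq_sum_range, cfS_eq_sum_range]
  exact Finset.sum_congr rfl fun i hi ↦ h i (Finset.mem_range.1 hi)

lemma cfS_mono (α : ℝ) : Monotone (cfS α) :=
  monotone_nat_of_le_succ fun n ↦ by rw [cfS_succ]; omega

lemma cfS_pos {α : ℝ} (h : Irrational α) {n : ℕ} (hn : 0 < n) : 0 < cfS α n := by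
  obtain ⟨m, rfl⟩ := Nat.exists_eq_succ_of_ne_zero hn.ne'
  rw [cfS_succ]
  have := cfA_succ_pos h m
  omega

lemma measurable_gaussIter (n : ℕ) : Measurable fun α ↦ gaussIter α n := by
  induction n with
  | zero => exact measurable_fract
  | succ n ih => exact measurable_fract.comp (ih.const_div 1)

lemma measurable_cfA (n : ℕ) : Measurable fun α ↦ cfA α n :=
  Nat.measurable_floor.comp ((measurable_gaussIter (n - 1)).const_div 1)

lemma measurable_cfS (n : ℕ) : Measurable fun α ↦ cfS α n :=
  Finset.measurable_fun_sum _ fun i _ ↦ measurable_cfA i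

end ContinuedFraction

section Legendre

lemma cfQ_mul_sub_cfP_succ {α : ℝ} (h : Irrational α) (h0 : 0 < α) (h1 : α < 1) (k : ℕ) :
    cfQ α (k + 1) * α - cfP α (k + 1) = -gaussIter α (k + 1) * (cfQ α k * α - cfP α k) := by
  have hx := gaussIter_pos h k
  have e := one_div_gaussIter h k
  have e' : 1 = gaussIter α k * (cfA α (k + 1) + gaussIter α (k + 1)) := by
    rw [← e]; field_simp
  have m := mul_cfQ_add_eq h h0 h1 k
  rw [cfQ_succ, cfP_succ]
  push_cast
  generalize (cfA α (k + 1) : ℝ) = a at *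
  generalize gaussIter α (k + 1) = y at *
  generalize gaussIter α k = x at *
  apply mul_left_cancel₀ hx.ne'
  linear_combination m + (cfP α k - α * cfQ α k) * e'

lemma cfQ_mul_sub_cfP_sign {α : ℝ} (h : Irrational α) (h0 : 0 < α) (h1 : α < 1) (k : ℕ) :
    0 < (-1) ^ k * (cfQ α k * α - cfP α k) := by
  induction k with
  | zero => simpa [cfQ, cfP]
  | succ k ih =>
    rw [cfQ_mul_sub_cfP_succ h h0 h1, pow_succ]
    nlinarith [mul_pos (gaussIter_pos h (k + 1)) ih]

/-- Legendre's criterion for approximations from below: they are convergents of even index. -/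
lemma exists_even_cfQ_eq {α : ℝ} (h : Irrational α) (h0 : 0 < α) (h1 : α < 1) {p q : ℕ}
    (hq : 2 ≤ q) (hc : p.Coprime q) (hl : (p / q : ℝ) < α)
    (hr : α < p / q + 1 / (2 * (q : ℝ) ^ 2)) : ∃ k, Even k ∧ 0 < k ∧ cfQ α k = q := by
  obtain ⟨k, hk, hk'⟩ : ∃ k, cfQ α k ≤ q ∧ q < cfQ α (k + 1) := by
    have hex : ∃ n, q < cfQ α n := ⟨2 * q, lt_of_lt_of_le Nat.lt_two_pow_self (two_pow_le_cfQ h q)⟩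
    obtain ⟨k, hk⟩ : ∃ k, Nat.find hex = k + 1 := by
      apply Nat.exists_eq_succ_of_ne_zero
      intro h
      have := Nat.find_spec hex
      rw [h] at this
      simp only [cfQ] at this
      omega
    exact ⟨k, not_lt.1 (Nat.find_min hex (by omega)), hk ▸ Nat.find_spec hex⟩
  have hq0 : (0 : ℝ) < q := by positivity
  have hqk : (0 : ℝ) < cfQ α k := by exact_mod_cast cfQ_pos h k
  set D : ℝ := cfQ α k * α - cfP α k with hD
  have hD1 := cfQ_mul_sub_cfP_succ h h0 h1 k
  rw [← hD] at hD1
  have hx0 := gaussIter_pos h (k + 1)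
  set x := gaussIter α (k + 1)
  have hd1 : 0 < q * α - p := by
    rw [div_lt_iff₀ hq0] at hl
    linarith
  have hd2 : q * α - p < 1 / (2 * q) := by
    have : q * α < q * (p / q + 1 / (2 * (q : ℝ) ^ 2)) := by gcongr
    have e : (q : ℝ) * (p / q + 1 / (2 * (q : ℝ) ^ 2)) = p + 1 / (2 * q) := by field_simp
    linarith
  have hdet : (cfP α k : ℤ) * cfQ α (k + 1) - cfP α (k + 1) * cfQ α k = (-1) ^ (k + 1) :=
    cfP_det α (k + 1)
  have hee : ((-1 : ℤ) ^ (k + 1)) * (-1) ^ (k + 1) = 1 := by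
    rw [← mul_pow]; simp
  set e : ℤ := (-1) ^ (k + 1)
  obtain ⟨u, v, hu, hv, hv'⟩ : ∃ u v : ℤ, u * cfQ α k + v * cfQ α (k + 1) = q ∧
      u * cfP α k + v * cfP α (k + 1) = p ∧ q * cfP α k - p * cfQ α k = e * v := by
    refine ⟨e * (p * cfQ α (k + 1) - q * cfP α (k + 1)), e * (q * cfP α k - p * cfQ α k), ?_, ?_, ?_⟩
    · linear_combination e * q * hdet + q * hee
    · linear_combination e * p * hdet + p * hee
    · linear_combination -(q * cfP α k - p * cfQ α k) * hee
  rcases eq_or_ne v 0 with rfl | hvne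
  · have e1 : q * cfP α k = p * cfQ α k := by
      have : (q * cfP α k : ℤ) = p * cfQ α k := by linarith
      exact_mod_cast this
    have e2 : q ∣ cfQ α k := hc.symm.dvd_of_dvd_mul_left ⟨cfP α k, e1.symm⟩
    have e3 : cfQ α k = q := le_antisymm hk (Nat.le_of_dvd (cfQ_pos h k) e2)
    have e4 : cfP α k = p := by
      rw [e3, mul_comm] at e1
      exact Nat.eq_of_mul_eq_mul_right (by omega) e1
    have hD0 : 0 < D := by rw [hD, e3, e4]; exact hd1
    have hs := cfQ_mul_sub_cfP_sign h h0 h1 k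
    rw [← hD] at hs
    refine ⟨k, ?_, ?_, e3⟩
    · by_contra ho
      rw [Nat.not_even_iff_odd] at ho
      rw [ho.neg_one_pow] at hs
      linarith
    · rcases Nat.eq_zero_or_pos k with rfl | hk0
      · simp only [cfQ] at e3
        omega
      · exact hk0
  · exfalso
    have hqα : q * α - p = D * (u - v * x) := by
      have hu' : (u * cfQ α k + v * cfQ α (k + 1) : ℝ) = q := by exact_mod_cast hu
      have hv'' : (u * cfP α k + v * cfP α (k + 1) : ℝ) = p := by exact_mod_cast hv
      rw [hD] at hD1 ⊢
      linear_combination -α * hu' + hv'' + v * hD1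
    have huv : 1 ≤ |(u - v * x : ℝ)| := by
      have a1 : (0 : ℤ) < cfQ α k := by exact_mod_cast cfQ_pos h k
      have a2 : (q : ℤ) < cfQ α (k + 1) := by exact_mod_cast hk'
      rw [le_abs]
      rcases lt_or_gt_of_ne hvne with hv0 | hv0
      · left
        have : 1 ≤ u := by
          by_contra! hu0
          nlinarith
        have c1 : (1 : ℝ) ≤ u := by exact_mod_cast this
        have c2 : (v : ℝ) < 0 := by exact_mod_cast hv0
        nlinarith
      · right
        have : u ≤ -1 := by
          by_contra! hu0
          nlinarith
        have c1 : (u : ℝ) ≤ -1 := by exact_mod_cast this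
        have c2 : (0 : ℝ) < v := by exact_mod_cast hv0
        nlinarith
    have hDle : |D| ≤ q * α - p := by
      rw [← abs_of_pos hd1, hqα, abs_mul]
      exact le_mul_of_one_le_right (abs_nonneg _) huv
    have hone : (1 : ℝ) ≤ |(q : ℝ) * cfP α k - p * cfQ α k| := by
      have he : |e| = 1 := by simp [e]
      have : 1 ≤ |(q : ℤ) * cfP α k - p * cfQ α k| := by
        rw [hv', abs_mul, he, one_mul]
        exact Int.one_le_abs hvne
      exact_mod_cast this
    have e5 : (q : ℝ) * cfP α k - p * cfQ α k = cfQ α k * (q * α - p) - q * D := by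
      rw [hD]; ring
    have e6 : |(q : ℝ) * cfP α k - p * cfQ α k| ≤ cfQ α k * (q * α - p) + q * |D| := by
      rw [e5]
      refine (abs_sub _ _).trans ?_
      rw [abs_mul, abs_mul, abs_of_pos hd1, abs_of_pos hqk, abs_of_pos hq0]
    have hk2 : (cfQ α k : ℝ) ≤ q := by exact_mod_cast hk
    have : (cfQ α k : ℝ) * (q * α - p) + q * |D| < q * (1 / (2 * q)) + q * (1 / (2 * q)) := by
      have i1 : (cfQ α k : ℝ) * (q * α - p) ≤ q * (q * α - p) := by gcongr
      have i2 : (q : ℝ) * |D| ≤ q * (q * α - p) := by gcongr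
      have i3 : (q : ℝ) * (q * α - p) < q * (1 / (2 * q)) := by gcongr
      linarith
    have e7 : (q : ℝ) * (1 / (2 * q)) = 1 / 2 := by field_simp
    linarith

end Legendre

section Cylinder

/-- The first `n` partial quotients. -/
noncomputable def cfDigits (n : ℕ) (α : ℝ) : Fin n → ℕ := fun i ↦ cfA α (i + 1)

lemma cfDigits_eq_iff {n : ℕ} {α β : ℝ} :
    cfDigits n α = cfDigits n β ↔ ∀ i < n, cfA α (i + 1) = cfA β (i + 1) := by
  simp only [cfDigits, funext_iff]
  exact ⟨fun h i hi ↦ h ⟨i, hi⟩, fun h i ↦ h i i.2⟩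

lemma measurable_cfDigits (n : ℕ) : Measurable (cfDigits n) :=
  measurable_pi_lambda _ fun i ↦ measurable_cfA (i + 1)

lemma ae_irrational : ∀ᵐ x : ℝ, Irrational x := by
  have : volume (range ((↑) : ℚ → ℝ)) = 0 := (countable_range _).measure_zero _
  exact measure_eq_zero_iff_ae_notMem.1 this

/-- Lebesgue measure on the unit interval. -/
noncomputable def unitMeasure : Measure ℝ := volume.restrict (Ioo 0 1)

instance : IsProbabilityMeasure unitMeasure :=
  ⟨by simp [unitMeasure]⟩

lemma ae_unitMeasure : ∀ᵐ α ∂unitMeasure, Irrational α ∧ 0 < α ∧ α < 1 := by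
  rw [unitMeasure, ae_restrict_iff' measurableSet_Ioo]
  filter_upwards [ae_irrational] with x hx h
  exact ⟨hx, h.1, h.2⟩

lemma mem_cylinder_iff {α : ℝ} (h : Irrational α) (n : ℕ)
    {s : ℝ} (hs0 : 0 < s) (hs1 : s ≤ 1) {β : ℝ} (hβ : Irrational β) :
    ((0 < β ∧ β < 1) ∧ cfDigits n β = cfDigits n α ∧ gaussIter β n ≤ s) ↔
      β ∈ uIcc (cfP α n / cfQ α n : ℝ) ((cfP α n + s * cfPPrev α n) / (cfQ α n + s * cfQPrev α n)) := by
  have hQ : (0 : ℝ) < cfQ α n := by exact_mod_cast cfQ_pos h n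
  have hQ' : (0 : ℝ) ≤ cfQPrev α n := by positivity
  have hdet : (cfPPrev α n : ℝ) * cfQ α n - cfP α n * cfQPrev α n = (-1) ^ n := by
    exact_mod_cast cfP_det α n
  have key : ∀ x : ℝ, 0 ≤ x → (cfP α n + x * cfPPrev α n) / (cfQ α n + x * cfQPrev α n) =
      cfP α n / cfQ α n + (-1 : ℝ) ^ n * (x / (cfQ α n * (cfQ α n + x * cfQPrev α n))) := by
    intro x hx
    rw [← hdet]
    field_simp
    ring
  rw [key s hs0.le]
  constructor
  · rintro ⟨⟨h0, h1⟩, hd, hx⟩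
    rw [cfDigits_eq_iff] at hd
    have hx0 := gaussIter_pos hβ n
    have hm := mul_cfQ_add_eq hβ h0 h1 n
    have hd1 : cfPPrev β n = cfPPrev α n := by
      cases n with
      | zero => rfl
      | succ n => exact cfP_congr fun i hi ↦ hd i (by omega)
    have hd2 : cfQPrev β n = cfQPrev α n := by
      cases n with
      | zero => rfl
      | succ n => exact cfQ_congr fun i hi ↦ hd i (by omega)
    rw [cfQ_congr hd, cfP_congr hd, hd1, hd2, ← eq_div_iff (by positivity), key _ hx0.le] at hm
    have hmono : gaussIter β n / (cfQ α n * (cfQ α n + gaussIter β n * cfQPrev α n)) ≤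
        s / (cfQ α n * (cfQ α n + s * cfQPrev α n)) := by
      rw [div_le_div_iff₀ (by positivity) (by positivity)]
      nlinarith [mul_le_mul_of_nonneg_right hx (mul_pos hQ hQ).le]
    have hpos : 0 ≤ gaussIter β n / (cfQ α n * (cfQ α n + gaussIter β n * cfQPrev α n)) := by
      positivity
    rw [hm, mem_uIcc]
    rcases neg_one_pow_eq_or ℝ n with e | e <;> rw [e]
    · left; constructor <;> linarith
    · right; constructor <;> linarith
  · intro hmem
    set r : ℝ := (-1) ^ n * (β - cfP α n / cfQ α n) with hr
    have hβr : β = cfP α n / cfQ α n + (-1) ^ n * r := by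
      rw [hr, ← mul_assoc, ← mul_pow]; simp
    have hr0 : 0 ≤ r ∧ r ≤ s / (cfQ α n * (cfQ α n + s * cfQPrev α n)) := by
      have hpos : 0 ≤ s / (cfQ α n * (cfQ α n + s * cfQPrev α n)) := by positivity
      rw [mem_uIcc] at hmem
      rcases neg_one_pow_eq_or ℝ n with e | e <;> rw [e] at hmem hr <;>
        rcases hmem with hmem | hmem <;> constructor <;> linarith [hmem.1, hmem.2]
    obtain ⟨hr0, hrs⟩ := hr0
    have hrpos : 0 < r := by
      refine lt_of_le_of_ne hr0 fun h0 ↦ hβ ⟨(cfP α n : ℚ) / cfQ α n, ?_⟩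
      rw [hβr, ← h0]
      push_cast
      ring
    rw [le_div_iff₀ (by positivity)] at hrs
    have hden : 0 < 1 - r * cfQ α n * cfQPrev α n := by
      by_contra! hc
      have : 0 < r * cfQ α n * cfQ α n := by positivity
      nlinarith
    set x : ℝ := r * cfQ α n ^ 2 / (1 - r * cfQ α n * cfQPrev α n) with hx
    have hx0 : 0 < x := by positivity
    have hxs : x ≤ s := by
      rw [hx, div_le_iff₀ hden]
      linarith
    have hxr : x / (cfQ α n * (cfQ α n + x * cfQPrev α n)) = r := by
      rw [div_eq_iff (by positivity)]
      have := (eq_div_iff hden.ne').1 hx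
      linear_combination this
    have hβx : β = (cfP α n + x * cfPPrev α n) / (cfQ α n + x * cfQPrev α n) := by
      rw [key x hx0.le, hxr]; exact hβr
    have hx1 : x < 1 := by
      refine lt_of_le_of_ne (hxs.trans hs1) fun h1 ↦
        hβ ⟨((cfP α n + cfPPrev α n : ℕ) : ℚ) / ((cfQ α n + cfQPrev α n : ℕ) : ℚ), ?_⟩
      rw [hβx, h1]
      push_cast
      simp
    obtain ⟨i1, i2, i3⟩ := mobius_inverse_branch h n x hx0 hx1 β hβx
    exact ⟨i3, cfDigits_eq_iff.2 i1, i2 ▸ hxs⟩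

lemma unitMeasure_cylinder {α : ℝ} (h : Irrational α) (n : ℕ)
    {s : ℝ} (hs0 : 0 < s) (hs1 : s ≤ 1) :
    unitMeasure (cfDigits n ⁻¹' {cfDigits n α} ∩ {β | gaussIter β n ≤ s}) =
      ENNReal.ofReal (s / (cfQ α n * (cfQ α n + s * cfQPrev α n))) := by
  have hQ : (0 : ℝ) < cfQ α n := by exact_mod_cast cfQ_pos h n
  have hQ' : (0 : ℝ) ≤ cfQPrev α n := by positivity
  have hdet : (cfPPrev α n : ℝ) * cfQ α n - cfP α n * cfQPrev α n = (-1) ^ n := by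
    exact_mod_cast cfP_det α n
  rw [unitMeasure, Measure.restrict_apply
    ((measurable_cfDigits n (measurableSet_singleton _)).inter
      (measurableSet_le (measurable_gaussIter n) measurable_const))]
  have : (cfDigits n ⁻¹' {cfDigits n α} ∩ {β | gaussIter β n ≤ s} ∩ Ioo 0 1 : Set ℝ) =ᵐ[volume]
      (uIcc (cfP α n / cfQ α n : ℝ)
        ((cfP α n + s * cfPPrev α n) / (cfQ α n + s * cfQPrev α n)) : Set ℝ) := by
    rw [eventuallyEq_set]
    filter_upwards [ae_irrational] with β hβ
    rw [← mem_cylinder_iff h n hs0 hs1 hβ]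
    simp only [mem_inter_iff, mem_preimage, mem_singleton_iff, mem_ofPred_eq, mem_Ioo]
    tauto
  rw [measure_congr this, Real.volume_interval]
  congr 1
  have : ((cfP α n + s * cfPPrev α n) / (cfQ α n + s * cfQPrev α n) - cfP α n / cfQ α n : ℝ) =
      (-1) ^ n * (s / (cfQ α n * (cfQ α n + s * cfQPrev α n))) := by
    rw [← hdet]
    field_simp
    ring
  rw [this, abs_mul, abs_pow, abs_neg, abs_one, one_pow, one_mul, abs_of_nonneg (by positivity)]

/-- Conditionally on the first `n` digits, the `n`-th Gauss iterate is at most `s` with probability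
between `s` and `2 s`. -/
lemma unitMeasure_cylinder_bounds (n : ℕ) (v : Fin n → ℕ) {s : ℝ} (hs0 : 0 < s) (hs1 : s ≤ 1) :
    ENNReal.ofReal s * unitMeasure (cfDigits n ⁻¹' {v}) ≤
        unitMeasure (cfDigits n ⁻¹' {v} ∩ {β | gaussIter β n ≤ s}) ∧
      unitMeasure (cfDigits n ⁻¹' {v} ∩ {β | gaussIter β n ≤ s}) ≤
        ENNReal.ofReal (2 * s) * unitMeasure (cfDigits n ⁻¹' {v}) := by
  by_cases hv : ∃ α, Irrational α ∧ cfDigits n α = v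
  · obtain ⟨α, h, rfl⟩ := hv
    have hQ : (0 : ℝ) < cfQ α n := by exact_mod_cast cfQ_pos h n
    have hQ' : (0 : ℝ) ≤ cfQPrev α n := by positivity
    have hQQ : (cfQPrev α n : ℝ) ≤ cfQ α n := by exact_mod_cast cfQPrev_le h n
    have e1 := unitMeasure_cylinder h n one_pos le_rfl
    have : {β | gaussIter β n ≤ 1} = univ :=
      eq_univ_of_forall fun β ↦ (gaussIter_lt_one β n).le
    rw [this, inter_univ] at e1
    rw [e1, unitMeasure_cylinder h n hs0 hs1, ← ENNReal.ofReal_mul hs0.le,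
      ← ENNReal.ofReal_mul (by positivity)]
    constructor
    · apply ENNReal.ofReal_le_ofReal
      rw [mul_one_div, one_mul]
      gcongr
      nlinarith
    · apply ENNReal.ofReal_le_ofReal
      rw [mul_one_div, one_mul, div_le_div_iff₀ (by positivity) (by positivity)]
      have : 0 ≤ s * cfQ α n * (2 * s * cfQPrev α n + (cfQ α n - cfQPrev α n)) := by
        have := sub_nonneg.2 hQQ
        positivity
      nlinarith
  · have : unitMeasure (cfDigits n ⁻¹' {v}) = 0 := by
      rw [measure_eq_zero_iff_ae_notMem]
      filter_upwards [ae_unitMeasure] with α hα hmem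
      exact hv ⟨α, hα.1, hmem⟩
    rw [measure_mono_null inter_subset_left this, this]
    simp

end Cylinder

section BorelCantelli

/-- The filtration generated by the partial quotients. -/
noncomputable def cfFiltration : Filtration ℕ (inferInstance : MeasurableSpace ℝ) where
  seq n := MeasurableSpace.comap (cfDigits n) inferInstance
  mono' := by
    intro m n hmn
    have : cfDigits m = (fun v : Fin n → ℕ ↦ fun i : Fin m ↦ v (Fin.castLE hmn i)) ∘ cfDigits n := rfl
    dsimp only
    rw [this, ← MeasurableSpace.comap_comp]
    exact MeasurableSpace.comap_mono (Measurable.of_discrete.comap_le)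
  le' n := (measurable_cfDigits n).comap_le

lemma measurableSet_cfFiltration {n : ℕ} {s : Set ℝ}
    (hs : ∀ α β, cfDigits n α = cfDigits n β → α ∈ s → β ∈ s) :
    MeasurableSet[cfFiltration n] s := by
  refine ⟨cfDigits n '' s, MeasurableSet.of_discrete, ?_⟩
  refine Subset.antisymm ?_ (subset_preimage_image _ _)
  rintro β ⟨α, hα, h⟩
  exact hs α β h hα

lemma ae_cylinder_ne_zero (n : ℕ) :
    ∀ᵐ α ∂unitMeasure, unitMeasure (cfDigits n ⁻¹' {cfDigits n α}) ≠ 0 := by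
  refine ae_of_ae_map (p := fun v ↦ unitMeasure (cfDigits n ⁻¹' {v}) ≠ 0)
    (measurable_cfDigits n).aemeasurable ?_
  rw [ae_iff_of_countable]
  intro v hv
  rwa [Measure.map_apply (measurable_cfDigits n) (measurableSet_singleton v)] at hv

/-- A lower bound for a conditional probability can be checked on cylinders. -/
lemma le_condExp_indicator_of_cylinder (n : ℕ) {s : Set ℝ} (hs : MeasurableSet s) (g : ℝ → ℝ)
    (hg : ∀ᵐ α ∂unitMeasure, g α * unitMeasure.real (cfDigits n ⁻¹' {cfDigits n α}) ≤
      unitMeasure.real (cfDigits n ⁻¹' {cfDigits n α} ∩ s)) :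
    ∀ᵐ α ∂unitMeasure, g α ≤ (unitMeasure[s.indicator (1 : ℝ → ℝ) | cfFiltration n]) α := by
  filter_upwards [hg, ae_cylinder_ne_zero n] with α h1 h2
  set C := cfDigits n ⁻¹' {cfDigits n α}
  have hm : Measurable[cfFiltration n] (unitMeasure[s.indicator (1 : ℝ → ℝ) | cfFiltration n]) :=
    stronglyMeasurable_condExp.measurable
  have hC : MeasurableSet[cfFiltration n] C := ⟨_, measurableSet_singleton _, rfl⟩
  have hs_int : Integrable (s.indicator (1 : ℝ → ℝ)) unitMeasure :=
    (integrable_const 1).indicator hs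
  have e1 := setIntegral_condExp (cfFiltration.le n) hs_int hC
  have e2 : ∫ x in C, (unitMeasure[s.indicator (1 : ℝ → ℝ) | cfFiltration n]) x ∂unitMeasure =
      ∫ x in C, (unitMeasure[s.indicator (1 : ℝ → ℝ) | cfFiltration n]) α ∂unitMeasure := by
    refine setIntegral_congr_fun (cfFiltration.le n _ hC) fun β hβ ↦ ?_
    exact hm.factorsThrough hβ
  rw [e2, setIntegral_const, setIntegral_indicator hs] at e1
  simp only [Pi.one_apply, setIntegral_const, smul_eq_mul, mul_one] at e1
  have hpos : 0 < unitMeasure.real C := ENNReal.toReal_pos h2 (measure_ne_top _ _)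
  rw [← e1, mul_comm] at h1
  exact le_of_mul_le_mul_left h1 hpos

open scoped Classical in
/-- A conditional Borel-Cantelli lemma for large partial quotients. -/
lemma ae_frequently_mul_cfS_le_cfA (E : ℕ → ℕ → Prop) (hE : ∀ q, ¬ E 0 q) {M : ℕ} (hM : 0 < M) :
    ∀ᵐ α ∂unitMeasure, ¬ Summable (fun k ↦ if E k (cfQ α k) then (1 : ℝ) / cfS α k else 0) →
      ∃ᶠ k in atTop, E k (cfQ α k) ∧ M * cfS α k ≤ cfA α (k + 1) := by
  let s : ℕ → Set ℝ := fun n ↦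
    n.casesOn ∅ fun k ↦ {α | E k (cfQ α k) ∧ M * cfS α k ≤ cfA α (k + 1)}
  have hs : ∀ n, MeasurableSet[cfFiltration n] (s n) := by
    intro n
    cases n with
    | zero => exact @MeasurableSet.empty _ (cfFiltration 0)
    | succ k =>
      refine measurableSet_cfFiltration fun α β h hα ↦ ?_
      rw [cfDigits_eq_iff] at h
      have h' : ∀ i < k, cfA α (i + 1) = cfA β (i + 1) := fun i hi ↦ h i (by omega)
      change E k (cfQ β k) ∧ M * cfS β k ≤ cfA β (k + 1)
      rw [← cfQ_congr h', ← cfS_congr h', ← h k (by omega)]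
      exact hα
  have hcond : ∀ k, ∀ᵐ α ∂unitMeasure,
      (if E k (cfQ α k) then (1 : ℝ) / (M * cfS α k) else 0) ≤
        (unitMeasure[(s (k + 1)).indicator (1 : ℝ → ℝ) | cfFiltration k]) α := by
    intro k
    refine le_condExp_indicator_of_cylinder k (cfFiltration.le _ _ (hs (k + 1))) _ ?_
    filter_upwards [ae_unitMeasure] with α hα
    split_ifs with hEα
    · have hk : 0 < k := Nat.pos_of_ne_zero (by rintro rfl; exact hE _ hEα)
      have hS : 0 < M * cfS α k := Nat.mul_pos hM (cfS_pos hα.1 hk)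
      have hS1 : (1 : ℝ) ≤ M * cfS α k := by exact_mod_cast hS
      have hb := (unitMeasure_cylinder_bounds k (cfDigits k α) (s := 1 / (M * cfS α k))
        (by positivity) (by rw [div_le_one (by linarith)]; exact hS1)).1
      have hsub : unitMeasure (cfDigits k ⁻¹' {cfDigits k α} ∩
          {β | gaussIter β k ≤ 1 / (M * cfS α k)}) ≤
          unitMeasure (cfDigits k ⁻¹' {cfDigits k α} ∩ s (k + 1)) := by
        apply measure_mono_ae
        filter_upwards [ae_unitMeasure] with β hβ hmem
        refine ⟨hmem.1, ?_⟩
        have h' := cfDigits_eq_iff.1 hmem.1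
        change E k (cfQ β k) ∧ M * cfS β k ≤ cfA β (k + 1)
        rw [cfQ_congr h', cfS_congr h', cfA_succ]
        refine ⟨hEα, ?_⟩
        have hx := gaussIter_pos hβ.1 k
        have hx2 : gaussIter β k ≤ 1 / (M * cfS α k) := hmem.2
        rw [Nat.le_floor_iff (by positivity), le_div_comm₀ (by positivity) hx]
        exact_mod_cast hx2
      have := ENNReal.toReal_mono (measure_ne_top _ _) (hb.trans hsub)
      rwa [ENNReal.toReal_mul, ENNReal.toReal_ofReal (by positivity)] at this
    · rw [zero_mul]
      exact measureReal_nonneg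
  filter_upwards [ae_mem_limsup_atTop_iff unitMeasure hs, ae_all_iff.2 hcond] with α h1 h2 hsum
  have hM' : (M : ℝ) ≠ 0 := by positivity
  have hg : ∀ k, 0 ≤ (if E k (cfQ α k) then (1 : ℝ) / (M * cfS α k) else 0) := by
    intro k; split_ifs <;> positivity
  have hdiv : ¬ Summable fun k ↦ (if E k (cfQ α k) then (1 : ℝ) / (M * cfS α k) else 0) := by
    refine fun hc ↦ hsum ((hc.mul_left (M : ℝ)).congr fun k ↦ ?_)
    split_ifs
    · field_simp
    · simp
  rw [not_summable_iff_tendsto_nat_atTop_of_nonneg hg] at hdiv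
  have hlim := h1.2 (tendsto_atTop_mono (fun n ↦ Finset.sum_le_sum fun k _ ↦ h2 k) hdiv)
  rw [mem_limsup_iff_frequently_mem] at hlim
  rw [frequently_atTop] at hlim ⊢
  intro N
  obtain ⟨n, hn, hmem⟩ := hlim (N + 1)
  cases n with
  | zero => exact absurd hmem (notMem_empty α)
  | succ k => exact ⟨k, by omega, hmem⟩

end BorelCantelli

section DigitSum

lemma unitMeasure_gaussIter_le (n : ℕ) {s : ℝ} (hs0 : 0 < s) (hs1 : s ≤ 1) :
    unitMeasure {α | gaussIter α n ≤ s} ≤ ENNReal.ofReal (2 * s) := by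
  have hms : MeasurableSet {α | gaussIter α n ≤ s} :=
    measurableSet_le (measurable_gaussIter n) measurable_const
  have hpre : ∀ v : Fin n → ℕ, MeasurableSet (cfDigits n ⁻¹' {v}) :=
    fun v ↦ measurable_cfDigits n (measurableSet_singleton v)
  have e : ∀ ν : Measure ℝ, ∑' v : Fin n → ℕ, ν (cfDigits n ⁻¹' {v}) = ν univ := by
    intro ν
    rw [← measure_iUnion _ hpre, ← preimage_iUnion, iUnion_of_singleton, preimage_univ]
    intro v w hvw
    exact Disjoint.preimage _ (disjoint_singleton.2 hvw)
  have e1 := e (unitMeasure.restrict {α | gaussIter α n ≤ s})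
  rw [Measure.restrict_apply_univ] at e1
  rw [← e1]
  calc _ ≤ ∑' v, ENNReal.ofReal (2 * s) * unitMeasure (cfDigits n ⁻¹' {v}) := by
        refine ENNReal.tsum_le_tsum fun v ↦ ?_
        rw [Measure.restrict_apply (hpre v)]
        exact (unitMeasure_cylinder_bounds n v hs0 hs1).2
    _ = _ := by rw [ENNReal.tsum_mul_left, e, measure_univ, mul_one]

lemma unitMeasure_le_cfA (n : ℕ) {t : ℕ} (ht : 0 < t) :
    unitMeasure {α | t ≤ cfA α (n + 1)} ≤ ENNReal.ofReal (2 / t) := by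
  have ht1 : (1 : ℝ) ≤ t := by exact_mod_cast ht
  refine le_trans (measure_mono_ae ?_) (le_of_le_of_eq
    (unitMeasure_gaussIter_le n (s := 1 / t) (by positivity) ?_) (by rw [mul_one_div]))
  · filter_upwards [ae_unitMeasure] with α hα hmem
    have h1 : t ≤ cfA α (n + 1) := hmem
    have hx := gaussIter_pos hα.1 n
    rw [cfA_succ, Nat.le_floor_iff (by positivity), le_div_comm₀ (by positivity) hx] at h1
    exact h1
  · rw [div_le_one (by linarith)]
    exact ht1

lemma lintegral_min_cfA_le (n T : ℕ) :
    ∫⁻ α, ((min (cfA α (n + 1)) T : ℕ) : ENNReal) ∂unitMeasure ≤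
      ENNReal.ofReal (2 * (1 + Real.log T)) := by
  have e : ∀ α, ((min (cfA α (n + 1)) T : ℕ) : ENNReal) =
      ∑ t ∈ Finset.Icc 1 T, {α | t ≤ cfA α (n + 1)}.indicator 1 α := by
    intro α
    simp only [indicator_apply, mem_ofPred_eq, Pi.one_apply, Finset.sum_boole]
    congr 1
    have : Finset.filter (fun t ↦ t ≤ cfA α (n + 1)) (Finset.Icc 1 T) =
        Finset.Icc 1 (min (cfA α (n + 1)) T) := by
      ext t; simp; tauto
    rw [this, Nat.card_Icc]; simp
  have hms : ∀ t, MeasurableSet {α | t ≤ cfA α (n + 1)} :=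
    fun t ↦ measurableSet_le measurable_const (measurable_cfA _)
  simp_rw [e]
  rw [lintegral_finsetSum _ fun t _ ↦ measurable_one.indicator (hms t)]
  calc _ ≤ ∑ t ∈ Finset.Icc 1 T, ENNReal.ofReal (2 / t) := by
        refine Finset.sum_le_sum fun t ht ↦ ?_
        rw [lintegral_indicator_one (hms t)]
        exact unitMeasure_le_cfA n (Finset.mem_Icc.1 ht).1
    _ = ENNReal.ofReal (∑ t ∈ Finset.Icc 1 T, 2 / (t : ℝ)) := by
        rw [ENNReal.ofReal_sum_of_nonneg]
        intro i _
        positivity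
    _ ≤ _ := by
        refine ENNReal.ofReal_le_ofReal ?_
        have := harmonic_le_one_add_log T
        rw [harmonic_eq_sum_Icc] at this
        push_cast at this
        simp_rw [div_eq_mul_inv]
        rw [← Finset.mul_sum]
        linarith

lemma unitMeasure_le_cfS (K : ℕ) {T L : ℕ} (hT : 0 < T) (hL : 0 < L) :
    unitMeasure {α | L ≤ cfS α K} ≤
      ENNReal.ofReal (K * (2 / T) + K * (2 * (1 + Real.log T)) / L) := by
  have hlog : 0 ≤ Real.log T := Real.log_natCast_nonneg T
  have hsub : {α | L ≤ cfS α K} ⊆ (⋃ i ∈ Finset.range K, {α | T ≤ cfA α (i + 1)}) ∪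
      {α | (L : ENNReal) ≤ ∑ i ∈ Finset.range K, ((min (cfA α (i + 1)) T : ℕ) : ENNReal)} := by
    intro α hα
    by_cases hex : ∃ i ∈ Finset.range K, T ≤ cfA α (i + 1)
    · left
      obtain ⟨i, hi, h⟩ := hex
      exact mem_iUnion₂.2 ⟨i, hi, h⟩
    · right
      push Not at hex
      have hα' : L ≤ cfS α K := hα
      rw [cfS_eq_sum_range] at hα'
      have : ∑ i ∈ Finset.range K, min (cfA α (i + 1)) T = ∑ i ∈ Finset.range K, cfA α (i + 1) :=
        Finset.sum_congr rfl fun i hi ↦ min_eq_left (hex i hi).le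
      rw [← this] at hα'
      change (L : ENNReal) ≤ _
      exact_mod_cast hα'
  have hm : Measurable fun α ↦ ∑ i ∈ Finset.range K, ((min (cfA α (i + 1)) T : ℕ) : ENNReal) := by
    refine Finset.measurable_fun_sum _ fun i _ ↦ ?_
    exact (Measurable.of_discrete (f := fun a : ℕ ↦ ((min a T : ℕ) : ENNReal))).comp
      (measurable_cfA (i + 1))
  have h1 : unitMeasure (⋃ i ∈ Finset.range K, {α | T ≤ cfA α (i + 1)}) ≤
      ENNReal.ofReal (K * (2 / T)) := by
    refine (measure_biUnion_finset_le _ _).trans ?_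
    refine (Finset.sum_le_sum fun i _ ↦ unitMeasure_le_cfA i hT).trans ?_
    rw [Finset.sum_const, Finset.card_range, nsmul_eq_mul, ENNReal.ofReal_mul (by positivity),
      ENNReal.ofReal_natCast]
  have h2 : unitMeasure {α | (L : ENNReal) ≤
      ∑ i ∈ Finset.range K, ((min (cfA α (i + 1)) T : ℕ) : ENNReal)} ≤
      ENNReal.ofReal (K * (2 * (1 + Real.log T)) / L) := by
    refine (meas_ge_le_lintegral_div hm.aemeasurable (by positivity) (by simp)).trans ?_
    rw [ENNReal.ofReal_div_of_pos (by positivity), ENNReal.ofReal_natCast]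
    gcongr
    rw [lintegral_finsetSum]
    · refine (Finset.sum_le_sum fun i _ ↦ lintegral_min_cfA_le i T).trans ?_
      rw [Finset.sum_const, Finset.card_range, nsmul_eq_mul,
        ENNReal.ofReal_mul (p := (K : ℝ)) (by positivity), ENNReal.ofReal_natCast]
    · intro i _
      exact (Measurable.of_discrete (f := fun a : ℕ ↦ ((min a T : ℕ) : ENNReal))).comp
        (measurable_cfA (i + 1))
  refine (measure_mono hsub).trans ((measure_union_le _ _).trans ?_)
  rw [ENNReal.ofReal_add (by positivity) (by positivity)]
  exact add_le_add h1 h2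

/-- The sum of the first `r n` partial quotients is `O(n log n)` with high probability. -/
lemma exists_unitMeasure_le_cfS_le (r : ℕ) {ε : ℝ} (hε : 0 < ε) :
    ∃ D : ℕ, 0 < D ∧ ∀ᶠ n : ℕ in atTop,
      unitMeasure {α | D * (n * (Nat.log 2 n + 1)) ≤ cfS α (r * n)} ≤ ENNReal.ofReal ε := by
  obtain ⟨D, hD⟩ := exists_nat_gt (12 * r / ε)
  have hD0 : (0 : ℝ) < D := lt_of_le_of_lt (by positivity) hD
  obtain ⟨n₀, hn₀⟩ := exists_nat_gt (4 * r / ε)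
  refine ⟨D, by exact_mod_cast hD0, ?_⟩
  filter_upwards [eventually_ge_atTop (max n₀ 1)] with n hn
  have hn1 : 0 < n := by have := le_max_right n₀ 1; omega
  have hn1' : (0 : ℝ) < n := by exact_mod_cast hn1
  have hnn : (n₀ : ℝ) ≤ n := by exact_mod_cast (le_max_left n₀ 1).trans hn
  have hD' : 0 < D := by exact_mod_cast hD0
  refine (unitMeasure_le_cfS (r * n) (T := n ^ 2) (by positivity) (by positivity)).trans ?_
  refine ENNReal.ofReal_le_ofReal ?_
  have hl : Real.log n ≤ Nat.log 2 n + 1 := by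
    have h1 : (n : ℝ) ≤ 2 ^ (Nat.log 2 n + 1) := by
      exact_mod_cast (Nat.lt_pow_succ_log_self (by norm_num) n).le
    have h2 := Real.log_le_log hn1' h1
    rw [Real.log_pow] at h2
    have h3 : Real.log 2 ≤ 1 := by linarith [Real.log_two_lt_d9]
    push_cast at h2
    have : (Nat.log 2 n + 1 : ℝ) * Real.log 2 ≤ (Nat.log 2 n + 1) * 1 := by gcongr
    linarith
  push_cast
  rw [Real.log_pow]
  push_cast
  set l : ℝ := Nat.log 2 n + 1 with hldef
  have hl1 : 1 ≤ l := by simp [hldef]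
  have b1 : (r : ℝ) * n * (2 / n ^ 2) ≤ ε / 2 := by
    have : (r : ℝ) * n * (2 / n ^ 2) = 2 * r / n := by field_simp
    rw [this, div_le_iff₀ hn1']
    rw [div_lt_iff₀ hε] at hn₀
    nlinarith
  have b2 : (r : ℝ) * n * (2 * (1 + 2 * Real.log n)) / (D * (n * l)) ≤ ε / 2 := by
    rw [div_le_iff₀ (by positivity)]
    rw [div_lt_iff₀ hε] at hD
    have c1 : (r : ℝ) * n * (2 * (1 + 2 * Real.log n)) ≤ r * n * (6 * l) := by
      exact mul_le_mul_of_nonneg_left (by linarith) (by positivity)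
    have c2 : (12 * r) * (n * l) ≤ (D * ε) * (n * l) := by gcongr
    linarith
  linarith

end DigitSum

section Sieve

/-- The natural numbers in `(x, y]` divisible by no element of `S`. -/
noncomputable def siftedInterval (S : Finset ℕ) (x y : ℝ) : Finset ℕ :=
  (Finset.Ioc ⌊x⌋₊ ⌊y⌋₊).filter fun n ↦ ∀ p ∈ S, ¬ p ∣ n

lemma mem_siftedInterval {S : Finset ℕ} {x y : ℝ} (hx : 0 ≤ x) (hy : 0 ≤ y) {n : ℕ} :
    n ∈ siftedInterval S x y ↔ (x < n ∧ n ≤ y) ∧ ∀ p ∈ S, ¬ p ∣ n := by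
  rw [siftedInterval, Finset.mem_filter, Finset.mem_Ioc, Nat.floor_lt hx, Nat.le_floor_iff hy]

lemma card_siftedInterval_insert {S : Finset ℕ} (hS : ∀ p ∈ S, p.Prime) {p : ℕ} (hp : p.Prime)
    (hpS : p ∉ S) {x y : ℝ} (hx : 0 ≤ x) (hxy : x ≤ y) :
    (siftedInterval (insert p S) x y).card + (siftedInterval S (x / p) (y / p)).card =
      (siftedInterval S x y).card := by
  have hy := hx.trans hxy
  have hp0 : (0 : ℝ) < p := by exact_mod_cast hp.pos
  rw [← Finset.card_filter_add_card_filter_not (s := siftedInterval S x y) (fun n ↦ p ∣ n), add_comm]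
  congr 1
  · refine Finset.card_bij (fun m _ ↦ p * m) ?_ ?_ ?_
    · intro m hm
      rw [mem_siftedInterval (by positivity) (by positivity), div_lt_iff₀ hp0, le_div_iff₀ hp0] at hm
      rw [Finset.mem_filter, mem_siftedInterval hx hy]
      push_cast
      refine ⟨⟨⟨by linarith, by linarith⟩, fun s hs hd ↦ ?_⟩, dvd_mul_right _ _⟩
      rcases (hS s hs).dvd_mul.1 hd with h | h
      · exact hpS (((Nat.prime_dvd_prime_iff_eq (hS s hs) hp).1 h) ▸ hs)
      · exact hm.2 s hs h
    · intro a _ b _ h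
      exact Nat.eq_of_mul_eq_mul_left hp.pos h
    · intro n hn
      rw [Finset.mem_filter, mem_siftedInterval hx hy] at hn
      obtain ⟨⟨h1, h2⟩, m, rfl⟩ := hn
      refine ⟨m, ?_, rfl⟩
      rw [mem_siftedInterval (by positivity) (by positivity), div_lt_iff₀ hp0, le_div_iff₀ hp0]
      push_cast at h1
      exact ⟨⟨by linarith, by linarith⟩, fun s hs hd ↦ h2 s hs (hd.mul_left p)⟩
  · congr 1
    ext n
    rw [Finset.mem_filter, mem_siftedInterval hx hy, mem_siftedInterval hx hy]
    simp only [Finset.forall_mem_insert]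
    tauto

lemma abs_card_siftedInterval_sub_le (S : Finset ℕ) (hS : ∀ p ∈ S, p.Prime) :
    ∀ x y : ℝ, 0 ≤ x → x ≤ y →
      |(siftedInterval S x y).card - (y - x) * ∏ p ∈ S, (1 - (p : ℝ)⁻¹)| ≤ 2 ^ S.card := by
  induction S using Finset.induction_on with
  | empty =>
    intro x y hx hxy
    have h : (siftedInterval ∅ x y).card + ⌊x⌋₊ = ⌊y⌋₊ := by
      simp [siftedInterval, Nat.sub_add_cancel (Nat.floor_mono hxy)]
    have h' : ((siftedInterval ∅ x y).card : ℝ) + ⌊x⌋₊ = ⌊y⌋₊ := by exact_mod_cast h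
    have := Nat.floor_le hx
    have := Nat.floor_le (hx.trans hxy)
    have := Nat.lt_floor_add_one x
    have := Nat.lt_floor_add_one y
    rw [Finset.prod_empty, Finset.card_empty, pow_zero, abs_le]
    constructor <;> linarith
  | insert p S hpS ih =>
    intro x y hx hxy
    have hp : p.Prime := hS p (Finset.mem_insert_self _ _)
    have hS' : ∀ p ∈ S, p.Prime := fun s hs ↦ hS s (Finset.mem_insert_of_mem hs)
    have hp0 : (0 : ℝ) < p := by exact_mod_cast hp.pos
    have h := card_siftedInterval_insert hS' hp hpS hx hxy
    have h' : ((siftedInterval (insert p S) x y).card : ℝ) +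
      (siftedInterval S (x / p) (y / p)).card = (siftedInterval S x y).card := by exact_mod_cast h
    have i1 := abs_le.1 (ih hS' x y hx hxy)
    have i2 := abs_le.1 (ih hS' (x / p) (y / p) (by positivity) (by gcongr))
    rw [Finset.prod_insert hpS, Finset.card_insert_of_notMem hpS, pow_succ]
    have e : (y - x) * ((1 - (p : ℝ)⁻¹) * ∏ p ∈ S, (1 - (p : ℝ)⁻¹)) =
        (y - x) * ∏ p ∈ S, (1 - (p : ℝ)⁻¹) - (y / p - x / p) * ∏ p ∈ S, (1 - (p : ℝ)⁻¹) := by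
      ring
    rw [e, abs_le]
    constructor <;> linarith [i1.1, i1.2, i2.1, i2.2]

lemma two_pow_card_primeFactors_le {q : ℕ} (hq : q ≠ 0) :
    (2 : ℝ) ^ q.primeFactors.card ≤ 2 * √q := by
  have h1 : 4 ^ q.primeFactors.card ≤ 4 * q := by
    have h2 : ∏ p ∈ q.primeFactors, 4 ≤ ∏ p ∈ q.primeFactors, ((if p < 4 then 2 else 1) * p) := by
      refine Finset.prod_le_prod' fun p hp ↦ ?_
      have := (Nat.prime_of_mem_primeFactors hp).two_le
      split_ifs <;> omega
    rw [Finset.prod_const, Finset.prod_mul_distrib, Finset.prod_ite, Finset.prod_const,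
      Finset.prod_const_one, mul_one] at h2
    have h3 : (q.primeFactors.filter fun p ↦ p < 4).card ≤ 2 := by
      have : (q.primeFactors.filter fun p ↦ p < 4) ⊆ {2, 3} := by
        intro p hp
        rw [Finset.mem_filter] at hp
        have := (Nat.prime_of_mem_primeFactors hp.1).two_le
        simp only [Finset.mem_insert, Finset.mem_singleton]
        omega
      exact (Finset.card_le_card this).trans Finset.card_le_two
    have h4 : 2 ^ (q.primeFactors.filter fun p ↦ p < 4).card ≤ 2 ^ 2 :=
      Nat.pow_le_pow_right (by norm_num) h3
    have h5 : ∏ p ∈ q.primeFactors, p ≤ q :=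
      Nat.le_of_dvd (Nat.pos_of_ne_zero hq) (Nat.prod_primeFactors_dvd q)
    exact h2.trans (Nat.mul_le_mul h4 h5)
  have h6 : ((2 : ℝ) ^ q.primeFactors.card) ^ 2 ≤ 4 * q := by
    rw [← pow_mul, mul_comm, pow_mul]
    norm_num
    exact_mod_cast h1
  refine (pow_le_pow_iff_left₀ (by positivity) (by positivity) two_ne_zero).1 ?_
  rw [mul_pow, Real.sq_sqrt (Nat.cast_nonneg q)]
  linarith

/-- The numerators `p` coprime to `q` with `p / q ∈ (x, y]`. -/
noncomputable def coprimeNumerators (q : ℕ) (x y : ℝ) : Finset ℕ :=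
  siftedInterval q.primeFactors (q * x) (q * y)

lemma mem_coprimeNumerators {q : ℕ} (hq : q ≠ 0) {x y : ℝ} (hx : 0 ≤ x) (hy : 0 ≤ y) {p : ℕ} :
    p ∈ coprimeNumerators q x y ↔ (q * x < p ∧ p ≤ q * y) ∧ p.Coprime q := by
  rw [coprimeNumerators, mem_siftedInterval (by positivity) (by positivity)]
  refine and_congr Iff.rfl ?_
  rw [Nat.coprime_comm]
  refine ⟨fun h ↦ Nat.coprime_of_dvd fun k hk hkq ↦ h k (Nat.mem_primeFactors.2 ⟨hk, hkq, hq⟩), ?_⟩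
  intro h k hk hkp
  have hk' := Nat.mem_primeFactors.1 hk
  exact Nat.Prime.not_coprime_iff_dvd.2 ⟨k, hk'.1, hk'.2.1, hkp⟩ h

lemma cast_totient_eq_mul_prod (q : ℕ) :
    (q.totient : ℝ) = q * ∏ p ∈ q.primeFactors, (1 - (p : ℝ)⁻¹) := by
  have h := congrArg ((↑) : ℚ → ℝ) (Nat.totient_eq_mul_prod_factors q)
  push_cast at h
  exact h

lemma le_card_coprimeNumerators {q : ℕ} (hq : q ≠ 0) {x y : ℝ} (hx : 0 ≤ x) (hxy : x ≤ y) :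
    (y - x) * q.totient - 2 * √q ≤ (coprimeNumerators q x y).card := by
  have h1 := (abs_le.1 (abs_card_siftedInterval_sub_le q.primeFactors
    (fun p ↦ Nat.prime_of_mem_primeFactors) (q * x) (q * y) (by positivity) (by gcongr))).1
  have h2 := two_pow_card_primeFactors_le hq
  have h3 := cast_totient_eq_mul_prod q
  have h4 : (q * y - q * x) * ∏ p ∈ q.primeFactors, (1 - (p : ℝ)⁻¹) = (y - x) * q.totient := by
    rw [h3]; ring
  rw [h4] at h1
  rw [coprimeNumerators]
  linarith

end Sieve

section Density

lemma sum_primeFactors_inv_le (N : ℕ) :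
    ∑ q ∈ Finset.Icc 1 N, ∑ p ∈ q.primeFactors, (p : ℝ)⁻¹ ≤ N := by
  have h1 : ∀ q ∈ Finset.Icc 1 N, ∑ p ∈ q.primeFactors, (p : ℝ)⁻¹ ≤
      ∑ p ∈ Finset.Ioc 1 N, if p ∣ q then (p : ℝ)⁻¹ else 0 := by
    intro q hq
    rw [← Finset.sum_filter]
    refine Finset.sum_le_sum_of_subset_of_nonneg ?_ fun i _ _ ↦ by positivity
    intro p hp
    rw [Finset.mem_Icc] at hq
    have h2 := Nat.dvd_of_mem_primeFactors hp
    rw [Finset.mem_filter, Finset.mem_Ioc]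
    exact ⟨⟨(Nat.prime_of_mem_primeFactors hp).one_lt, (Nat.le_of_dvd hq.1 h2).trans hq.2⟩, h2⟩
  refine (Finset.sum_le_sum h1).trans ?_
  rw [Finset.sum_comm]
  have h2 : ∀ p ∈ Finset.Ioc 1 N, (∑ q ∈ Finset.Icc 1 N, if p ∣ q then (p : ℝ)⁻¹ else 0) ≤
      N * ((p : ℝ) ^ 2)⁻¹ := by
    intro p hp
    have hp0 : (0 : ℝ) < p := by
      have := (Finset.mem_Ioc.1 hp).1
      positivity
    rw [← Finset.sum_filter, Finset.sum_const, nsmul_eq_mul]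
    have hc : ((Finset.Icc 1 N).filter fun q ↦ p ∣ q).card = N / p := Nat.Ioc_filter_dvd_card_eq_div N p
    rw [hc]
    calc ((N / p : ℕ) : ℝ) * (p : ℝ)⁻¹ ≤ (N / p : ℝ) * (p : ℝ)⁻¹ := by
          gcongr; exact Nat.cast_div_le
      _ = _ := by field_simp
  refine (Finset.sum_le_sum h2).trans ?_
  rw [← Finset.mul_sum]
  rcases Nat.eq_zero_or_pos N with rfl | hN
  · simp
  · have := sum_Ioc_inv_sq_le_sub (α := ℝ) one_ne_zero hN
    have h3 : (0 : ℝ) ≤ (N : ℝ)⁻¹ := by positivity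
    refine mul_le_of_le_one_right (by positivity) ?_
    norm_num at this
    linarith

lemma exp_mul_le_totient {q : ℕ} {B : ℝ} (h : ∑ p ∈ q.primeFactors, (p : ℝ)⁻¹ ≤ B) :
    Real.exp (-(2 * B)) * q ≤ q.totient := by
  have h3 := cast_totient_eq_mul_prod q
  rw [h3, mul_comm]
  gcongr
  calc Real.exp (-(2 * B)) ≤ Real.exp (∑ p ∈ q.primeFactors, -(2 * (p : ℝ)⁻¹)) := by
        rw [Real.exp_le_exp, Finset.sum_neg_distrib, ← Finset.mul_sum]
        linarith
    _ = ∏ p ∈ q.primeFactors, Real.exp (-(2 * (p : ℝ)⁻¹)) := Real.exp_sum _ _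
    _ ≤ _ := by
        refine Finset.prod_le_prod (fun _ _ ↦ (Real.exp_pos _).le) fun p hp ↦ ?_
        have h2 : (2 : ℝ) ≤ p := by exact_mod_cast (Nat.prime_of_mem_primeFactors hp).two_le
        set t := (p : ℝ)⁻¹ with ht
        have ht2 : t ≤ 1 / 2 := by
          rw [ht, inv_le_comm₀ (by linarith) (by norm_num)]
          norm_num; exact_mod_cast h2
        have ht0 : 0 < t := by positivity
        have h4 := Real.add_one_le_exp (2 * t)
        rw [Real.exp_neg, inv_le_comm₀ (Real.exp_pos _) (by linarith)]
        refine le_trans ?_ h4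
        rw [inv_le_iff_one_le_mul₀ (by linarith)]
        nlinarith

open scoped Classical in
/-- A set of positive lower density has, in all large blocks of a suitable geometric
subdivision, a positive proportion of elements `q` with `φ(q) ≫ q`. -/
lemma exists_le_card_block {A : Set ℕ} (hA : 0 < lowerDensity A) :
    ∃ δ : ℝ, 0 < δ ∧ ∃ η : ℝ, 0 < η ∧ ∃ u : ℕ, 0 < u ∧ ∀ᶠ n : ℕ in atTop,
      δ * 2 ^ (u * (n + 1)) ≤ ((Finset.Ioc (2 ^ (u * n)) (2 ^ (u * (n + 1)))).filter
        fun q ↦ q ∈ A ∧ η * q ≤ q.totient).card := by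
  set d := lowerDensity A / 2 with hd
  have hd0 : 0 < d := by positivity
  have hev : ∀ᶠ N : ℕ in atTop, d < (((Finset.Icc 1 N).filter (· ∈ A)).card : ℝ) / N := by
    refine eventually_lt_of_lt_liminf (lt_of_lt_of_eq (show d < lowerDensity A by linarith) rfl) ?_
    exact isBoundedUnder_of ⟨0, fun N ↦ by positivity⟩
  obtain ⟨u, hu⟩ := pow_unbounded_of_one_lt (4 / d) (one_lt_two (α := ℝ))
  rw [div_lt_iff₀ hd0] at hu
  refine ⟨d / 2, by positivity, Real.exp (-(2 * (4 / d))), Real.exp_pos _, u + 1, by omega, ?_⟩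
  have htend : Tendsto (fun n : ℕ ↦ 2 ^ ((u + 1) * (n + 1))) atTop (atTop : Filter ℕ) := by
    refine tendsto_atTop_mono (fun n ↦ ?_) tendsto_id
    exact Nat.lt_two_pow_self.le.trans (Nat.pow_le_pow_right (by norm_num) (by simp only [id]; nlinarith))
  filter_upwards [htend.eventually hev] with n hn
  set N := 2 ^ ((u + 1) * (n + 1)) with hN
  have hN0 : (0 : ℝ) < N := by positivity
  rw [lt_div_iff₀ hN0] at hn
  set G := (Finset.Ioc (2 ^ ((u + 1) * n)) N).filter
    fun q ↦ q ∈ A ∧ Real.exp (-(2 * (4 / d))) * q ≤ q.totient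
  set bad := (Finset.Icc 1 N).filter fun q : ℕ ↦ 4 / d < ∑ p ∈ q.primeFactors, (p : ℝ)⁻¹
  have hsub : (Finset.Icc 1 N).filter (· ∈ A) ⊆ (Finset.Icc 1 (2 ^ ((u + 1) * n)) ∪ bad) ∪ G := by
    intro q hq
    simp only [G, bad, Finset.mem_union, Finset.mem_filter, Finset.mem_Icc, Finset.mem_Ioc] at hq ⊢
    by_cases h1 : q ≤ 2 ^ ((u + 1) * n)
    · exact Or.inl (Or.inl ⟨hq.1.1, h1⟩)
    · by_cases h2 : 4 / d < ∑ p ∈ q.primeFactors, (p : ℝ)⁻¹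
      · exact Or.inl (Or.inr ⟨hq.1, h2⟩)
      · exact Or.inr ⟨⟨not_le.1 h1, hq.1.2⟩, hq.2, exp_mul_le_totient (not_lt.1 h2)⟩
  have hcard := (Finset.card_le_card hsub).trans
    ((Finset.card_union_le _ _).trans (Nat.add_le_add_right (Finset.card_union_le _ _) _))
  rw [Nat.card_Icc, Nat.add_sub_cancel] at hcard
  have hcard' : (((Finset.Icc 1 N).filter (· ∈ A)).card : ℝ) ≤
      2 ^ ((u + 1) * n) + bad.card + G.card := by exact_mod_cast hcard
  have hbad : (bad.card : ℝ) * (4 / d) ≤ N := by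
    refine le_trans ?_ (sum_primeFactors_inv_le N)
    rw [← nsmul_eq_mul]
    refine (Finset.card_nsmul_le_sum bad _ _ fun q hq ↦ (Finset.mem_filter.1 hq).2.le).trans ?_
    exact Finset.sum_le_sum_of_subset_of_nonneg (Finset.filter_subset _ _)
      fun q _ _ ↦ Finset.sum_nonneg fun p _ ↦ by positivity
  have hbad' : (bad.card : ℝ) ≤ d / 4 * N := by
    rw [mul_div_assoc', div_le_iff₀ hd0] at hbad
    linarith
  have hsmall : (2 : ℝ) ^ ((u + 1) * n) ≤ d / 4 * N := by
    have e : (N : ℝ) = 2 ^ u * 2 * 2 ^ ((u + 1) * n) := by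
      rw [hN]; push_cast; ring
    rw [e]
    have : (0 : ℝ) < 2 ^ ((u + 1) * n) := by positivity
    nlinarith
  have eN : (2 : ℝ) ^ ((u + 1) * (n + 1)) = N := by rw [hN]; push_cast; rfl
  rw [eN]
  linarith

end Density

section Blocks

/-- The points of the form `p / q + t` with `0 < t < 1 / (2 q²)`, `p` coprime to `q` and
`p / q ∈ (x, y]`. -/
def approxSet (q : ℕ) (x y : ℝ) : Set ℝ :=
  ⋃ p ∈ coprimeNumerators q x y, Ioo ((p : ℝ) / q) (p / q + 1 / (2 * (q : ℝ) ^ 2))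

lemma measurableSet_approxSet (q : ℕ) (x y : ℝ) : MeasurableSet (approxSet q x y) :=
  Finset.measurableSet_biUnion _ fun _ _ ↦ measurableSet_Ioo

lemma volume_approxSet {q : ℕ} (hq : q ≠ 0) (x y : ℝ) :
    volume (approxSet q x y) =
      ENNReal.ofReal ((coprimeNumerators q x y).card * (1 / (2 * (q : ℝ) ^ 2))) := by
  have hq1 : (1 : ℝ) ≤ q := by exact_mod_cast Nat.one_le_iff_ne_zero.2 hq
  have hlt : ∀ {p p' : ℕ}, p < p' → (p : ℝ) / q + 1 / (2 * (q : ℝ) ^ 2) ≤ p' / q := by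
    intro p p' h
    have h' : (p : ℝ) + 1 ≤ p' := by exact_mod_cast h
    rw [div_add_div _ _ (by positivity) (by positivity), div_le_div_iff₀ (by positivity) (by positivity)]
    have : 0 ≤ (q : ℝ) ^ 2 * ((p' - p - 1) * (2 * q) + (2 * q - 1)) := by
      have : (0 : ℝ) ≤ p' - p - 1 := by linarith
      have : (0 : ℝ) ≤ 2 * q - 1 := by linarith
      positivity
    nlinarith
  rw [approxSet, measure_biUnion_finset]
  · simp_rw [Real.volume_Ioo, add_sub_cancel_left]
    rw [Finset.sum_const, nsmul_eq_mul, ENNReal.ofReal_mul (by positivity), ENNReal.ofReal_natCast]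
  · intro p _ p' _ hne
    refine Set.disjoint_left.2 fun α h h' ↦ ?_
    rcases lt_or_gt_of_ne hne with hpp | hpp
    · linarith [hlt hpp, h.2, h'.1]
    · linarith [hlt hpp, h.1, h'.2]
  · exact fun _ _ ↦ measurableSet_Ioo

lemma two_mul_lt_of_mem_Ioo_of_mem_Ioo {p q p' q' : ℕ} {α : ℝ} (hq : 0 < q) (hqq : q < q')
    (hc' : p'.Coprime q')
    (h : α ∈ Ioo ((p : ℝ) / q) (p / q + 1 / (2 * (q : ℝ) ^ 2)))
    (h' : α ∈ Ioo ((p' : ℝ) / q') (p' / q' + 1 / (2 * (q' : ℝ) ^ 2))) : 2 * q < q' := by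
  have hq0 : (0 : ℝ) < q := by exact_mod_cast hq
  have hqq' : (q : ℝ) < q' := by exact_mod_cast hqq
  have hq0' : (0 : ℝ) < q' := hq0.trans hqq'
  have hne : (p : ℤ) * q' - p' * q ≠ 0 := by
    intro h0
    have h1 : p * q' = p' * q := by exact_mod_cast sub_eq_zero.1 h0
    have h2 : q' ∣ q := hc'.symm.dvd_of_dvd_mul_left (h1 ▸ dvd_mul_left _ _)
    exact absurd (Nat.le_of_dvd hq h2) (not_le.2 hqq)
  have h1 : (1 : ℝ) ≤ |(p : ℝ) * q' - p' * q| := by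
    exact_mod_cast Int.one_le_abs hne
  have h2 : |(p : ℝ) / q - p' / q'| < 1 / (2 * (q : ℝ) ^ 2) := by
    have : 1 / (2 * (q' : ℝ) ^ 2) ≤ 1 / (2 * (q : ℝ) ^ 2) := by gcongr
    rw [abs_lt]
    constructor <;> linarith [h.1, h.2, h'.1, h'.2]
  rw [div_sub_div _ _ hq0.ne' hq0'.ne', abs_div, abs_of_pos (mul_pos hq0 hq0'),
    div_lt_div_iff₀ (by positivity) (by positivity), mul_comm (q : ℝ) p'] at h2
  have h3 : (2 : ℝ) * q < q' := by
    refine lt_of_mul_lt_mul_left ?_ hq0.le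
    have : (0 : ℝ) < 2 * (q : ℝ) ^ 2 := by positivity
    nlinarith
  exact_mod_cast h3

open scoped Classical in
lemma card_filter_mem_approxSet_le {a b : ℕ} {F : Finset ℕ} (hF : F ⊆ Finset.Ioc (2 ^ a) (2 ^ b))
    {x y : ℝ} (hx : 0 ≤ x) (hy : 0 ≤ y) (α : ℝ) :
    (F.filter fun q ↦ α ∈ approxSet q x y).card ≤ b + 1 - a := by
  rw [← Nat.card_Icc]
  have key : ∀ q q' : ℕ, 0 < q → q < q' → α ∈ approxSet q x y → α ∈ approxSet q' x y →
      2 * q < q' := by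
    intro q q' hq hqq h h'
    simp only [approxSet, mem_iUnion] at h h'
    obtain ⟨p, -, h⟩ := h
    obtain ⟨p', hp', h'⟩ := h'
    exact two_mul_lt_of_mem_Ioo_of_mem_Ioo hq hqq
      ((mem_coprimeNumerators (hq.trans hqq).ne' hx hy).1 hp').2 h h'
  have key' : ∀ q q' : ℕ, 0 < q → q < q' → α ∈ approxSet q x y → α ∈ approxSet q' x y →
      Nat.log 2 q ≠ Nat.log 2 q' := by
    intro q q' hq hqq h h' he
    have h1 := key q q' hq hqq h h'
    have h2 := Nat.pow_log_le_self 2 hq.ne'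
    have h3 := Nat.lt_pow_succ_log_self (b := 2) (by norm_num) q'
    rw [← he, pow_succ] at h3
    omega
  refine Finset.card_le_card_of_injOn (Nat.log 2) ?_ ?_
  · intro q hq
    have h1 := Finset.mem_Ioc.1 (hF (Finset.mem_filter.1 hq).1)
    rw [Finset.coe_Icc, mem_Icc]
    constructor
    · exact Nat.le_log_of_pow_le (by norm_num) h1.1.le
    · exact (Nat.log_mono_right h1.2).trans (Nat.log_pow (by norm_num) b).le
  · intro q hq q' hq' he
    have h1 := (Finset.mem_Ioc.1 (hF (Finset.mem_filter.1 hq).1)).1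
    have h1' := (Finset.mem_Ioc.1 (hF (Finset.mem_filter.1 hq').1)).1
    have h2 := (Finset.mem_filter.1 hq).2
    have h2' := (Finset.mem_filter.1 hq').2
    rcases lt_trichotomy q q' with h | h | h
    · exact absurd he (key' q q' ((Nat.zero_le _).trans_lt h1) h h2 h2')
    · exact h
    · exact absurd he.symm (key' q' q ((Nat.zero_le _).trans_lt h1') h h2' h2)

open scoped Classical in
lemma sum_measure_le_mul_measure_biUnion {X ι : Type*} [MeasurableSpace X] (μ : Measure X)
    (F : Finset ι) {E : ι → Set X} (hE : ∀ i ∈ F, MeasurableSet (E i)) {m : ℕ}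
    (hm : ∀ x, (F.filter fun i ↦ x ∈ E i).card ≤ m) :
    ∑ i ∈ F, μ (E i) ≤ m * μ (⋃ i ∈ F, E i) := by
  have hU : MeasurableSet (⋃ i ∈ F, E i) := Finset.measurableSet_biUnion _ hE
  calc ∑ i ∈ F, μ (E i) = ∑ i ∈ F, ∫⁻ x, (E i).indicator 1 x ∂μ :=
        Finset.sum_congr rfl fun i hi ↦ (lintegral_indicator_one (hE i hi)).symm
    _ = ∫⁻ x, ∑ i ∈ F, (E i).indicator 1 x ∂μ :=
        (lintegral_finsetSum' _ fun i hi ↦ (measurable_one.indicator (hE i hi)).aemeasurable).symm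
    _ ≤ ∫⁻ x, m * (⋃ i ∈ F, E i).indicator 1 x ∂μ := by
        refine lintegral_mono fun x ↦ ?_
        have h : ∑ i ∈ F, (E i).indicator (1 : X → ENNReal) x =
            (F.filter fun i ↦ x ∈ E i).card := by
          simp only [indicator_apply, Pi.one_apply, Finset.sum_boole]
        simp only [h]
        by_cases hx : x ∈ ⋃ i ∈ F, E i
        · rw [indicator_of_mem hx, Pi.one_apply, mul_one]
          exact_mod_cast hm x
        · rw [Finset.filter_eq_empty_iff.2 fun i hi hxi ↦ hx (mem_biUnion hi hxi)]
          simp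
    _ = m * μ (⋃ i ∈ F, E i) := by
        rw [lintegral_const_mul _ (measurable_one.indicator hU), lintegral_indicator_one hU]

lemma exists_block_sets {A : Set ℕ} (hA : 0 < lowerDensity A) :
    ∃ c : ℝ, 0 < c ∧ ∃ u : ℕ, 0 < u ∧ ∀ x y : ℝ, 0 ≤ x → x < y → ∀ᶠ n : ℕ in atTop,
      ∃ H ⊆ Ioo x y, MeasurableSet H ∧ ENNReal.ofReal (c * (y - x)) ≤ volume H ∧
        ∀ α ∈ H, ∃ q ∈ A, ∃ p : ℕ, p.Coprime q ∧ 2 ^ (u * n) < q ∧ q ≤ 2 ^ (u * (n + 1)) ∧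
          (p / q : ℝ) < α ∧ α < p / q + 1 / (2 * (q : ℝ) ^ 2) := by
  classical
  obtain ⟨δ, hδ, η, hη, u, hu, hev⟩ := exists_le_card_block hA
  refine ⟨δ * η / (8 * (u + 1)), by positivity, u, hu, fun x y hx hxy ↦ ?_⟩
  have hd : 0 < y - x := by linarith
  have hs : ∀ᶠ n : ℕ in atTop, 8 / ((y - x) * η) ≤ √n :=
    (Real.tendsto_sqrt_atTop.comp tendsto_natCast_atTop_atTop).eventually_ge_atTop _
  have ht : ∀ᶠ n : ℕ in atTop, 1 / (y - x) ≤ n :=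
    tendsto_natCast_atTop_atTop.eventually_ge_atTop _
  filter_upwards [hev, hs, ht] with n hn hns hnt
  set F := (Finset.Ioc (2 ^ (u * n)) (2 ^ (u * (n + 1)))).filter
    fun q ↦ q ∈ A ∧ η * q ≤ q.totient
  set z := (x + y) / 2 with hz
  have hz0 : 0 ≤ z := by linarith
  have hmemF : ∀ q ∈ F, (2 ^ (u * n) < q ∧ q ≤ 2 ^ (u * (n + 1))) ∧ q ∈ A ∧
      η * q ≤ q.totient := fun q hq ↦ by
    simpa only [F, Finset.mem_filter, Finset.mem_Ioc] using hq
  have hnq : ∀ q ∈ F, (n : ℝ) ≤ q := fun q hq ↦ by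
    have h1 := (hmemF q hq).1.1
    have h2 : n < 2 ^ n := Nat.lt_two_pow_self
    have h3 : 2 ^ n ≤ 2 ^ (u * n) := Nat.pow_le_pow_right (by norm_num) (by nlinarith)
    exact_mod_cast (by omega : n ≤ q)
  have hq1 : ∀ q ∈ F, (1 : ℝ) ≤ q := fun q hq ↦ by
    have h1 := (hmemF q hq).1.1
    exact_mod_cast (Nat.zero_le _).trans_lt h1
  refine ⟨⋃ q ∈ F, approxSet q x z, ?_, Finset.measurableSet_biUnion _ fun q _ ↦
    measurableSet_approxSet q x z, ?_, ?_⟩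
  · intro α hα
    simp only [approxSet, mem_iUnion] at hα
    obtain ⟨q, hq, p, hp, h1, h2⟩ := hα
    have hq0 : (0 : ℝ) < q := by linarith [hq1 q hq]
    have hp' := (mem_coprimeNumerators (by exact_mod_cast hq0.ne') hx hz0).1 hp
    have h3 : x < (p : ℝ) / q := by rw [lt_div_iff₀ hq0]; linarith [hp'.1.1]
    have h4 : (p : ℝ) / q ≤ z := by rw [div_le_iff₀ hq0]; linarith [hp'.1.2]
    have h5 : 1 / (2 * (q : ℝ) ^ 2) ≤ (y - x) / 2 := by
      have h6 : 1 / (y - x) ≤ q := hnt.trans (hnq q hq)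
      rw [div_le_iff₀ hd] at h6
      rw [div_le_div_iff₀ (by positivity) (by norm_num)]
      nlinarith [hq1 q hq]
    exact ⟨by linarith, by linarith⟩
  · have hvol : ∀ q ∈ F, ENNReal.ofReal ((y - x) * η / (8 * 2 ^ (u * (n + 1)))) ≤
        volume (approxSet q x z) := by
      intro q hq
      have h0 := hq1 q hq
      have hq0 : q ≠ 0 := by rintro rfl; norm_num at h0
      rw [volume_approxSet hq0]
      refine ENNReal.ofReal_le_ofReal ?_
      have h1 := le_card_coprimeNumerators hq0 hx (show x ≤ z by linarith)
      have h2 : 8 / ((y - x) * η) ≤ √q := hns.trans (Real.sqrt_le_sqrt (hnq q hq))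
      rw [div_le_iff₀ (by positivity)] at h2
      have h3 : √(q : ℝ) * √q = q := Real.mul_self_sqrt (by positivity)
      have h4 : 8 * √(q : ℝ) ≤ (y - x) * η * q := by
        calc 8 * √(q : ℝ) ≤ (√q * ((y - x) * η)) * √q := by gcongr
          _ = (y - x) * η * (√(q : ℝ) * √q) := by ring
          _ = _ := by rw [h3]
      have h5 : (z - x) * (η * q) ≤ (z - x) * q.totient := by
        have : 0 ≤ z - x := by linarith
        gcongr
        exact (hmemF q hq).2.2
      have h6 : (y - x) * η * q / 4 ≤ (coprimeNumerators q x z).card := by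
        have : (z - x) * (η * q) = (y - x) * η * q / 2 := by rw [hz]; ring
        linarith
      have h7 : (q : ℝ) ≤ 2 ^ (u * (n + 1)) := by exact_mod_cast (hmemF q hq).1.2
      calc (y - x) * η / (8 * 2 ^ (u * (n + 1))) ≤ (y - x) * η / (8 * q) := by gcongr
        _ = (y - x) * η * q / 4 * (1 / (2 * (q : ℝ) ^ 2)) := by field_simp; norm_num
        _ ≤ _ := by gcongr
    have hsum := sum_measure_le_mul_measure_biUnion volume F
      (fun q _ ↦ measurableSet_approxSet q x z)
      (fun α ↦ card_filter_mem_approxSet_le (Finset.filter_subset _ _) hx hz0 α)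
    have hm : u * (n + 1) + 1 - u * n = u + 1 := by
      rw [mul_add]; omega
    rw [hm] at hsum
    have h1 : ENNReal.ofReal (δ * η * (y - x) / 8) ≤ ∑ q ∈ F, volume (approxSet q x z) := by
      refine le_trans ?_ (Finset.card_nsmul_le_sum F _ _ hvol)
      rw [nsmul_eq_mul, ← ENNReal.ofReal_natCast, ← ENNReal.ofReal_mul (by positivity)]
      refine ENNReal.ofReal_le_ofReal ?_
      calc δ * η * (y - x) / 8 =
          δ * 2 ^ (u * (n + 1)) * ((y - x) * η / (8 * 2 ^ (u * (n + 1)))) := by field_simp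
        _ ≤ _ := by gcongr
    have h2 := h1.trans hsum
    have e : δ * η * (y - x) / 8 = ((u + 1 : ℕ) : ℝ) * (δ * η / (8 * (u + 1)) * (y - x)) := by
      push_cast; field_simp
    rw [e, ENNReal.ofReal_mul (by positivity), ENNReal.ofReal_natCast] at h2
    exact (ENNReal.mul_le_mul_iff_right (by simp) (by simp)).1 h2
  · intro α hα
    simp only [approxSet, mem_iUnion] at hα
    obtain ⟨q, hq, p, hp, h1, h2⟩ := hα
    have hF := hmemF q hq
    have hq0 : q ≠ 0 := ((Nat.zero_le _).trans_lt hF.1.1).ne'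
    exact ⟨q, hF.2.1, p, ((mem_coprimeNumerators hq0 hx hz0).1 hp).2, hF.1.1, hF.1.2, h1, h2⟩

end Blocks

section Divergence

/-- If all the sets `H n` have measure at least `c` and `∑ b n = ∞`, then `∑ b n 1_{H n} = ∞` on a
set of measure at least `c`. -/
lemma le_measure_tsum_indicator_eq_top {X : Type*} [MeasurableSpace X] (μ : Measure X)
    [IsFiniteMeasure μ] {H : ℕ → Set X} (hH : ∀ n, MeasurableSet (H n)) {I : Set X}
    (hI : MeasurableSet I) (hHI : ∀ n, H n ⊆ I) {c : ENNReal} (hc : ∀ n, c ≤ μ (H n))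
    {b : ℕ → ENNReal} (hb : ∑' n, b n = ⊤) :
    c ≤ μ {x ∈ I | ∑' n, (H n).indicator (fun _ ↦ b n) x = ⊤} := by
  set F : X → ENNReal := fun x ↦ ∑' n, (H n).indicator (fun _ ↦ b n) x with hF
  have hFm : Measurable F := Measurable.tsum fun n ↦ measurable_const.indicator (hH n)
  set W : ℕ → Set X := fun T ↦ {x ∈ I | (T : ENNReal) < F x} with hW
  have hWm : ∀ T, MeasurableSet (W T) := fun T ↦ hI.inter (measurableSet_lt measurable_const hFm)
  have hcW : ∀ T, c ≤ μ (W T) := by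
    intro T
    by_contra! hlt
    set V := I \ W T with hV
    have hVm : MeasurableSet V := hI.diff (hWm T)
    have h1 : ∫⁻ x in V, F x ∂μ ≤ T * μ V := by
      rw [← setLIntegral_const]
      refine setLIntegral_mono measurable_const fun x hx ↦ ?_
      by_contra! h
      exact hx.2 ⟨hx.1, h⟩
    have h2 : ∫⁻ x in V, F x ∂μ = ∑' n, b n * μ (H n ∩ V) := by
      rw [hF, lintegral_tsum fun n ↦ (measurable_const.indicator (hH n)).aemeasurable]
      refine tsum_congr fun n ↦ ?_
      rw [lintegral_indicator_const (hH n), Measure.restrict_apply (hH n)]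
    have h3 : ∑' n, b n * (c - μ (W T)) ≤ ∑' n, b n * μ (H n ∩ V) := by
      refine ENNReal.tsum_le_tsum fun n ↦ mul_le_mul_right ?_ _
      rw [tsub_le_iff_right]
      refine (hc n).trans ((measure_mono fun x hx ↦ ?_).trans (measure_union_le _ _))
      by_cases hxW : x ∈ W T
      · exact Or.inr hxW
      · exact Or.inl ⟨hx, hHI n hx, hxW⟩
    rw [ENNReal.tsum_mul_right, hb, ENNReal.top_mul (tsub_pos_of_lt hlt).ne', ← h2] at h3
    exact absurd (h3.trans h1) (not_le.2 (ENNReal.mul_lt_top (by simp) (measure_lt_top _ _)))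
  have hanti : Antitone W := fun S T hST x hx ↦ ⟨hx.1, lt_of_le_of_lt (by exact_mod_cast hST) hx.2⟩
  have hlim := tendsto_measure_iInter_atTop (μ := μ) (fun T ↦ (hWm T).nullMeasurableSet) hanti
    ⟨0, measure_ne_top _ _⟩
  refine (ge_of_tendsto' hlim hcW).trans (measure_mono fun x hx ↦ ?_)
  rw [mem_iInter] at hx
  exact ⟨(hx 0).1, ENNReal.eq_top_of_forall_nnreal_le fun r ↦ by
    obtain ⟨T, hT⟩ := exists_nat_ge r
    exact le_trans (by exact_mod_cast hT) (hx T).2.le⟩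

lemma not_summable_one_div_mul_log (D : ℕ) (hD : 0 < D) :
    ¬ Summable fun n : ℕ ↦ (1 : ℝ) / (D * (n * (Nat.log 2 n + 1)) : ℕ) := by
  intro h
  have hanti : ∀ ⦃m n : ℕ⦄, 0 < m → m ≤ n → (1 : ℝ) / (D * (n * (Nat.log 2 n + 1)) : ℕ) ≤
      1 / (D * (m * (Nat.log 2 m + 1)) : ℕ) := by
    intro m n hm hmn
    have h1 : 0 < D * (m * (Nat.log 2 m + 1)) := by positivity
    have h2 : D * (m * (Nat.log 2 m + 1)) ≤ D * (n * (Nat.log 2 n + 1)) := by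
      have := Nat.log_mono_right (b := 2) hmn
      gcongr
    exact one_div_le_one_div_of_le (by exact_mod_cast h1) (by exact_mod_cast h2)
  rw [← summable_condensed_iff_of_nonneg (fun n ↦ by positivity) hanti] at h
  have h' : Summable fun k : ℕ ↦ (1 : ℝ) / ((k + 1 : ℕ) : ℝ) := by
    refine (h.mul_left (D : ℝ)).congr fun k ↦ ?_
    rw [Nat.log_pow (by norm_num)]
    push_cast
    field_simp
  exact Real.not_summable_one_div_natCast ((summable_nat_add_iff 1).1 h')

/-- A set occupying at most a fixed proportion `1 - c < 1` of every interval is null. -/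
lemma volume_inter_Ioo_eq_zero {S : Set ℝ} {c : ℝ} (hc : 0 < c)
    (h : ∀ x y, 0 ≤ x → x < y → y ≤ 1 → volume (S ∩ Ioo x y) ≤ ENNReal.ofReal ((1 - c) * (y - x))) :
    volume (S ∩ Ioo 0 1) = 0 := by
  have hd := IsUnifLocDoublingMeasure.ae_tendsto_measure_inter_div (volume : Measure ℝ)
    (S ∩ Ioo 0 1) 1
  have hmem : ∀ᵐ x ∂(volume.restrict (S ∩ Ioo 0 1)), x ∈ Ioo (0 : ℝ) 1 :=
    ae_mono (Measure.restrict_mono_set _ inter_subset_right) (ae_restrict_mem measurableSet_Ioo)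
  have hF : ∀ᵐ x ∂(volume.restrict (S ∩ Ioo (0 : ℝ) 1)), False := by
    filter_upwards [hd, hmem] with x hx hx01
    have hδ : Tendsto (fun j : ℕ ↦ 1 / ((j : ℝ) + 1)) atTop (𝓝[>] 0) :=
      tendsto_nhdsWithin_iff.2 ⟨tendsto_one_div_add_atTop_nhds_zero_nat,
        Eventually.of_forall fun j ↦ by simp only [mem_Ioi]; positivity⟩
    have hlim := hx (fun _ : ℕ ↦ x) _ hδ (Eventually.of_forall fun j ↦ by
      refine Metric.mem_closedBall_self ?_; positivity)
    have hsmall : ∀ᶠ j : ℕ in atTop, 1 / ((j : ℝ) + 1) < min x (1 - x) :=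
      tendsto_one_div_add_atTop_nhds_zero_nat.eventually_lt_const
        (lt_min hx01.1 (by linarith [hx01.2]))
    have hle : ∀ᶠ j : ℕ in atTop, volume (S ∩ Ioo 0 1 ∩ Metric.closedBall x (1 / ((j : ℝ) + 1))) /
        volume (Metric.closedBall x (1 / ((j : ℝ) + 1))) ≤ ENNReal.ofReal (1 - c) := by
      filter_upwards [hsmall] with j hj
      set t := 1 / ((j : ℝ) + 1) with ht
      have ht0 : 0 < t := by positivity
      rw [lt_min_iff] at hj
      refine ENNReal.div_le_of_le_mul ?_
      rw [Real.volume_closedBall, ← ENNReal.ofReal_mul' (by positivity)]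
      have h1 := h (x - t) (x + t) (by linarith) (by linarith) (by linarith)
      rw [show x + t - (x - t) = 2 * t by ring] at h1
      refine le_trans ?_ h1
      have hI : Metric.closedBall x t =ᵐ[volume] Ioo (x - t) (x + t) := by
        rw [Real.closedBall_eq_Icc]
        exact Ioo_ae_eq_Icc.symm
      rw [measure_congr (ae_eq_set_inter (s := S ∩ Ioo 0 1) .rfl hI)]
      exact measure_mono (inter_subset_inter_left _ inter_subset_left)
    have := le_of_tendsto hlim hle
    rw [ENNReal.one_le_ofReal] at this
    linarith
  rw [eventually_false_iff_eq_bot, ae_eq_bot, Measure.restrict_eq_zero] at hF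
  exact hF

open scoped Classical in
lemma exists_volume_summable_inter_Ioo_le {A : Set ℕ} (hA : 0 < lowerDensity A) :
    ∃ c : ℝ, 0 < c ∧ ∀ x y : ℝ, 0 ≤ x → x < y → y ≤ 1 →
      volume ({α | Summable fun k ↦
        if Even k ∧ 0 < k ∧ cfQ α k ∈ A then (1 : ℝ) / cfS α k else 0} ∩ Ioo x y) ≤
        ENNReal.ofReal ((1 - c) * (y - x)) := by
  obtain ⟨c, hc, u, hu, hblock⟩ := exists_block_sets hA
  refine ⟨c / 2, by positivity, fun x y hx hxy hy ↦ ?_⟩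
  have hd : 0 < y - x := by linarith
  set ε := c * (y - x) / 2 with hε
  have hε0 : 0 < ε := by positivity
  obtain ⟨D, hD, hDev⟩ := exists_unitMeasure_le_cfS_le (2 * u) hε0
  have hDev' := (tendsto_add_atTop_nat 1).eventually hDev
  obtain ⟨n₀, hn₀⟩ := eventually_atTop.1 ((hblock x y hx hxy).and hDev')
  choose H hHI hHm hHv hHq using fun n ↦ (hn₀ (n + n₀) (Nat.le_add_left _ _)).1
  have hbad := fun n ↦ (hn₀ (n + n₀) (Nat.le_add_left _ _)).2
  set B : ℕ → ℕ := fun n ↦ D * (n * (Nat.log 2 n + 1)) with hB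
  set K : ℕ → Set ℝ := fun n ↦ H n ∩ {α | cfS α (2 * u * (n + n₀ + 1)) < B (n + n₀ + 1)} with hK
  have hKm : ∀ n, MeasurableSet (K n) := fun n ↦
    (hHm n).inter (measurableSet_lt (measurable_cfS _) measurable_const)
  have hKI : ∀ n, K n ⊆ Ioo x y := fun n ↦ inter_subset_left.trans (hHI n)
  have hIoo : Ioo x y ⊆ Ioo 0 1 := Ioo_subset_Ioo hx hy
  have hunit : ∀ s ⊆ Ioo x y, unitMeasure s = volume s := fun s hs ↦ by
    rw [unitMeasure, Measure.restrict_eq_self _ (hs.trans hIoo)]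
  have hKv : ∀ n, ENNReal.ofReal ε ≤ unitMeasure (K n) := by
    intro n
    have h1 : unitMeasure (H n) ≤ unitMeasure (K n) + ENNReal.ofReal ε := by
      refine (measure_mono fun α hα ↦ ?_).trans
        ((measure_union_le _ _).trans (add_le_add_right (hbad n) _))
      by_cases h : cfS α (2 * u * (n + n₀ + 1)) < B (n + n₀ + 1)
      · exact Or.inl ⟨hα, h⟩
      · exact Or.inr (not_lt.1 h)
    have h2 := (hHv n).trans_eq (hunit _ (hHI n)).symm
    have h3 : ENNReal.ofReal (c * (y - x)) = ENNReal.ofReal ε + ENNReal.ofReal ε := by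
      rw [← ENNReal.ofReal_add hε0.le hε0.le]
      congr 1
      rw [hε]; ring
    rw [h3] at h2
    exact (ENNReal.add_le_add_iff_right ENNReal.ofReal_ne_top).1 (h2.trans h1)
  have hbsum : ∑' n, ENNReal.ofReal (1 / (B (n + n₀ + 1) : ℝ)) = ⊤ := by
    by_contra hne
    have hs := ENNReal.summable_toReal hne
    refine not_summable_one_div_mul_log D hD ((summable_nat_add_iff (n₀ + 1)).1 (hs.congr fun n ↦ ?_))
    rw [ENNReal.toReal_ofReal (by positivity), add_assoc]
  have hmain := le_measure_tsum_indicator_eq_top unitMeasure hKm measurableSet_Ioo hKI hKv hbsum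
  set W := {α ∈ Ioo x y | ∑' n, (K n).indicator
    (fun _ ↦ ENNReal.ofReal (1 / (B (n + n₀ + 1) : ℝ))) α = ⊤} with hW
  have hWI : W ⊆ Ioo x y := fun α hα ↦ hα.1
  have hWm : MeasurableSet W := measurableSet_Ioo.inter (measurableSet_eq_fun
    (Measurable.tsum fun n ↦ measurable_const.indicator (hKm n)) measurable_const)
  have hWdiv : ∀ α ∈ W, Irrational α → ¬ Summable fun k ↦
      if Even k ∧ 0 < k ∧ cfQ α k ∈ A then (1 : ℝ) / cfS α k else 0 := by
    intro α hα hirr hsum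
    have hα01 := hIoo hα.1
    set f : ℕ → ℝ := fun k ↦ if Even k ∧ 0 < k ∧ cfQ α k ∈ A then (1 : ℝ) / cfS α k else 0 with hf
    have hf0 : ∀ k, 0 ≤ f k := fun k ↦ by
      simp only [hf]; split_ifs <;> positivity
    have hex : ∀ n : {n | α ∈ K n}, ∃ k, 2 ^ (u * (n + n₀)) < cfQ α k ∧
        cfQ α k ≤ 2 ^ (u * (n + n₀ + 1)) ∧ 1 / (B (n + n₀ + 1) : ℝ) ≤ f k := by
      rintro ⟨n, hn⟩
      obtain ⟨q, hqA, p, hc, hq1, hq2, hl, hr⟩ := hHq n α hn.1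
      have hq2' : 2 ≤ q := by
        have := Nat.one_le_two_pow (n := u * (n + n₀))
        exact this.trans_lt hq1
      obtain ⟨k, hke, hk0, hkq⟩ := exists_even_cfQ_eq hirr hα01.1 hα01.2 hq2' hc hl hr
      refine ⟨k, hkq ▸ hq1, hkq ▸ hq2, ?_⟩
      have hfk : f k = 1 / cfS α k := if_pos ⟨hke, hk0, hkq ▸ hqA⟩
      rw [hfk]
      obtain ⟨j, rfl⟩ := hke
      have hj : 2 ^ j ≤ 2 ^ (u * (n + n₀ + 1)) := by
        refine (two_pow_le_cfQ hirr j).trans ?_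
        rw [two_mul, hkq]
        exact hq2
      have hj' : j ≤ u * (n + n₀ + 1) := (Nat.pow_le_pow_iff_right (by norm_num)).1 hj
      have hS : cfS α (j + j) ≤ B (n + n₀ + 1) := by
        refine (cfS_mono α ?_).trans (le_of_lt hn.2)
        rw [mul_assoc]; omega
      have hS0 : 0 < cfS α (j + j) := cfS_pos hirr hk0
      exact one_div_le_one_div_of_le (by exact_mod_cast hS0) (by exact_mod_cast hS)
    choose k hk1 hk2 hk3 using hex
    have hlt : ∀ m n : {n | α ∈ K n}, (m : ℕ) < n → k m ≠ k n := by
      intro m n hmn he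
      have h1 := hk2 m
      have h2 := hk1 n
      rw [he] at h1
      have h3 : 2 ^ (u * (m + n₀ + 1)) ≤ 2 ^ (u * (n + n₀)) :=
        Nat.pow_le_pow_right (by norm_num) (Nat.mul_le_mul_left _ (by omega))
      exact absurd (h1.trans h3) (not_le.2 h2)
    have hinj : Function.Injective k := by
      intro m n he
      rcases lt_trichotomy (m : ℕ) n with h | h | h
      · exact absurd he (hlt m n h)
      · exact Subtype.ext h
      · exact absurd he.symm (hlt n m h)
    refine hsum.tsum_ofReal_ne_top ?_
    rw [eq_top_iff, ← hα.2]
    calc ∑' n, (K n).indicator (fun _ ↦ ENNReal.ofReal (1 / (B (n + n₀ + 1) : ℝ))) α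
        = ∑' n, {n | α ∈ K n}.indicator
            (fun n ↦ ENNReal.ofReal (1 / (B (n + n₀ + 1) : ℝ))) n := rfl
      _ = ∑' n : {n | α ∈ K n}, ENNReal.ofReal (1 / (B (n + n₀ + 1) : ℝ)) :=
          (tsum_subtype {n | α ∈ K n} fun n ↦ ENNReal.ofReal (1 / (B (n + n₀ + 1) : ℝ))).symm
      _ ≤ ∑' n : {n | α ∈ K n}, ENNReal.ofReal (f (k n)) :=
          ENNReal.tsum_le_tsum fun n ↦ ENNReal.ofReal_le_ofReal (hk3 n)
      _ ≤ ∑' k, ENNReal.ofReal (f k) :=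
          ENNReal.tsum_comp_le_tsum_of_injective hinj fun k ↦ ENNReal.ofReal (f k)
  rw [hunit W hWI] at hmain
  calc _ ≤ volume (Ioo x y \ W) := by
        refine measure_mono_ae ?_
        filter_upwards [ae_irrational] with α hirr hα
        exact ⟨hα.2, fun h ↦ hWdiv α h hirr hα.1⟩
    _ = ENNReal.ofReal (y - x) - volume W := by
        rw [measure_sdiff hWI hWm.nullMeasurableSet (ne_top_of_le_ne_top (by simp)
          (measure_mono hWI)), Real.volume_Ioo]
    _ ≤ ENNReal.ofReal (y - x) - ENNReal.ofReal ε := tsub_le_tsub_left hmain _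
    _ = ENNReal.ofReal ((1 - c / 2) * (y - x)) := by
        rw [← ENNReal.ofReal_sub _ hε0.le]
        congr 1
        rw [hε]; ring

end Divergence

section Circle

lemma quasiMeasurePreserving_iota : Measure.QuasiMeasurePreserving iota volume unitMeasure := by
  have hm : Measurable iota :=
    measurable_subtype_coe.comp (AddCircle.measurableEquivIco 1 0).measurable
  refine ⟨hm, ?_⟩
  have hmk := UnitAddCircle.measurePreserving_mk 0
  have h01 : (volume.restrict (Ioc (0 : ℝ) (0 + 1))) = unitMeasure := by
    rw [zero_add, unitMeasure, Measure.restrict_congr_set Ioo_ae_eq_Ioc]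
  rw [h01] at hmk
  rw [← hmk.map_eq, Measure.map_map hm hmk.measurable]
  have hid : iota ∘ (fun x : ℝ ↦ (x : UnitAddCircle)) =ᵐ[unitMeasure] id := by
    filter_upwards [ae_unitMeasure] with x hx
    exact AddCircle.equivIco_coe_of_mem (p := 1) (a := 0) ⟨hx.2.1.le, by linarith [hx.2.2]⟩
  rw [Measure.map_congr hid, Measure.map_id]

end Circle

section Main

lemma ae_exists_strictMono_tendsto {A : Set ℕ} (hA : 0 < lowerDensity A) :
    ∀ᵐ α ∂unitMeasure, ∃ k : ℕ → ℕ,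
      StrictMono k ∧ (∀ j, Even (k j)) ∧ (∀ j, 0 < k j) ∧ (∀ j, cfQ α (k j) ∈ A) ∧
      Tendsto (fun j ↦ (∑ i ∈ Finset.Icc 1 (k j), (cfA α i : ℝ)) / (cfA α (k j + 1)))
        atTop (𝓝 0) := by
  classical
  obtain ⟨c, hc, hle⟩ := exists_volume_summable_inter_Ioo_le hA
  have hnull := volume_inter_Ioo_eq_zero hc hle
  have hdiv : ∀ᵐ α ∂unitMeasure, ¬ Summable fun k ↦
      if Even k ∧ 0 < k ∧ cfQ α k ∈ A then (1 : ℝ) / cfS α k else 0 := by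
    rw [unitMeasure, ae_restrict_iff' measurableSet_Ioo]
    filter_upwards [measure_eq_zero_iff_ae_notMem.1 hnull] with α h hα hs
    exact h ⟨hs, hα⟩
  have hfreq := fun M : ℕ ↦ ae_frequently_mul_cfS_le_cfA
    (fun k q ↦ Even k ∧ 0 < k ∧ q ∈ A) (fun q h ↦ lt_irrefl 0 h.2.1) M.succ_pos
  filter_upwards [hdiv, ae_all_iff.2 hfreq, ae_unitMeasure] with α hd hf hα
  obtain ⟨k, hk, hkM⟩ := extraction_forall_of_frequently fun M ↦ hf M (by convert hd)
  refine ⟨k, hk, fun j ↦ (hkM j).1.1, fun j ↦ (hkM j).1.2.1, fun j ↦ (hkM j).1.2.2, ?_⟩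
  refine squeeze_zero (fun j ↦ by positivity) (fun j ↦ ?_) tendsto_one_div_add_atTop_nhds_zero_nat
  have h1 : ((j : ℝ) + 1) * ∑ i ∈ Finset.Icc 1 (k j), (cfA α i : ℝ) ≤ cfA α (k j + 1) := by
    exact_mod_cast (hkM j).2
  have h2 : (0 : ℝ) < cfA α (k j + 1) := by exact_mod_cast cfA_succ_pos hα.1 (k j)
  rw [div_le_div_iff₀ h2 (by positivity)]
  linarith

end Main

theorem exists_large_partial_quotients_even (A : Set ℕ) (hA : 0 < lowerDensity A) :
    ∀ᵐ α ∂(volume : Measure UnitAddCircle), ∃ k : ℕ → ℕ,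
      StrictMono k ∧ (∀ j, Even (k j)) ∧ (∀ j, 0 < k j) ∧
      (∀ j, cfQ (iota α) (k j) ∈ A) ∧
      Filter.Tendsto
        (fun j => (∑ i ∈ Finset.Icc 1 (k j), (cfA (iota α) i : ℝ)) / (cfA (iota α) (k j + 1)))
        Filter.atTop (nhds 0) := by
  filter_upwards [quasiMeasurePreserving_iota.ae (ae_exists_strictMono_tendsto hA)] with α h
  exact h
end
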